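/- Let k be an algebraically closed field of characteristic p > 0, let G be a normal subgroup of a finite group G̃, let B be a block of kG, and let M be an I_{G̃}(B)-invariant B-module. If the induced module Ind_G^{G̃} M is a support τ-tilting kG̃-module, then M is a support τ-tilting B-module. -/

import Mathlib

/-!
Common definitions: τ-tilting theory over a ring, blocks of group algebras,
conjugate modules and induced modules.

Since group algebras (and their blocks) are symmetric algebras, the
Auslander–Reiten translate is `τ = Ω²` computed via (minimal) projective covers;
τ-rigidity is formulated accordingly.  Support τ-tilting modules are formulated
via support τ-tilting pairs: `M` is support τ-tilting iff `M` is τ-rigid and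
there is a projective module `P` with `Hom(P, M) = 0` and `|M| + |P| = |Λ|`
(the number of simple modules), which is the standard equivalent
characterisation (Adachi–Iyama–Reiten, Prop. 2.3; Remark 2.2 of the paper).
-/

universe u

section GeneralDefs

variable (A : Type u) [Ring A]

/-- A module is indecomposable if it is nontrivial and has no nontrivial
direct sum decomposition. -/
def IsIndecModule (X : Type u) [AddCommGroup X] [Module A X] : Prop :=
  Nontrivial X ∧ ∀ U V : Submodule A X, IsCompl U V → U = ⊥ ∨ V = ⊥

/-- `|M|`: the number of isomorphism classes of indecomposable direct summands
of `M`. -/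
noncomputable def numIndec (M : Type u) [AddCommGroup M] [Module A M] : ℕ :=
  Nat.card (Quot fun
    (L L' : {L : Submodule A M // (∃ L'', IsCompl L L'') ∧ IsIndecModule A L}) =>
      Nonempty (L.1 ≃ₗ[A] L'.1))

/-- `|A|`: the number of isomorphism classes of simple `A`-modules. -/
noncomputable def numSimples : ℕ :=
  Nat.card (Quot fun (X Y : {X : ModuleCat.{u} A // IsSimpleModule A X}) =>
    Nonempty ((X.1 : Type u) ≃ₗ[A] (Y.1 : Type u)))

/-- The number of isomorphism classes of simple `A`-modules lying in the block
with block idempotent `b` (i.e. on which `b` acts as the identity). -/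
noncomputable def numSimplesIn (b : A) : ℕ :=
  Nat.card (Quot fun
    (X Y : {X : ModuleCat.{u} A //
        IsSimpleModule A X ∧ ∀ v : (X : Type u), b • v = v}) =>
      Nonempty ((X.1 : Type u) ≃ₗ[A] (Y.1 : Type u)))

/-- `π : P → M` is a projective cover: `P` is projective, `π` is surjective and
`ker π` is superfluous (i.e. `π` is an essential epimorphism). -/
def IsProjCover {P M : Type u} [AddCommGroup P] [Module A P]
    [AddCommGroup M] [Module A M] (π : P →ₗ[A] M) : Prop :=
  Module.Projective A P ∧ Function.Surjective π ∧
    ∀ N : Submodule A P, N ⊔ LinearMap.ker π = ⊤ → N = ⊤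

/-- `M` is τ-rigid: `Hom(M, τ M) = 0`, where for the symmetric algebras
considered here `τ M = Ω² M` is computed from minimal projective presentations:
for (any) projective cover `π₀ : P₀ → M` and projective cover
`π₁ : P₁ → ker π₀`, one has `τ M = ker π₁`. -/
def IsTauRigid (M : Type u) [AddCommGroup M] [Module A M] : Prop :=
  ∀ (P₀ : Type u) [AddCommGroup P₀] [Module A P₀] (π₀ : P₀ →ₗ[A] M),
    IsProjCover A π₀ →
    ∀ (P₁ : Type u) [AddCommGroup P₁] [Module A P₁]
      (π₁ : P₁ →ₗ[A] ↥(LinearMap.ker π₀)),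
      IsProjCover A π₁ →
      ∀ g : M →ₗ[A] ↥(LinearMap.ker π₁), g = 0

/-- `M` is a support τ-tilting `A`-module (via support τ-tilting pairs):
`M` is τ-rigid and there is a (finitely generated) projective `A`-module `P`
with `Hom_A(P, M) = 0` and `|M| + |P| = |A|`. -/
def IsSupportTauTilting (M : Type u) [AddCommGroup M] [Module A M] : Prop :=
  IsTauRigid A M ∧
  ∃ P : ModuleCat.{u} A, Module.Projective A P ∧ Module.Finite A P ∧
    (∀ f : (P : Type u) →ₗ[A] M, f = 0) ∧
    numIndec A M + numIndec A (P : Type u) = numSimples A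

/-- `b` is a block idempotent: a primitive central idempotent of `A`.
The corresponding block is `B = A * b`. -/
def IsBlockIdem (b : A) : Prop :=
  b ≠ 0 ∧ b * b = b ∧ (∀ r : A, b * r = r * b) ∧
  ∀ c : A, c * c = c → (∀ r : A, c * r = r * c) → b * c = c → c = 0 ∨ c = b

/-- `M` is a support τ-tilting module over the block `B` with block idempotent
`b`: `M` lies in `B`, is τ-rigid (over `B`, equivalently over `A`) and there is
a projective module `P` lying in `B` with `Hom(P, M) = 0` and
`|M| + |P| = |B|`. -/
def IsSupportTauTiltingBlock (b : A) (M : Type u) [AddCommGroup M]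
    [Module A M] : Prop :=
  (∀ m : M, b • m = m) ∧ IsTauRigid A M ∧
  ∃ P : ModuleCat.{u} A, Module.Projective A P ∧ Module.Finite A P ∧
    (∀ v : (P : Type u), b • v = v) ∧
    (∀ f : (P : Type u) →ₗ[A] M, f = 0) ∧
    numIndec A M + numIndec A (P : Type u) = numSimplesIn A b

/-- The partial order on support τ-tilting modules: `M ≥ M'` iff there are
`r > 0` and an epimorphism `M^{⊕ r} ↠ M'`. -/
def stGE (M M' : Type u) [AddCommGroup M] [Module A M]
    [AddCommGroup M'] [Module A M'] : Prop :=
  ∃ r : ℕ, 0 < r ∧ ∃ φ : (Fin r → M) →ₗ[A] M', Function.Surjective φ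

/-- `X ∈ add M`: `X` is a direct summand of a finite direct sum of copies
of `M`. -/
def InAdd (M X : Type u) [AddCommGroup M] [Module A M]
    [AddCommGroup X] [Module A X] : Prop :=
  ∃ (n : ℕ) (i : X →ₗ[A] (Fin n → M)) (p : (Fin n → M) →ₗ[A] X),
    p.comp i = LinearMap.id

/-- For a central idempotent `b` of `A`, the direct summand `b • N` of an
`A`-module `N`, realised as the submodule of elements on which `b` acts as the
identity. -/
def blockComponent (b : A) (hb : ∀ r : A, b * r = r * b)
    (N : Type u) [AddCommGroup N] [Module A N] : Submodule A N where
  carrier := {n | b • n = n}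
  add_mem' := by
    intro a c ha hc
    simp only [Set.mem_setOf_eq, smul_add] at *
    rw [ha, hc]
  zero_mem' := by simp
  smul_mem' := by
    intro r n hn
    simp only [Set.mem_setOf_eq] at *
    rw [← mul_smul, hb, mul_smul, hn]

end GeneralDefs

section InducedDefs

/-- `(N, j)` is the module induced from `M` along the ring homomorphism
`ι : R →+* S`, i.e. `N ≅ S ⊗_R M`, characterised by the universal property of
extension of scalars: `j : M → N` is `R`-linear (with `R` acting on `N` via
`ι`) and every `R`-linear map from `M` to (the restriction of) an `S`-module
`X` factors uniquely through an `S`-linear map `N → X`. -/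
def IsInducedMod {R S : Type u} [Ring R] [Ring S] (ι : R →+* S)
    (M : Type u) [AddCommGroup M] [Module R M]
    (N : Type u) [AddCommGroup N] [Module S N] (j : M →+ N) : Prop :=
  (∀ (r : R) (m : M), j (r • m) = ι r • j m) ∧
  ∀ (X : Type u) [AddCommGroup X] [Module S X] (f : M →+ X),
    (∀ (r : R) (m : M), f (r • m) = ι r • f m) →
    ∃! g : N →ₗ[S] X, ∀ m : M, g (j m) = f m

end InducedDefs

section GroupDefs

variable (k : Type u) [Field k] (Gt : Type u) [Group Gt] (G : Subgroup Gt)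
  [G.Normal]

/-- The ring automorphism of `kG` induced by conjugation by `x ∈ G̃` on the
normal subgroup `G`. -/
noncomputable def conjRingHom (x : Gt) :
    MonoidAlgebra k ↥G →+* MonoidAlgebra k ↥G :=
  MonoidAlgebra.mapDomainRingHom k (MulAut.conjNormal (H := G) x)

/-- The ring homomorphism `kG →+* kG̃` induced by the inclusion `G ≤ G̃`. -/
noncomputable def inclRingHom : MonoidAlgebra k ↥G →+* MonoidAlgebra k Gt :=
  MonoidAlgebra.mapDomainRingHom k G.subtype

/-- `x M ≅ M`: the conjugate module `x M` (with `g` acting as `x⁻¹ g x` does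
on `M`) is isomorphic to `M`; equivalently, there is an additive automorphism
of `M` which is semilinear for the conjugation automorphism of `kG`. -/
def IsConjStable (x : Gt) (M : Type u) [AddCommGroup M]
    [Module (MonoidAlgebra k ↥G) M] : Prop :=
  ∃ φ : M ≃+ M, ∀ (r : MonoidAlgebra k ↥G) (m : M),
    φ (conjRingHom k Gt G x r • m) = r • φ m

end GroupDefs

section HomDim

variable (k : Type u) [Field k] (A : Type u) [Ring A] [Algebra k A]

/-- The `k`-vector space structure on a module over a `k`-algebra. -/
abbrev scalarModule (X : Type u) [AddCommGroup X] [Module A X] : Module k X :=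
  Module.compHom X (algebraMap k A)

theorem scalarModule_isScalarTower (X : Type u) [AddCommGroup X] [Module A X] :
    letI := scalarModule k A X
    IsScalarTower k A X :=
  letI := scalarModule k A X
  ⟨fun c a x => by
    rw [Algebra.smul_def, mul_smul]; rfl⟩

/-- The `k`-dimension of `Hom_A(P, X)`. -/
noncomputable def homDim (P X : Type u) [AddCommGroup P] [Module A P]
    [AddCommGroup X] [Module A X] : ℕ :=
  letI := scalarModule k A X
  haveI := scalarModule_isScalarTower k A X
  Module.finrank k (P →ₗ[A] X)

variable {A}

theorem finite_hom_of_isScalarTower [Module.Finite k A] (P X : Type u)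
    [AddCommGroup P] [Module A P] [AddCommGroup X] [Module A X] [Module k X]
    [IsScalarTower k A X] [Module.Finite A P] [Module.Finite A X] :
    Module.Finite k (P →ₗ[A] X) := by
  have : Module.Finite k X := Module.Finite.trans A X
  obtain ⟨n, f, hf⟩ := Module.Finite.exists_fin' A P
  let Φ : (P →ₗ[A] X) →ₗ[k] (Fin n → X) :=
    { toFun := fun h i => h (f (Pi.single i 1))
      map_add' := fun _ _ => rfl
      map_smul' := fun _ _ => rfl }
  refine Module.Finite.of_injective Φ fun h h' hh => ?_
  have : h.comp f = h'.comp f := by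
    refine LinearMap.pi_ext' fun i => LinearMap.ext_ring ?_
    exact congrFun hh i
  ext p
  obtain ⟨q, rfl⟩ := hf p
  exact LinearMap.congr_fun this q

/-- A finite family of maps `C → E` from which all others are obtained by precomposition
with central scalars. -/
theorem exists_hom_generators [Module.Finite k A] (C E : Type u)
    [AddCommGroup C] [Module A C] [AddCommGroup E] [Module A E]
    [Module.Finite A C] [Module.Finite A E] :
    ∃ (r : ℕ) (f : Fin r → (C →ₗ[A] E)), ∀ g : C →ₗ[A] E, ∃ c : Fin r → k,
      ∀ x, g x = ∑ i, f i (algebraMap k A (c i) • x) := by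
  let _ := scalarModule k A E
  have := scalarModule_isScalarTower k A E
  have := finite_hom_of_isScalarTower (A := A) k C E
  obtain ⟨r, f, hf⟩ := Module.Finite.exists_fin (R := k) (M := C →ₗ[A] E)
  refine ⟨r, f, fun g => ?_⟩
  have hg : g ∈ Submodule.span k (Set.range f) := by rw [hf]; trivial
  obtain ⟨c, hc⟩ := (Submodule.mem_span_range_iff_exists_fun k).1 hg
  refine ⟨c, fun x => ?_⟩
  rw [← hc, LinearMap.sum_apply]
  refine Finset.sum_congr rfl fun i _ => ?_
  rw [map_smul]
  rfl

variable (A)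

theorem homDim_eq_zero_iff [Module.Finite k A] (P X : Type u)
    [AddCommGroup P] [Module A P] [AddCommGroup X] [Module A X]
    [Module.Finite A P] [Module.Finite A X] :
    homDim k A P X = 0 ↔ ∀ f : P →ₗ[A] X, f = 0 := by
  let _ := scalarModule k A X
  have := scalarModule_isScalarTower k A X
  have := finite_hom_of_isScalarTower (A := A) k P X
  unfold homDim
  rw [Module.finrank_zero_iff]
  exact ⟨fun h f => Subsingleton.elim _ _, fun h => ⟨fun a b => by rw [h a, h b]⟩⟩

theorem finrank_eq_add_of_exact {U V W : Type u} [AddCommGroup U] [Module k U]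
    [AddCommGroup V] [Module k V] [AddCommGroup W] [Module k W] [Module.Finite k V]
    (f : U →ₗ[k] V) (g : V →ₗ[k] W) (hf : Function.Injective f) (hfg : Function.Exact f g)
    (hg : Function.Surjective g) :
    Module.finrank k V = Module.finrank k U + Module.finrank k W := by
  rw [← LinearMap.finrank_range_add_finrank_ker g, LinearMap.range_eq_top.2 hg, finrank_top,
    hfg.linearMap_ker_eq, LinearMap.finrank_range_of_inj hf, add_comm]

theorem homDim_eq_add_of_exact_right [Module.Finite k A] {P X' X X'' : Type u}
    [AddCommGroup P] [Module A P] [AddCommGroup X'] [Module A X'] [AddCommGroup X] [Module A X]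
    [AddCommGroup X''] [Module A X''] [Module.Finite A P] [Module.Finite A X]
    (f : X' →ₗ[A] X) (g : X →ₗ[A] X'') (hf : Function.Injective f) (hfg : Function.Exact f g)
    (hlift : ∀ h : P →ₗ[A] X'', ∃ h' : P →ₗ[A] X, g.comp h' = h) :
    homDim k A P X = homDim k A P X' + homDim k A P X'' := by
  let _ := scalarModule k A X'
  have := scalarModule_isScalarTower k A X'
  let _ := scalarModule k A X
  have := scalarModule_isScalarTower k A X
  let _ := scalarModule k A X''
  have := scalarModule_isScalarTower k A X''
  have := finite_hom_of_isScalarTower (A := A) k P X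
  let F : (P →ₗ[A] X') →ₗ[k] (P →ₗ[A] X) :=
    { toFun := fun h => f.comp h
      map_add' := fun _ _ => by ext; simp
      map_smul' := fun c h => by
        ext x
        exact f.map_smul (algebraMap k A c) (h x) }
  let G : (P →ₗ[A] X) →ₗ[k] (P →ₗ[A] X'') :=
    { toFun := fun h => g.comp h
      map_add' := fun _ _ => by ext; simp
      map_smul' := fun c h => by
        ext x
        exact g.map_smul (algebraMap k A c) (h x) }
  refine finrank_eq_add_of_exact k F G (fun a b hab => ?_) (fun h => ⟨fun hh => ?_, ?_⟩) hlift
  · ext x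
    exact hf (LinearMap.congr_fun hab x)
  · have : ∀ x, h x ∈ LinearMap.range f := fun x =>
      (hfg _).1 (LinearMap.congr_fun hh x)
    refine ⟨(LinearEquiv.ofInjective f hf).symm.toLinearMap.comp (h.codRestrict _ this), ?_⟩
    ext x
    have := LinearEquiv.apply_symm_apply (LinearEquiv.ofInjective f hf)
      (h.codRestrict _ this x)
    exact congrArg Subtype.val this
  · rintro ⟨h', rfl⟩
    ext x
    exact (hfg _).2 ⟨h' x, rfl⟩

theorem homDim_eq_add_of_exact_left [Module.Finite k A] {P₁ P₀ M X : Type u}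
    [AddCommGroup P₁] [Module A P₁] [AddCommGroup P₀] [Module A P₀] [AddCommGroup M] [Module A M]
    [AddCommGroup X] [Module A X] [Module.Finite A P₀] [Module.Finite A X]
    (v : P₁ →ₗ[A] P₀) (π : P₀ →ₗ[A] M) (hπ : Function.Surjective π)
    (hv : LinearMap.ker π = LinearMap.range v)
    (hext : ∀ h : P₁ →ₗ[A] X, ∃ e : P₀ →ₗ[A] X, e.comp v = h) :
    homDim k A P₀ X = homDim k A M X + homDim k A P₁ X := by
  let _ := scalarModule k A X
  have := scalarModule_isScalarTower k A X
  have := finite_hom_of_isScalarTower (A := A) k P₀ X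
  let F : (M →ₗ[A] X) →ₗ[k] (P₀ →ₗ[A] X) :=
    { toFun := fun h => h.comp π
      map_add' := fun _ _ => rfl
      map_smul' := fun c h => rfl }
  let G : (P₀ →ₗ[A] X) →ₗ[k] (P₁ →ₗ[A] X) :=
    { toFun := fun h => h.comp v
      map_add' := fun _ _ => rfl
      map_smul' := fun c h => rfl }
  refine finrank_eq_add_of_exact k F G (fun a b hab => ?_) (fun h => ⟨fun hh => ?_, ?_⟩) hext
  · ext x
    obtain ⟨y, rfl⟩ := hπ x
    exact LinearMap.congr_fun hab y
  · have hle : LinearMap.ker π ≤ LinearMap.ker h := by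
      rw [hv]
      rintro _ ⟨y, rfl⟩
      exact LinearMap.congr_fun hh y
    refine ⟨((LinearMap.ker π).liftQ h hle).comp
      (π.quotKerEquivOfSurjective hπ).symm.toLinearMap, ?_⟩
    ext x
    change (LinearMap.ker π).liftQ h hle ((π.quotKerEquivOfSurjective hπ).symm (π x)) = h x
    rw [(LinearEquiv.symm_apply_eq _).2
      (LinearMap.quotKerEquivOfSurjective_apply_mk π hπ x).symm, Submodule.liftQ_apply]
  · rintro ⟨h', rfl⟩
    ext x
    have : v x ∈ LinearMap.ker π := hv ▸ ⟨x, rfl⟩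
    change h' (π (v x)) = 0
    rw [LinearMap.mem_ker.1 this, map_zero]

theorem homDim_congr_left [Module.Finite k A] {P P' X : Type u}
    [AddCommGroup P] [Module A P] [AddCommGroup P'] [Module A P'] [AddCommGroup X] [Module A X]
    (e : P ≃ₗ[A] P') : homDim k A P X = homDim k A P' X := by
  let _ := scalarModule k A X
  have := scalarModule_isScalarTower k A X
  exact LinearEquiv.finrank_eq
    { toFun := fun h => h.comp e.symm.toLinearMap
      invFun := fun h => h.comp e.toLinearMap
      left_inv := fun h => by ext; simp
      right_inv := fun h => by ext; simp
      map_add' := fun _ _ => rfl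
      map_smul' := fun c h => rfl }

theorem homDim_congr_right {P X X' : Type u}
    [AddCommGroup P] [Module A P] [AddCommGroup X] [Module A X] [AddCommGroup X'] [Module A X']
    (e : X ≃ₗ[A] X') : homDim k A P X = homDim k A P X' := by
  let _ := scalarModule k A X
  have := scalarModule_isScalarTower k A X
  let _ := scalarModule k A X'
  have := scalarModule_isScalarTower k A X'
  exact LinearEquiv.finrank_eq
    { toFun := fun h => e.toLinearMap.comp h
      invFun := fun h => e.symm.toLinearMap.comp h
      left_inv := fun h => by ext; simp
      right_inv := fun h => by ext; simp
      map_add' := fun _ _ => by ext; simp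
      map_smul' := fun c h => LinearMap.ext fun x => e.map_smul (algebraMap k A c) (h x) }

theorem homDim_prod [Module.Finite k A] (P P' X : Type u)
    [AddCommGroup P] [Module A P] [AddCommGroup P'] [Module A P'] [AddCommGroup X] [Module A X]
    [Module.Finite A P] [Module.Finite A P'] [Module.Finite A X] :
    homDim k A (P × P') X = homDim k A P X + homDim k A P' X :=
  homDim_eq_add_of_exact_left k A (LinearMap.inr A P P') (LinearMap.fst A P P')
    Prod.fst_surjective (LinearMap.range_inr ..).symm
    fun h => ⟨h.comp (LinearMap.snd A P P'), by ext; simp⟩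

theorem homDim_fin [Module.Finite k A] (P X : Type u) (n : ℕ)
    [AddCommGroup P] [Module A P] [AddCommGroup X] [Module A X]
    [Module.Finite A P] [Module.Finite A X] :
    homDim k A (Fin n → P) X = n * homDim k A P X := by
  induction n with
  | zero =>
    rw [zero_mul, homDim_eq_zero_iff]
    intro f
    ext1 i
    exact i.elim0
  | succ n ih =>
    rw [homDim_congr_left k A (Fin.consLinearEquiv A fun _ : Fin (n + 1) => P).symm, homDim_prod,
      ih]
    ring

end HomDim

section Indecomposables

variable {A : Type u} [Ring A]

theorem IsIndecModule.of_equiv {X Y : Type u} [AddCommGroup X] [Module A X]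
    [AddCommGroup Y] [Module A Y] (e : X ≃ₗ[A] Y) (h : IsIndecModule A X) :
    IsIndecModule A Y := by
  refine ⟨e.symm.toEquiv.nontrivial_congr.2 h.1 |> fun h => h, fun U V hUV => ?_⟩
  have hc := hUV.map (Submodule.orderIsoMapComap e.symm)
  refine (h.2 _ _ hc).imp (fun h => ?_) (fun h => ?_) <;>
  · rw [← map_bot (Submodule.orderIsoMapComap e.symm)] at h
    exact (Submodule.orderIsoMapComap e.symm).injective h

/-- Fitting's lemma. -/
theorem IsIndecModule.isUnit_or_isNilpotent {L : Type u} [AddCommGroup L] [Module A L]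
    [IsNoetherian A L] [IsArtinian A L] (hL : IsIndecModule A L) (f : Module.End A L) :
    IsUnit f ∨ IsNilpotent f := by
  obtain ⟨n, hn⟩ := Filter.eventually_atTop.1 f.eventually_isCompl_ker_pow_range_pow
  have h := hn (n + 1) (Nat.le_succ n)
  rcases hL.2 _ _ h with h0 | h0
  · left
    rw [Module.End.isUnit_iff]
    apply IsArtinian.bijective_of_injective_endomorphism
    rw [← LinearMap.ker_eq_bot, eq_bot_iff, ← h0]
    intro x hx
    rw [LinearMap.mem_ker, pow_succ, Module.End.mul_apply, LinearMap.mem_ker.1 hx, map_zero]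
  · right
    exact ⟨n + 1, LinearMap.range_eq_bot.1 h0⟩

theorem IsIndecModule.isUnit_or_isUnit_of_add {L : Type u} [AddCommGroup L] [Module A L]
    [IsNoetherian A L] [IsArtinian A L] (hL : IsIndecModule A L) {f g : Module.End A L}
    (h : IsUnit (f + g)) : IsUnit f ∨ IsUnit g := by
  obtain ⟨c, hc⟩ := h
  have h1 : (↑c⁻¹ * f) + (↑c⁻¹ * g) = 1 := by rw [← mul_add, ← hc, Units.inv_mul]
  rcases hL.isUnit_or_isNilpotent (↑c⁻¹ * f) with h | h
  · left
    exact (Units.isUnit_units_mul _ _).1 h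
  · right
    have h2 : (↑c⁻¹ * g : Module.End A L) = 1 - (↑c⁻¹ * f) := by rw [← h1]; abel
    exact (Units.isUnit_units_mul c⁻¹ _).1 (h2 ▸ h.isUnit_one_sub)

theorem IsIndecModule.exists_isUnit_of_sum {L : Type u} [AddCommGroup L] [Module A L]
    [IsNoetherian A L] [IsArtinian A L] (hL : IsIndecModule A L) {ι : Type*} (s : Finset ι)
    (f : ι → Module.End A L) (h : IsUnit (∑ i ∈ s, f i)) : ∃ i ∈ s, IsUnit (f i) := by
  classical
  induction s using Finset.induction_on with
  | empty =>
    rw [Finset.sum_empty, Module.End.isUnit_iff] at h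
    obtain ⟨x, y, hxy⟩ := hL.1
    exact absurd (h.1 (show (0 : Module.End A L) x = (0 : Module.End A L) y from rfl)) hxy
  | insert i s hi ih =>
    rw [Finset.sum_insert hi] at h
    rcases hL.isUnit_or_isUnit_of_add h with h | h
    · exact ⟨i, Finset.mem_insert_self _ _, h⟩
    · obtain ⟨j, hj, h⟩ := ih h
      exact ⟨j, Finset.mem_insert_of_mem hj, h⟩

theorem isCompl_range_ker_of_bijective {L M : Type u} [AddCommGroup L] [Module A L]
    [AddCommGroup M] [Module A M] (f : L →ₗ[A] M) (g : M →ₗ[A] L)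
    (h : Function.Bijective (g.comp f)) :
    IsCompl (LinearMap.range f) (LinearMap.ker g) := by
  refine ⟨Submodule.disjoint_def.2 ?_, codisjoint_iff.2 (eq_top_iff.2 fun x _ => ?_)⟩
  · rintro _ ⟨x, rfl⟩ hx
    have : x = 0 := h.1 (by simpa using hx)
    rw [this, map_zero]
  · obtain ⟨y, hy⟩ := h.2 (g x)
    refine Submodule.mem_sup.2 ⟨f y, ⟨y, rfl⟩, x - f y, ?_, by abel⟩
    rw [LinearMap.mem_ker, map_sub, sub_eq_zero]
    exact hy.symm

theorem IsIndecModule.nonempty_equiv_of_bijective {L M : Type u} [AddCommGroup L] [Module A L]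
    [AddCommGroup M] [Module A M] (hL : IsIndecModule A L) (hM : IsIndecModule A M)
    (f : L →ₗ[A] M) (g : M →ₗ[A] L) (h : Function.Bijective (g.comp f)) :
    Nonempty (L ≃ₗ[A] M) := by
  rcases hM.2 _ _ (isCompl_range_ker_of_bijective f g h) with h0 | h0
  · obtain ⟨x, y, hxy⟩ := hL.1
    rw [LinearMap.range_eq_bot] at h0
    refine absurd (h.1 ?_) hxy
    simp [h0]
  · refine ⟨(LinearEquiv.ofBijective g ⟨LinearMap.ker_eq_bot.1 h0, fun x => ?_⟩).symm⟩
    obtain ⟨y, hy⟩ := h.2 x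
    exact ⟨f y, hy⟩

/-- The indecomposable direct summands of `M`. -/
abbrev IndecSummand (A : Type u) [Ring A] (M : Type u) [AddCommGroup M] [Module A M] : Type u :=
  {L : Submodule A M // (∃ L'', IsCompl L L'') ∧ IsIndecModule A L}

theorem IsIndecModule.exists_indecSummand {L M : Type u} [AddCommGroup L] [Module A L]
    [AddCommGroup M] [Module A M] (hL : IsIndecModule A L)
    (f : L →ₗ[A] M) (g : M →ₗ[A] L) (h : Function.Bijective (g.comp f)) :
    ∃ Z : IndecSummand A M, Nonempty (L ≃ₗ[A] Z.1) := by
  have hf : Function.Injective f := fun x y hxy => h.1 (by simp [hxy])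
  let e := LinearEquiv.ofInjective f hf
  exact ⟨⟨_, ⟨_, isCompl_range_ker_of_bijective f g h⟩, hL.of_equiv e⟩, ⟨e⟩⟩

theorem IndecSummand.exists_retract {M : Type u} [AddCommGroup M] [Module A M]
    (Z : IndecSummand A M) : ∃ p : M →ₗ[A] Z.1, p.comp Z.1.subtype = LinearMap.id := by
  obtain ⟨L, hL⟩ := Z.2.1
  refine ⟨Submodule.projectionOnto _ _ hL, ?_⟩
  ext x
  exact congrArg Subtype.val (Submodule.projectionOnto_apply_left hL x)

/-- Induction along decompositions into indecomposable direct summands. -/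
theorem indecSummand_induction (X : Type u) [AddCommGroup X] [Module A X]
    [IsArtinian A X] {motive : Submodule A X → Prop} (bot : motive ⊥)
    (indec : ∀ L : IndecSummand A X, motive L.1)
    (sup : ∀ U V, Disjoint U V → motive U → motive V → motive (U ⊔ V)) : motive ⊤ := by
  suffices H : ∀ L : Submodule A X, (∃ L'', IsCompl L L'') → motive L from H ⊤ ⟨⊥, isCompl_top_bot⟩
  intro L
  induction L using WellFoundedLT.induction with
  | ind L ih =>
    rintro ⟨L'', hL''⟩
    by_cases hbot : L = ⊥
    · rwa [hbot]
    by_cases hind : IsIndecModule A L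
    · exact indec ⟨L, ⟨L'', hL''⟩, hind⟩
    have hnt : Nontrivial L := Submodule.nontrivial_iff_ne_bot.2 hbot
    obtain ⟨U', V', hUV, hU', hV'⟩ : ∃ U' V' : Submodule A L, IsCompl U' V' ∧ U' ≠ ⊥ ∧ V' ≠ ⊥ := by
      by_contra hcon
      push Not at hcon
      exact hind ⟨hnt, fun U V h => or_iff_not_imp_left.2 fun h' => hcon U V h h'⟩
    have hdis : Disjoint (U'.map L.subtype) (V'.map L.subtype) :=
      Submodule.disjoint_map L.injective_subtype hUV.disjoint
    have hsup : U'.map L.subtype ⊔ V'.map L.subtype = L := by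
      rw [← Submodule.map_sup, hUV.sup_eq_top, Submodule.map_subtype_top]
    have hne : ∀ U V : Submodule A X, Disjoint U V → U ⊔ V = L → V ≠ ⊥ → U < L := by
      intro U V hd hs hV
      refine lt_of_le_of_ne (hs ▸ le_sup_left) fun h => hV ?_
      have : V ≤ U := by rw [h, ← hs]; exact le_sup_right
      exact hd.eq_bot_of_ge this
    have hcompl : ∀ U V : Submodule A X, Disjoint U V → U ⊔ V = L → ∃ W, IsCompl U W := by
      intro U V hd hs
      refine ⟨V ⊔ L'', Disjoint.disjoint_sup_right_of_disjoint_sup_left hd (hs ▸ hL''.disjoint),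
        codisjoint_iff.2 ?_⟩
      rw [← sup_assoc, hs, hL''.sup_eq_top]
    have hinj := Submodule.map_injective_of_injective L.injective_subtype
    have hmne : ∀ W : Submodule A L, W ≠ ⊥ → W.map L.subtype ≠ ⊥ := fun W hW h =>
      hW (hinj (h.trans (Submodule.map_bot _).symm))
    have hsup' : V'.map L.subtype ⊔ U'.map L.subtype = L := by rw [sup_comm, hsup]
    have := sup _ _ hdis
      (ih _ (hne _ _ hdis hsup (hmne _ hV')) (hcompl _ _ hdis hsup))
      (ih _ (hne _ _ hdis.symm hsup' (hmne _ hU')) (hcompl _ _ hdis.symm hsup'))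
    rwa [hsup] at this

theorem InAdd.refl (M : Type u) [AddCommGroup M] [Module A M] : InAdd A M M :=
  ⟨1, LinearMap.pi fun _ => LinearMap.id, LinearMap.proj 0, rfl⟩

theorem InAdd.of_retract {M X Y : Type u} [AddCommGroup M] [Module A M] [AddCommGroup X]
    [Module A X] [AddCommGroup Y] [Module A Y] (h : InAdd A M X) (i : Y →ₗ[A] X)
    (p : X →ₗ[A] Y) (hp : p.comp i = LinearMap.id) : InAdd A M Y := by
  obtain ⟨n, i', p', h'⟩ := h
  refine ⟨n, i'.comp i, p.comp p', ?_⟩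
  ext y
  have h1 := LinearMap.congr_fun h' (i y)
  have h2 := LinearMap.congr_fun hp y
  simp only [LinearMap.comp_apply, LinearMap.id_apply] at h1 h2 ⊢
  rw [h1, h2]

theorem InAdd.of_pi {M X : Type u} {ι : Type*} [Fintype ι] [AddCommGroup M] [Module A M]
    [AddCommGroup X] [Module A X]
    (i : X →ₗ[A] (ι → M)) (p : (ι → M) →ₗ[A] X) (hp : p.comp i = LinearMap.id) :
    InAdd A M X := by
  let e := LinearEquiv.funCongrLeft A M (Fintype.equivFin ι).symm
  refine ⟨Fintype.card ι, e.toLinearMap.comp i, p.comp e.symm.toLinearMap, ?_⟩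
  ext x
  simpa using LinearMap.congr_fun hp x

theorem InAdd.trans {M X Y : Type u} [AddCommGroup M] [Module A M] [AddCommGroup X]
    [Module A X] [AddCommGroup Y] [Module A Y] (h : InAdd A M X) (h' : InAdd A X Y) :
    InAdd A M Y := by
  obtain ⟨m, i, p, h⟩ := h
  obtain ⟨n, i', p', h'⟩ := h'
  refine InAdd.of_pi (ι := Fin n × Fin m)
    (LinearMap.pi fun a => (LinearMap.proj a.2).comp (i.comp ((LinearMap.proj a.1).comp i')))
    (p'.comp (LinearMap.pi fun a => p.comp (LinearMap.pi fun b => LinearMap.proj (a, b)))) ?_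
  ext y
  have h1 : ∀ x, p (i x) = x := LinearMap.congr_fun h
  have h2 : ∀ x, p' (i' x) = x := LinearMap.congr_fun h'
  exact (congrArg p' (funext fun a => h1 (i' y a))).trans (h2 y)

/-- An indecomposable module in `add M` is isomorphic to a direct summand of `M`. -/
theorem IsIndecModule.exists_indecSummand_of_inAdd {L M : Type u} [AddCommGroup L] [Module A L]
    [AddCommGroup M] [Module A M] [IsNoetherian A L] [IsArtinian A L] (hL : IsIndecModule A L)
    (h : InAdd A M L) : ∃ Z : IndecSummand A M, Nonempty (L ≃ₗ[A] Z.1) := by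
  classical
  obtain ⟨n, i, p, hp⟩ := h
  have hsum : ∑ j, (p.comp (LinearMap.single A _ j)).comp ((LinearMap.proj j).comp i) =
      (1 : Module.End A L) := by
    ext x
    have := LinearMap.congr_fun hp x
    simp only [LinearMap.comp_apply, LinearMap.id_apply] at this
    rw [LinearMap.sum_apply, Module.End.one_apply]
    conv_rhs => rw [← this, ← Finset.univ_sum_single (i x), map_sum]
    rfl
  obtain ⟨j, _, hj⟩ := hL.exists_isUnit_of_sum Finset.univ
    (fun j => (p.comp (LinearMap.single A _ j)).comp ((LinearMap.proj j).comp i))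
    (hsum ▸ isUnit_one)
  exact hL.exists_indecSummand _ _ ((Module.End.isUnit_iff _).1 hj)

end Indecomposables

section Presentations

variable {A : Type u} [Ring A]

theorem LinearMap.exists_comp_eq_of_ker_le {P Z X : Type*} [AddCommGroup P] [Module A P]
    [AddCommGroup Z] [Module A Z] [AddCommGroup X] [Module A X] (π : P →ₗ[A] Z)
    (hπ : Function.Surjective π) (g : P →ₗ[A] X) (h : ∀ x, π x = 0 → g x = 0) :
    ∃ f : Z →ₗ[A] X, f.comp π = g := by
  refine ⟨((LinearMap.ker π).liftQ g h).comp (π.quotKerEquivOfSurjective hπ).symm.toLinearMap, ?_⟩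
  ext x
  have : (π.quotKerEquivOfSurjective hπ).symm (π x) = (LinearMap.ker π).mkQ x := by
    rw [LinearEquiv.symm_apply_eq]
    rfl
  simp only [LinearMap.comp_apply, LinearEquiv.coe_coe, this]
  rfl

theorem exists_projCover [IsArtinianRing A] [IsNoetherianRing A] (M : Type u) [AddCommGroup M]
    [Module A M] [Module.Finite A M] :
    ∃ (P : ModuleCat.{u} A) (π : (P : Type u) →ₗ[A] M), IsProjCover A π ∧ Module.Finite A P := by
  obtain ⟨n, f, hf⟩ := Module.Finite.exists_fin' A M
  obtain ⟨L, ⟨hLp, hLs⟩, hmin⟩ := IsArtinian.set_has_minimal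
    {L : Submodule A (Fin n → A) | Module.Projective A L ∧ ∀ m, ∃ x ∈ L, f x = m}
    ⟨⊤, Module.Projective.of_equiv Submodule.topEquiv.symm,
      fun m => (hf m).imp fun x hx => ⟨trivial, hx⟩⟩
  let π : L →ₗ[A] M := f.comp L.subtype
  refine ⟨ModuleCat.of A L, π, ⟨hLp, fun m => ?_, fun N hN => ?_⟩,
    inferInstanceAs (Module.Finite A L)⟩
  · obtain ⟨x, hx, h⟩ := hLs m
    exact ⟨⟨x, hx⟩, h⟩
  have hNs : Function.Surjective (π.comp N.subtype) := by
    intro m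
    obtain ⟨x, hx, h⟩ := hLs m
    obtain ⟨y, hy, z, hz, hyz⟩ := Submodule.mem_sup.1
      (hN.symm ▸ Submodule.mem_top : (⟨x, hx⟩ : L) ∈ N ⊔ LinearMap.ker π)
    refine ⟨⟨y, hy⟩, ?_⟩
    have h1 : π (y + z) = m := by rw [hyz]; exact h
    rwa [map_add, LinearMap.mem_ker.1 hz, add_zero] at h1
  obtain ⟨σ, hσ⟩ := Module.projective_lifting_property (π.comp N.subtype) π hNs
  let φ : Module.End A L := N.subtype.comp σ
  have hφ : ∀ x, π (φ x) = π x := LinearMap.congr_fun hσ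
  obtain ⟨m, hm⟩ := Filter.eventually_atTop.1 φ.eventually_isCompl_ker_pow_range_pow
  have hc := (hm (m + 1) (Nat.le_succ m)).symm
  have hpow : ∀ (j : ℕ) x, π ((φ ^ j) x) = π x := by
    intro j
    induction j with
    | zero => intro x; rfl
    | succ j ih => intro x; rw [pow_succ', Module.End.mul_apply, hφ, ih]
  have hle : LinearMap.range (φ ^ (m + 1)) ≤ N := by
    rintro _ ⟨x, rfl⟩
    rw [pow_succ', Module.End.mul_apply]
    exact (σ _).2
  have hproj : Module.Projective A (LinearMap.range (φ ^ (m + 1))) := by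
    refine Module.Projective.of_split (LinearMap.range (φ ^ (m + 1))).subtype
      (Submodule.projectionOnto _ _ hc) ?_
    ext x
    simp [Submodule.projectionOnto_apply_left hc x]
  have hnlt := hmin ((LinearMap.range (φ ^ (m + 1))).map L.subtype)
    ⟨Module.Projective.of_equiv (Submodule.equivMapOfInjective _ L.injective_subtype _),
      fun y => by
        obtain ⟨x, hx, h⟩ := hLs y
        exact ⟨_, ⟨_, ⟨⟨x, hx⟩, rfl⟩, rfl⟩, (hpow _ _).trans h⟩⟩
  have hleL : (LinearMap.range (φ ^ (m + 1))).map L.subtype ≤ L := Submodule.map_subtype_le _ _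
  have heq := hleL.eq_of_not_lt hnlt
  have htop : LinearMap.range (φ ^ (m + 1)) = ⊤ :=
    Submodule.map_injective_of_injective L.injective_subtype
      (heq.trans (Submodule.map_subtype_top L).symm)
  exact top_le_iff.1 (htop ▸ hle)

variable {P P' P₀ P₁ Z Z' X Y C E : Type u}
  [AddCommGroup P] [Module A P] [AddCommGroup P'] [Module A P']
  [AddCommGroup P₀] [Module A P₀] [AddCommGroup P₁] [Module A P₁]
  [AddCommGroup Z] [Module A Z] [AddCommGroup Z'] [Module A Z']
  [AddCommGroup X] [Module A X] [AddCommGroup Y] [Module A Y]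
  [AddCommGroup C] [Module A C] [AddCommGroup E] [Module A E]

theorem IsProjCover.finite [Module.Finite A Z] {π : P →ₗ[A] Z} (h : IsProjCover A π) :
    Module.Finite A P := by
  classical
  obtain ⟨s, hs⟩ := Module.Finite.fg_top (R := A) (M := Z)
  obtain ⟨g, hg⟩ := h.2.1.hasRightInverse
  refine ⟨⟨s.image g, h.2.2 _ (eq_top_iff.2 fun x _ => ?_)⟩⟩
  have hx : π x ∈ (Submodule.span A ((s.image g : Finset P) : Set P)).map π := by
    rw [Submodule.map_span, Finset.coe_image, Set.image_image]
    simp only [hg _, Set.image_id', hs, Submodule.mem_top]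
  obtain ⟨y, hy, hyx⟩ := hx
  exact Submodule.mem_sup.2 ⟨y, hy, x - y, by simp [hyx], by abel⟩

/-- Every map from `ker π` to `X` extends to the source of `π`. -/
def ExtendsFromKernel (π : P →ₗ[A] Z) (X : Type u) [AddCommGroup X] [Module A X] : Prop :=
  ∀ h : LinearMap.ker π →ₗ[A] X, ∃ e : P →ₗ[A] X, ∀ z : LinearMap.ker π, e z = h z

/-- Every map from the source of `u` to `Y` factors through `u`. -/
def ExtendsAlong (u : P₁ →ₗ[A] P₀) (Y : Type*) [AddCommGroup Y] [Module A Y] : Prop :=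
  ∀ h : P₁ →ₗ[A] Y, ∃ e : P₀ →ₗ[A] Y, e.comp u = h

theorem ExtendsFromKernel.of_retract [Module.Projective A P] [Module.Projective A P']
    {π : P →ₗ[A] Z} {π' : P' →ₗ[A] Z'} (h : ExtendsFromKernel π X)
    (hπ : Function.Surjective π) (hπ' : Function.Surjective π')
    (s : Z' →ₗ[A] Z) (r : Z →ₗ[A] Z') (hrs : r.comp s = LinearMap.id) :
    ExtendsFromKernel π' X := by
  intro f
  obtain ⟨σ, hσ⟩ := Module.projective_lifting_property π (s.comp π') hπ
  obtain ⟨ρ, hρ⟩ := Module.projective_lifting_property π' (r.comp π) hπ'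
  have hσ : ∀ x, π (σ x) = s (π' x) := LinearMap.congr_fun hσ
  have hρ : ∀ x, π' (ρ x) = r (π x) := LinearMap.congr_fun hρ
  have hrs : ∀ x, r (s x) = x := LinearMap.congr_fun hrs
  obtain ⟨e, he⟩ := h (f.comp ((ρ.comp (LinearMap.ker π).subtype).codRestrict _
    fun x => by simp [hρ]))
  refine ⟨e.comp σ - f.comp ((ρ.comp σ - LinearMap.id).codRestrict _
    fun x => by simp [hρ, hσ, hrs]), fun z => ?_⟩
  have h1 := he ⟨σ z, by simp [hσ]⟩
  simp only [LinearMap.sub_apply, LinearMap.comp_apply] at h1 ⊢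
  rw [h1, ← map_sub]
  exact congrArg f (Subtype.ext (sub_sub_cancel (ρ (σ z)) (z : P')))

theorem ExtendsFromKernel.exists_lift [Module.Projective A P] {π : P →ₗ[A] Z}
    (hπ : Function.Surjective π) (q : E →ₗ[A] C) (hq : Function.Surjective q)
    (h : ExtendsFromKernel π (LinearMap.ker q)) (f : Z →ₗ[A] C) :
    ∃ f' : Z →ₗ[A] E, q.comp f' = f := by
  obtain ⟨g, hg⟩ := Module.projective_lifting_property q (f.comp π) hq
  have hg : ∀ x, q (g x) = f (π x) := LinearMap.congr_fun hg
  obtain ⟨e, he⟩ := h ((g.comp (LinearMap.ker π).subtype).codRestrict _ fun x => by simp [hg])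
  obtain ⟨f', hf'⟩ := π.exists_comp_eq_of_ker_le hπ (g - (LinearMap.ker q).subtype.comp e)
    fun x hx => by
      have h1 : (e x : E) = g x := congrArg Subtype.val (he ⟨x, hx⟩)
      simp [h1]
  refine ⟨f', LinearMap.ext fun z => ?_⟩
  obtain ⟨x, rfl⟩ := hπ z
  have := LinearMap.congr_fun hf' x
  simp only [LinearMap.comp_apply] at this
  simp [this, hg]

theorem ExtendsAlong.of_projCover [Module.Projective A P₀] {π₀ : P₀ →ₗ[A] Z}
    {π₁ : P₁ →ₗ[A] LinearMap.ker π₀} (h₁ : IsProjCover A π₁)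
    (hX : ∀ W : Submodule A X, ExtendsFromKernel π₀ (X ⧸ W)) :
    ExtendsAlong ((LinearMap.ker π₀).subtype.comp π₁) X := by
  intro h
  let W := (LinearMap.ker π₁).map h
  obtain ⟨f, hf⟩ := π₁.exists_comp_eq_of_ker_le h₁.2.1 (W.mkQ.comp h) fun x hx =>
    (Submodule.Quotient.mk_eq_zero W).2 ⟨x, hx, rfl⟩
  obtain ⟨e', he'⟩ := hX W f
  obtain ⟨e, he⟩ := Module.projective_lifting_property W.mkQ e' W.mkQ_surjective
  refine ⟨e, ?_⟩
  let h' := h - e.comp ((LinearMap.ker π₀).subtype.comp π₁)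
  suffices LinearMap.ker h' = ⊤ from (sub_eq_zero.1 (LinearMap.ker_eq_top.1 this)).symm
  refine h₁.2.2 _ (eq_top_iff.2 fun x _ => ?_)
  have hx : h' x ∈ W := by
    rw [← Submodule.Quotient.mk_eq_zero W]
    have h1 := LinearMap.congr_fun hf x
    have h2 := LinearMap.congr_fun he (π₁ x)
    have h3 := he' (π₁ x)
    simp only [LinearMap.comp_apply, Submodule.mkQ_apply] at h1 h2
    simp only [h', LinearMap.sub_apply, LinearMap.comp_apply, Submodule.subtype_apply,
      Submodule.Quotient.mk_sub]
    rw [← h1, h2, h3, sub_self]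
  obtain ⟨y, hy, hyx⟩ := hx
  have hy0 : π₁ y = 0 := hy
  have hy' : h' y = h y := by simp [h', hy0]
  exact Submodule.mem_sup.2 ⟨x - y, by simp [hy', hyx], y, hy, by abel⟩

theorem ExtendsAlong.extendsFromKernel {u : P₁ →ₗ[A] P₀} {π₀ : P₀ →ₗ[A] Z}
    (hu : LinearMap.ker π₀ = LinearMap.range u) (h : ExtendsAlong u X) :
    ExtendsFromKernel π₀ X := by
  intro f
  obtain ⟨e, he⟩ := h (f.comp (u.codRestrict _ fun x => hu ▸ ⟨x, rfl⟩))
  refine ⟨e, ?_⟩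
  rintro ⟨z, hz⟩
  obtain ⟨x, rfl⟩ : z ∈ LinearMap.range u := hu ▸ hz
  exact LinearMap.congr_fun he x

theorem ExtendsAlong.of_surjective [Module.Projective A P₁] {u : P₁ →ₗ[A] P₀}
    (h : ExtendsAlong u X) (q : X →ₗ[A] Y) (hq : Function.Surjective q) : ExtendsAlong u Y := by
  intro f
  obtain ⟨g, hg⟩ := Module.projective_lifting_property q f hq
  obtain ⟨e, he⟩ := h g
  exact ⟨q.comp e, by rw [LinearMap.comp_assoc, he, hg]⟩

theorem ExtendsAlong.pi {u : P₁ →ₗ[A] P₀} {ι : Type*} {Y : ι → Type u}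
    [∀ i, AddCommGroup (Y i)] [∀ i, Module A (Y i)] (h : ∀ i, ExtendsAlong u (Y i)) :
    ExtendsAlong u (∀ i, Y i) := by
  intro f
  choose e he using fun i => h i ((LinearMap.proj i).comp f)
  refine ⟨LinearMap.pi e, ?_⟩
  ext x i
  exact LinearMap.congr_fun (he i) x

end Presentations

section Independence

variable {A : Type u} [Ring A]

/-- `X` is a finitely generated module on which `b` acts as the identity, and every map from the
source of `u` to `X` factors through `u`. -/
structure IsTestModule (b : A) {P₁ P₀ : Type u} [AddCommGroup P₁] [Module A P₁] [AddCommGroup P₀]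
    [Module A P₀] (u : P₁ →ₗ[A] P₀) (X : Type u) [AddCommGroup X] [Module A X] : Prop where
  finite : Module.Finite A X
  smul_eq : ∀ x : X, b • x = x
  extendsAlong : ExtendsAlong u X

variable {b : A} {P₁ P₀ : Type u} [AddCommGroup P₁] [Module A P₁] [AddCommGroup P₀]
    [Module A P₀] {u : P₁ →ₗ[A] P₀}

theorem IsTestModule.of_surjective [Module.Projective A P₁] {X Y : Type u} [AddCommGroup X]
    [Module A X] [AddCommGroup Y] [Module A Y] (h : IsTestModule b u X) (q : X →ₗ[A] Y)
    (hq : Function.Surjective q) : IsTestModule b u Y where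
  finite := have := h.finite; Module.Finite.of_surjective q hq
  smul_eq y := by
    obtain ⟨x, rfl⟩ := hq y
    rw [← map_smul, h.smul_eq]
  extendsAlong := h.extendsAlong.of_surjective q hq

theorem IsTestModule.pi {ι : Type u} [Finite ι] {Y : ι → Type u} [∀ i, AddCommGroup (Y i)]
    [∀ i, Module A (Y i)] (h : ∀ i, IsTestModule b u (Y i)) : IsTestModule b u (∀ i, Y i) where
  finite := have := fun i => (h i).finite; inferInstance
  smul_eq y := funext fun i => (h i).smul_eq (y i)
  extendsAlong := .pi fun i => (h i).extendsAlong

theorem IsTestModule.fin (n : ℕ) {Y : Type u} [AddCommGroup Y]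
    [Module A Y] (h : IsTestModule b u Y) : IsTestModule b u (Fin n → Y) where
  finite := have := h.finite; inferInstance
  smul_eq y := funext fun i => h.smul_eq (y i)
  extendsAlong := .pi fun _ => h.extendsAlong

theorem mem_jacobson_of_not_equiv {ι : Type*} [DecidableEq ι] {Y : ι → Type u}
    [∀ i, AddCommGroup (Y i)] [∀ i, Module A (Y i)] [∀ i, IsNoetherian A (Y i)]
    [∀ i, IsArtinian A (Y i)] {i j : ι} (hi : IsIndecModule A (Y i)) (hj : IsIndecModule A (Y j))
    (hij : ¬ Nonempty (Y i ≃ₗ[A] Y j)) (f : Y j →ₗ[A] Y i) :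
    (LinearMap.single A Y i).comp (f.comp (LinearMap.proj j)) ∈
      Ideal.jacobson (⊥ : Ideal (Module.End A (∀ i, Y i))) := by
  rw [Ideal.mem_jacobson_iff]
  intro θ
  let a : Y i →ₗ[A] (∀ i, Y i) := θ.comp (LinearMap.single A Y i)
  let g : Y i →ₗ[A] Y j := (LinearMap.proj j).comp a
  have hunit : IsUnit (1 + f.comp g : Module.End A (Y i)) := by
    rcases hi.isUnit_or_isNilpotent (f.comp g) with h | h
    · exact absurd (hi.nonempty_equiv_of_bijective hj g f ((Module.End.isUnit_iff _).1 h)) hij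
    · exact h.isUnit_one_add
  obtain ⟨t, ht⟩ := hunit.exists_left_inv
  refine ⟨1 - a.comp (t.comp (f.comp (LinearMap.proj j))), ?_⟩
  rw [Ideal.mem_bot, sub_eq_zero]
  have ht' : ∀ y, t y + t (f (a y j)) = y := fun y => by
    have := LinearMap.congr_fun ht y
    simpa [g] using this
  refine LinearMap.ext fun w => ?_
  have := congrArg a (ht' (f (w j)))
  simp only [map_add] at this
  simp only [Module.End.mul_apply, LinearMap.add_apply, LinearMap.sub_apply, Module.End.one_apply,
    LinearMap.comp_apply, LinearMap.proj_apply]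
  have h1 : θ (LinearMap.single A Y i (f (w j))) = a (f (w j)) := rfl
  rw [h1]
  nth_rewrite 1 [← this]
  abel

theorem isEmpty_of_generated (k : Type u) [Field k] [Algebra k A] [Module.Finite k A]
    {ι : Type u} [Fintype ι] {Y : ι → Type u}
    [∀ i, AddCommGroup (Y i)] [∀ i, Module A (Y i)] [∀ i, Module.Finite A (Y i)]
    (hind : ∀ i, IsIndecModule A (Y i))
    (hniso : ∀ i j, i ≠ j → ¬ Nonempty (Y i ≃ₗ[A] Y j))
    (hgen : ∀ i, ∀ y : Y i,
      y ∈ AddSubgroup.closure {y | ∃ j ≠ i, ∃ (f : Y j →ₗ[A] Y i) (z : Y j), f z = y}) :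
    IsEmpty ι := by
  classical
  have : IsNoetherianRing A := isNoetherian_of_tower k inferInstance
  have : IsArtinianRing A := isArtinian_of_tower k inferInstance
  let W := ∀ i, Y i
  let E := Module.End A W
  have hfin : Module.Finite E W := by
    let _ := scalarModule k A W
    have := scalarModule_isScalarTower k A W
    have hk : Module.Finite k W := Module.Finite.trans A W
    have : IsScalarTower k E W := ⟨fun c e w => rfl⟩
    exact Module.Finite.of_restrictScalars_finite k E W
  let J : Ideal E := Ideal.jacobson ⊥
  have hJ : (⊤ : Submodule E W) ≤ J • ⊤ := by
    intro w _
    rw [← Finset.univ_sum_single w]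
    refine Submodule.sum_mem _ fun i _ => ?_
    refine AddSubgroup.closure_induction
      (p := fun y _ => (Pi.single i y : W) ∈ J • (⊤ : Submodule E W)) ?_ ?_ ?_ ?_ (hgen i (w i))
    · rintro _ ⟨j, hj, f, z, rfl⟩
      have h1 : (Pi.single i (f z) : W) =
          (show E from (LinearMap.single A Y i).comp (f.comp (LinearMap.proj j))) •
            (Pi.single j z : W) := by
        change _ = Pi.single i (f ((Pi.single j z : W) j))
        rw [Pi.single_eq_same]
      rw [h1]
      exact Submodule.smul_mem_smul (mem_jacobson_of_not_equiv (hind i) (hind j)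
        (hniso i j hj.symm) f) trivial
    · rw [Pi.single_zero]; exact Submodule.zero_mem _
    · intro x y _ _ hx hy
      rw [Pi.single_add]; exact Submodule.add_mem _ hx hy
    · intro x _ hx
      rw [Pi.single_neg]; exact Submodule.neg_mem _ hx
  have hbot := Submodule.FG.eq_bot_of_le_jacobson_smul (Module.finite_def.1 hfin)
    (hJ.trans_eq (by rw [show J = Ring.jacobson E from Ideal.jacobson_bot]))
  refine ⟨fun i => ?_⟩
  obtain ⟨x, y, hxy⟩ := (hind i).1
  have h0 : ∀ z : Y i, z = 0 := fun z => by
    have : (Pi.single i z : W) ∈ (⊤ : Submodule E W) := trivial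
    rw [hbot, Submodule.mem_bot] at this
    exact Pi.single_eq_zero_iff.1 this
  exact hxy ((h0 x).trans (h0 y).symm)

theorem mkQ_eq_zero_of_sum_homDim_eq_zero (k : Type u) [Field k] [Algebra k A] [Module.Finite k A]
    [Module.Projective A P₁] {ι : Type u} [Fintype ι] {Y : ι → Type u}
    [∀ i, AddCommGroup (Y i)] [∀ i, Module A (Y i)]
    (hT : ∀ i, IsTestModule b u (Y i))
    (hext : ∀ i, ∃ (R : ModuleCat.{u} A) (π : (R : Type u) →ₗ[A] Y i), Module.Projective A R ∧
      Function.Surjective π ∧ ∀ (X : Type u) [AddCommGroup X] [Module A X], IsTestModule b u X →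
        ExtendsFromKernel π X)
    (c : ι → ℚ)
    (h0 : ∀ (X : Type u) [AddCommGroup X] [Module A X], IsTestModule b u X →
      ∑ i, c i * homDim k A (Y i) X = 0) (i : ι) (hi : c i ≠ 0) (y : Y i) :
    y ∈ AddSubgroup.closure
      {y | ∃ j, c j ≠ 0 ∧ j ≠ i ∧ ∃ (f : Y j →ₗ[A] Y i) (z : Y j), f z = y} := by
  classical
  have hfinY := fun i => (hT i).finite
  let W := ∀ j : {j // c i * c j < 0}, Y j
  obtain ⟨r, f, hf⟩ := exists_hom_generators (A := A) k W (Y i)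
  let Φ : (Fin r → W) →ₗ[A] Y i := ∑ a, (f a).comp (LinearMap.proj a)
  have hΦ : ∀ z, Φ z = ∑ a, f a (z a) := fun z => by simp [Φ]
  have hWT : IsTestModule b u (Fin r → W) := .fin r (.pi fun j => hT j)
  have hrT : IsTestModule b u (LinearMap.range Φ) :=
    hWT.of_surjective Φ.rangeRestrict Φ.surjective_rangeRestrict
  let X := Y i ⧸ LinearMap.range Φ
  have hXT : IsTestModule b u X := (hT i).of_surjective _ (Submodule.mkQ_surjective _)
  have hXfin := hXT.finite
  have hker : LinearMap.ker (LinearMap.range Φ).mkQ = LinearMap.range Φ := Submodule.ker_mkQ _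
  have hkT : IsTestModule b u (LinearMap.ker (LinearMap.range Φ).mkQ) := by rwa [hker]
  have hz : ∀ j, c i * c j < 0 → homDim k A (Y j) X = 0 := by
    intro j hj
    rw [homDim_eq_zero_iff]
    intro h
    obtain ⟨R, π, hR, hπ, hRX⟩ := hext j
    obtain ⟨g, hg⟩ := (hRX _ hkT).exists_lift hπ (LinearMap.range Φ).mkQ
      (Submodule.mkQ_surjective _) h
    rw [← hg]
    refine LinearMap.ext fun z => (Submodule.Quotient.mk_eq_zero _).2 ?_
    obtain ⟨d, hd⟩ := hf (g.comp (LinearMap.proj (⟨j, hj⟩ : {j // c i * c j < 0})))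
    have h2 := hd (Pi.single ⟨j, hj⟩ z)
    rw [LinearMap.comp_apply, LinearMap.proj_apply, Pi.single_eq_same] at h2
    exact ⟨fun a => algebraMap k A (d a) • 
      (Pi.single (⟨j, hj⟩ : {j // c i * c j < 0}) z : W), by rw [hΦ, h2]⟩
  have hsum : ∑ j, c i * c j * homDim k A (Y j) X = 0 := by
    have h1 := congrArg (c i * ·) (h0 X hXT)
    simp only [Finset.mul_sum, mul_zero, ← mul_assoc] at h1
    exact h1
  have hnn : ∀ j ∈ Finset.univ, 0 ≤ c i * c j * homDim k A (Y j) X := by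
    intro j _
    rcases lt_or_ge (c i * c j) 0 with h | h
    · rw [hz j h, Nat.cast_zero, mul_zero]
    · positivity
  have hii := (Finset.sum_eq_zero_iff_of_nonneg hnn).1 hsum i (Finset.mem_univ i)
  have hi0 : homDim k A (Y i) X = 0 := by
    rcases mul_eq_zero.1 hii with h | h
    · exact absurd h (mul_self_ne_zero.2 hi)
    · exact_mod_cast h
  rw [homDim_eq_zero_iff] at hi0
  obtain ⟨z, hz⟩ : y ∈ LinearMap.range Φ :=
    (Submodule.Quotient.mk_eq_zero _).1 (LinearMap.congr_fun (hi0 (LinearMap.range Φ).mkQ) y)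
  rw [← hz, hΦ]
  refine AddSubgroup.sum_mem _ fun a _ => ?_
  rw [← Finset.univ_sum_single (z a), map_sum]
  refine AddSubgroup.sum_mem _ fun j _ => AddSubgroup.subset_closure
    ⟨j, fun h => ?_, fun h => ?_,
      (f a).comp (LinearMap.single A (fun j : {j // c i * c j < 0} => Y j) j),
      z a j, rfl⟩
  · exact absurd j.2 (by rw [h, mul_zero]; exact lt_irrefl _)
  · exact absurd j.2 (by rw [h]; exact not_lt.2 (mul_self_nonneg _))

/-- Pairwise non-isomorphic indecomposable test modules which are Ext-orthogonal to the test
modules have linearly independent dimension vectors. -/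
theorem coeff_eq_zero_of_sum_homDim_eq_zero (k : Type u) [Field k] [Algebra k A]
    [Module.Finite k A] [Module.Projective A P₁] {ι : Type u} [Fintype ι] {Y : ι → Type u}
    [∀ i, AddCommGroup (Y i)] [∀ i, Module A (Y i)]
    (hind : ∀ i, IsIndecModule A (Y i))
    (hniso : ∀ i j, i ≠ j → ¬ Nonempty (Y i ≃ₗ[A] Y j))
    (hT : ∀ i, IsTestModule b u (Y i))
    (hext : ∀ i, ∃ (R : ModuleCat.{u} A) (π : (R : Type u) →ₗ[A] Y i), Module.Projective A R ∧
      Function.Surjective π ∧ ∀ (X : Type u) [AddCommGroup X] [Module A X], IsTestModule b u X →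
        ExtendsFromKernel π X)
    (c : ι → ℚ)
    (h0 : ∀ (X : Type u) [AddCommGroup X] [Module A X], IsTestModule b u X →
      ∑ i, c i * homDim k A (Y i) X = 0) (i : ι) : c i = 0 := by
  classical
  by_contra hi
  have hfinY := fun i => (hT i).finite
  refine (isEmpty_of_generated (A := A) k (ι := {i // c i ≠ 0}) (Y := fun i => Y i)
    (fun i => hind i) (fun i j hij => hniso i j fun h => hij (Subtype.ext h))
    fun i y => ?_).false ⟨i, hi⟩
  refine AddSubgroup.closure_mono ?_ (mkQ_eq_zero_of_sum_homDim_eq_zero k hT hext c h0 i i.2 y)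
  rintro _ ⟨j, hj, hji, f, z, rfl⟩
  exact ⟨⟨j, hj⟩, fun h => hji (congrArg Subtype.val h), f, z, rfl⟩

end Independence

section DimensionVectors

variable {A : Type u} [Ring A]

theorem IsSimpleModule.nonempty_equiv_of_ne_zero {S T : Type u} [AddCommGroup S] [Module A S]
    [AddCommGroup T] [Module A T] [IsSimpleModule A S] [IsSimpleModule A T] (f : S →ₗ[A] T)
    (hf : f ≠ 0) : Nonempty (S ≃ₗ[A] T) :=
  ⟨LinearEquiv.ofBijective f (LinearMap.bijective_of_ne_zero hf)⟩

theorem IsProjCover.nonempty_equiv {P S T : Type u} [AddCommGroup P] [Module A P]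
    [AddCommGroup S] [Module A S] [AddCommGroup T] [Module A T] [IsSimpleModule A S]
    [IsSimpleModule A T] {π : P →ₗ[A] S} (hπ : IsProjCover A π) (f : P →ₗ[A] T) (hf : f ≠ 0) :
    Nonempty (S ≃ₗ[A] T) := by
  have hco : IsCoatom (LinearMap.ker f) :=
    isSimpleModule_iff_isCoatom.1
      (IsSimpleModule.congr (f.quotKerEquivOfSurjective (LinearMap.surjective_of_ne_zero hf)))
  have hle : LinearMap.ker π ≤ LinearMap.ker f := by
    by_contra h
    have h1 := hco.2 (LinearMap.ker f ⊔ LinearMap.ker π) (left_lt_sup.2 h)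
    exact hco.1 (hπ.2.2 _ h1)
  obtain ⟨g, hg⟩ := π.exists_comp_eq_of_ker_le hπ.2.1 f hle
  refine IsSimpleModule.nonempty_equiv_of_ne_zero g fun h => hf ?_
  rw [← hg, h, LinearMap.zero_comp]

theorem exists_quotient_equiv_of_iInf_le (s : Finset (Ideal A))
    (hs : ∀ m ∈ s, IsSimpleModule A (A ⧸ m)) (n : Ideal A) [IsSimpleModule A (A ⧸ n)]
    (h : s.inf id ≤ n) : ∃ m ∈ s, Nonempty ((A ⧸ m) ≃ₗ[A] (A ⧸ n)) := by
  classical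
  have hn : n ≠ ⊤ := (isSimpleModule_iff_isCoatom.1 ‹_›).1
  induction s using Finset.induction_on with
  | empty => exact absurd (top_le_iff.1 h) hn
  | insert m s hms ih =>
    by_cases hsn : s.inf id ≤ n
    · obtain ⟨m', hm', he⟩ := ih (fun m' hm' => hs m' (Finset.mem_insert_of_mem hm')) hsn
      exact ⟨m', Finset.mem_insert_of_mem hm', he⟩
    have hm := hs m (Finset.mem_insert_self m s)
    refine ⟨m, Finset.mem_insert_self m s, ?_⟩
    rw [Finset.inf_insert, id] at h
    let I : Ideal A := s.inf id
    let f : I →ₗ[A] (A ⧸ m) := (Submodule.mkQ m).comp I.subtype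
    let g : I →ₗ[A] (A ⧸ n) := (Submodule.mkQ n).comp I.subtype
    have hf : f ≠ 0 := fun h0 => hsn fun x hx =>
      h ⟨(Submodule.Quotient.mk_eq_zero m).1 (LinearMap.congr_fun h0 ⟨x, hx⟩), hx⟩
    have hg : g ≠ 0 := fun h0 => hsn fun x hx =>
      (Submodule.Quotient.mk_eq_zero n).1 (LinearMap.congr_fun h0 ⟨x, hx⟩)
    obtain ⟨q, hq⟩ := f.exists_comp_eq_of_ker_le (LinearMap.surjective_of_ne_zero hf) g
      fun x hx => (Submodule.Quotient.mk_eq_zero n).2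
        (h ⟨(Submodule.Quotient.mk_eq_zero m).1 hx, x.2⟩)
    exact IsSimpleModule.nonempty_equiv_of_ne_zero q fun h0 => hg (by
      rw [← hq, h0, LinearMap.zero_comp])

/-- An Artinian ring has finitely many simple modules up to isomorphism. -/
theorem exists_finset_ideal_of_isSimpleModule (A : Type u) [Ring A] [IsArtinianRing A] :
    ∃ s : Finset (Ideal A), ∀ (S : Type u) [AddCommGroup S] [Module A S] [IsSimpleModule A S],
      ∃ m ∈ s, Nonempty ((A ⧸ m) ≃ₗ[A] S) := by
  classical
  obtain ⟨_, ⟨s, hs, rfl⟩, hmin⟩ := IsArtinian.set_has_minimal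
    {I : Ideal A | ∃ s : Finset (Ideal A), (∀ m ∈ s, IsSimpleModule A (A ⧸ m)) ∧ s.inf id = I}
    ⟨_, ∅, by simp, rfl⟩
  refine ⟨s, fun S _ _ _ => ?_⟩
  have : Nontrivial S := IsSimpleModule.nontrivial A S
  obtain ⟨v, hv⟩ := exists_ne (0 : S)
  let e := (LinearMap.toSpanSingleton A S v).quotKerEquivOfSurjective
    (IsSimpleModule.toSpanSingleton_surjective A hv)
  have := IsSimpleModule.congr e
  have hle : s.inf id ≤ LinearMap.ker (LinearMap.toSpanSingleton A S v) := by
    by_contra h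
    refine hmin _ ⟨insert (LinearMap.ker (LinearMap.toSpanSingleton A S v)) s, ?_, rfl⟩ ?_
    · intro m hm
      rcases Finset.mem_insert.1 hm with rfl | hm
      · assumption
      · exact hs m hm
    · rw [Finset.inf_insert]
      exact inf_lt_right.2 h
  obtain ⟨m, hm, ⟨e'⟩⟩ := exists_quotient_equiv_of_iInf_le s hs _ hle
  exact ⟨m, hm, ⟨e'.trans e⟩⟩

/-- The simple modules on which `b` acts as the identity. -/
abbrev SimpleIn (b : A) : Type (u + 1) :=
  {X : ModuleCat.{u} A // IsSimpleModule A X ∧ ∀ v : (X : Type u), b • v = v}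

theorem equivalence_nonempty_linearEquiv {α : Type*} (f : α → ModuleCat.{u} A) :
    Equivalence fun X Y : α => Nonempty ((f X : Type u) ≃ₗ[A] (f Y : Type u)) where
  refl _ := ⟨LinearEquiv.refl _ _⟩
  symm h := h.map LinearEquiv.symm
  trans h h' := h.elim fun e => h'.map e.trans

theorem finite_simple_classes [IsArtinianRing A] (b : A) :
    Finite (Quot fun X Y : SimpleIn b => Nonempty ((X.1 : Type u) ≃ₗ[A] (Y.1 : Type u))) := by
  obtain ⟨s, hs⟩ := exists_finset_ideal_of_isSimpleModule A
  choose! m hm hme using fun X : SimpleIn b => (have := X.2.1; hs X.1)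
  refine Finite.of_injective (β := s) (fun q => ⟨m q.out, hm _⟩) fun q q' h => ?_
  have h' : m q.out = m q'.out := congrArg Subtype.val h
  rw [← q.out_eq, ← q'.out_eq]
  obtain ⟨e⟩ := hme q.out
  obtain ⟨e'⟩ := hme q'.out
  rw [← h'] at e'
  exact Quot.sound ⟨e.symm.trans e'⟩

/-- The finitely generated modules on which `b` acts as the identity. -/
abbrev BlockMod (b : A) : Type (u + 1) :=
  {X : ModuleCat.{u} A // Module.Finite A X ∧ ∀ v : (X : Type u), b • v = v}

/-- The vector of the dimensions of the spaces `Hom_A(P, X)`, as `X` varies over the finitely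
generated modules on which `b` acts as the identity. -/
noncomputable def dimVec (k : Type u) [Field k] [Algebra k A] (b : A) (P : Type u)
    [AddCommGroup P] [Module A P] : BlockMod b → ℚ :=
  fun X => homDim k A P X.1

theorem IsProjCover.smul_eq {b : A} (hb : b * b = b) (hc : ∀ r : A, b * r = r * b)
    {P S : Type u} [AddCommGroup P] [Module A P] [AddCommGroup S] [Module A S] {π : P →ₗ[A] S}
    (hπ : IsProjCover A π) (hS : ∀ v : S, b • v = v) (v : P) : b • v = v := by
  have h : blockComponent A b hc P = ⊤ := hπ.2.2 _ (eq_top_iff.2 fun x _ =>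
    Submodule.mem_sup.2 ⟨b • x, by
      change b • b • x = b • x
      rw [← mul_smul, hb], x - b • x, by simp [hS], by abel⟩)
  exact (h ▸ Submodule.mem_top : v ∈ blockComponent A b hc P)

theorem homDim_eq_sum (k : Type u) [Field k] [Algebra k A] [Module.Finite k A] {b : A}
    {n : ℕ} (S P : Fin n → ModuleCat.{u} A) (hP : ∀ i, Module.Projective A (P i))
    (hPf : ∀ i, Module.Finite A (P i)) (hS : ∀ i, IsSimpleModule A (S i))
    (hSe : ∀ (T : Type u) [AddCommGroup T] [Module A T] [IsSimpleModule A T],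
      (∀ v : T, b • v = v) → ∃ i, Nonempty ((S i : Type u) ≃ₗ[A] T))
    (h0 : ∀ i, homDim k A (P i) (S i) ≠ 0) (hij : ∀ i j, i ≠ j → homDim k A (P i) (S j) = 0)
    (Q : Type u) [AddCommGroup Q] [Module A Q] [Module.Projective A Q] [Module.Finite A Q]
    (X : Type u) [AddCommGroup X] [Module A X] [Module.Finite A X] (hX : ∀ v : X, b • v = v) :
    (homDim k A Q X : ℚ) = ∑ i, (homDim k A Q (S i) : ℚ) / homDim k A (P i) (S i) *
      homDim k A (P i) X := by
  have : IsNoetherianRing A := isNoetherian_of_tower k inferInstance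
  have : IsArtinianRing A := isArtinian_of_tower k inferInstance
  have hadd : ∀ (R : Type u) [AddCommGroup R] [Module A R] [Module.Projective A R]
      [Module.Finite A R] (X : Type u) [AddCommGroup X] [Module A X] [Module.Finite A X]
      (N : Submodule A X), homDim k A R X = homDim k A R N + homDim k A R (X ⧸ N) :=
    fun R _ _ _ _ X _ _ _ N => homDim_eq_add_of_exact_right k A N.subtype N.mkQ
      N.injective_subtype (LinearMap.exact_subtype_mkQ N)
      fun h => Module.projective_lifting_property _ h N.mkQ_surjective
  have hsimple : ∀ (T : Type u) [AddCommGroup T] [Module A T] [IsSimpleModule A T],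
      (∀ v : T, b • v = v) → (homDim k A Q T : ℚ) =
        ∑ i, (homDim k A Q (S i) : ℚ) / homDim k A (P i) (S i) * homDim k A (P i) T := by
    intro T _ _ _ hT
    obtain ⟨j, ⟨e⟩⟩ := hSe T hT
    have hc : ∀ (R : Type u) [AddCommGroup R] [Module A R] [Module.Finite A R],
        homDim k A R T = homDim k A R (S j) := fun R _ _ _ => (homDim_congr_right k A e).symm
    have := hS j
    rw [Finset.sum_eq_single j, hc, hc, div_mul_cancel₀ _ (Nat.cast_ne_zero.2 (h0 j))]
    · intro i _ hi
      rw [hc, hij i j hi, Nat.cast_zero, mul_zero]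
    · simp
  have hfl : IsFiniteLength A X := isFiniteLength_iff_isNoetherian_isArtinian.2
    ⟨inferInstance, inferInstance⟩
  clear h0 hij hS hSe
  induction hfl with
  | @of_subsingleton M _ _ _ =>
    have hz : ∀ (R : Type u) [AddCommGroup R] [Module A R] [Module.Finite A R],
        homDim k A R M = 0 := fun R _ _ _ =>
      (homDim_eq_zero_iff k A R M).2 fun f => Subsingleton.elim _ _
    simp [hz]
  | @of_simple_quotient M _ _ N _ hN ih =>
    have hM : IsNoetherian A M :=
      (isFiniteLength_iff_isNoetherian_isArtinian.1 (.of_simple_quotient hN)).1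
    have h1 := ih (fun v => Subtype.ext (hX v))
    have h2 := hsimple (M ⧸ N) fun v => by
      obtain ⟨w, rfl⟩ := N.mkQ_surjective v
      rw [← map_smul, hX]
    simp only [hadd _ M N, Nat.cast_add, mul_add, Finset.sum_add_distrib]
    rw [h1, h2]

/-- The dimension vectors of the indecomposable projective modules of a block form a basis of the
space spanned by the dimension vectors of its projective modules. -/
theorem exists_projective_family (k : Type u) [Field k] [Algebra k A] [Module.Finite k A]
    {b : A} (hb : b * b = b) (hc : ∀ r : A, b * r = r * b) :
    ∃ P : Fin (numSimplesIn A b) → ModuleCat.{u} A,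
      (∀ i, Module.Projective A (P i) ∧ Module.Finite A (P i) ∧
        ∀ v : (P i : Type u), b • v = v) ∧
      LinearIndependent ℚ (fun i => dimVec k b (P i)) ∧
      ∀ (Q : Type u) [AddCommGroup Q] [Module A Q], Module.Projective A Q → Module.Finite A Q →
        dimVec k b Q ∈ Submodule.span ℚ ((fun i => dimVec k b (P i)) ''
          {i | ∃ f : Q →ₗ[A] P i, Function.Surjective f}) := by
  classical
  have : IsNoetherianRing A := isNoetherian_of_tower k inferInstance
  have : IsArtinianRing A := isArtinian_of_tower k inferInstance
  have := finite_simple_classes b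
  let e : Fin (numSimplesIn A b) ≃
      (Quot fun X Y : SimpleIn b => Nonempty ((X.1 : Type u) ≃ₗ[A] (Y.1 : Type u))) :=
    (Finite.equivFin _).symm
  let S : Fin (numSimplesIn A b) → ModuleCat.{u} A := fun i => (e i).out.1
  have hS : ∀ i, IsSimpleModule A (S i) := fun i => (e i).out.2.1
  have hSb : ∀ i, ∀ v : (S i : Type u), b • v = v := fun i => (e i).out.2.2
  have hSf : ∀ i, Module.Finite A (S i) := fun i => inferInstance
  have hSe : ∀ (T : Type u) [AddCommGroup T] [Module A T] [IsSimpleModule A T],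
      (∀ v : T, b • v = v) → ∃ i, Nonempty ((S i : Type u) ≃ₗ[A] T) := by
    intro T _ _ hT hTb
    refine ⟨e.symm (Quot.mk _ ⟨ModuleCat.of A T, hT, hTb⟩), ?_⟩
    have h := Quot.out_eq (e (e.symm (Quot.mk _ (⟨ModuleCat.of A T, hT, hTb⟩ : SimpleIn b))))
    conv_rhs at h => rw [e.apply_symm_apply]
    exact ((equivalence_nonempty_linearEquiv _).quot_mk_eq_iff _ _).1 h
  choose P π hπ hPf using fun i => exists_projCover (A := A) (S i)
  have hP := fun i => (hπ i).1
  have hij : ∀ i j, i ≠ j → homDim k A (P i) (S j) = 0 := by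
    intro i j hij
    rw [homDim_eq_zero_iff]
    by_contra! h
    obtain ⟨f, hf⟩ := h
    obtain ⟨g⟩ := (hπ i).nonempty_equiv f hf
    refine hij (e.injective ?_)
    rw [← (e i).out_eq, ← (e j).out_eq]
    exact Quot.sound ⟨g⟩
  have h0 : ∀ i, homDim k A (P i) (S i) ≠ 0 := by
    intro i h
    rw [homDim_eq_zero_iff] at h
    have := IsSimpleModule.nontrivial A (S i)
    obtain ⟨v, hv⟩ := exists_ne (0 : S i)
    obtain ⟨x, hx⟩ := (hπ i).2.1 v
    exact hv (by rw [← hx, h (π i), LinearMap.zero_apply])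
  refine ⟨P, fun i => ⟨hP i, hPf i, (hπ i).smul_eq hb hc (hSb i)⟩, ?_, ?_⟩
  · rw [Fintype.linearIndependent_iff]
    intro g hg j
    have h1 := congrFun hg ⟨S j, hSf j, hSb j⟩
    simp only [Finset.sum_apply, Pi.smul_apply, smul_eq_mul, dimVec, Pi.zero_apply] at h1
    rw [Finset.sum_eq_single j (fun i _ hi => by rw [hij i j hi, Nat.cast_zero, mul_zero])
      (by simp)] at h1
    exact (mul_eq_zero.1 h1).resolve_right (Nat.cast_ne_zero.2 (h0 j))
  · intro Q _ _ hQ hQf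
    have h1 : dimVec k b Q = ∑ i, ((homDim k A Q (S i) : ℚ) / homDim k A (P i) (S i)) •
        dimVec k b (P i) := by
      ext X
      have := X.2.1
      simp only [Finset.sum_apply, Pi.smul_apply, smul_eq_mul, dimVec]
      exact homDim_eq_sum k S P hP hPf hS hSe h0 hij Q X.1 X.2.2
    rw [h1]
    refine Submodule.sum_mem _ fun i _ => ?_
    by_cases h : homDim k A Q (S i) = 0
    · rw [h, Nat.cast_zero, zero_div, zero_smul]
      exact Submodule.zero_mem _
    refine Submodule.smul_mem _ _ (Submodule.subset_span ⟨i, ?_, rfl⟩)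
    rw [homDim_eq_zero_iff] at h
    push Not at h
    obtain ⟨f, hf⟩ := h
    have hfs := LinearMap.surjective_of_ne_zero hf
    obtain ⟨q, hq⟩ := Module.projective_lifting_property (π i) f (hπ i).2.1
    refine ⟨q, LinearMap.range_eq_top.1 ((hπ i).2.2 _ (eq_top_iff.2 fun x _ => ?_))⟩
    obtain ⟨y, hy⟩ := hfs (π i x)
    have hy' : π i (q y) = π i x := (LinearMap.congr_fun hq y).trans hy
    exact Submodule.mem_sup.2 ⟨q y, ⟨y, rfl⟩, x - q y, by simp [hy'], by abel⟩

theorem numSimplesIn_one : numSimplesIn A 1 = numSimples A :=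
  Nat.card_congr (Quot.congr (Equiv.subtypeEquivRight fun X => by simp) fun _ _ => Iff.rfl)

end DimensionVectors

section PresentationVectors

variable {A : Type u} [Ring A]

theorem projective_pi {ι : Type*} [Fintype ι] {P : ι → Type*} [∀ i, AddCommGroup (P i)]
    [∀ i, Module A (P i)] [∀ i, Module.Projective A (P i)] : Module.Projective A (∀ i, P i) := by
  classical
  exact .of_equiv (DFinsupp.linearEquivFunOnFintype (R := A) (M := P))

/-- `P` is a finitely generated projective module on which `b` acts as the identity. -/
structure IsBlockProj (b : A) (P : Type u) [AddCommGroup P] [Module A P] : Prop where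
  projective : Module.Projective A P
  finite : Module.Finite A P
  smul_eq : ∀ v : P, b • v = v

/-- `w` is the difference of the dimension vectors of the terms of a projective presentation
`R₁ → R₀ → Z → 0` such that all maps from `R₁` to a test module factor through `R₀`. -/
def HasPresVec (k : Type u) [Field k] [Algebra k A] (b : A) {P₁ P₀ : Type u} [AddCommGroup P₁]
    [Module A P₁] [AddCommGroup P₀] [Module A P₀] (u : P₁ →ₗ[A] P₀) (Z : Type u) [AddCommGroup Z]
    [Module A Z] (w : BlockMod b → ℚ) : Prop :=
  ∃ (R₁ R₀ : ModuleCat.{u} A) (v : (R₁ : Type u) →ₗ[A] R₀) (ρ : (R₀ : Type u) →ₗ[A] Z),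
    IsBlockProj b R₁ ∧ IsBlockProj b R₀ ∧ Function.Surjective ρ ∧
    LinearMap.ker ρ = LinearMap.range v ∧
    (∀ (Y : Type u) [AddCommGroup Y] [Module A Y], IsTestModule b u Y → ExtendsAlong v Y) ∧
    w = dimVec k b R₀ - dimVec k b R₁

variable {b : A} {P₁ P₀ : Type u} [AddCommGroup P₁] [Module A P₁] [AddCommGroup P₀]
  [Module A P₀] {u : P₁ →ₗ[A] P₀}

theorem IsBlockProj.prod {P Q : Type u} [AddCommGroup P] [Module A P] [AddCommGroup Q]
    [Module A Q] (hP : IsBlockProj b P) (hQ : IsBlockProj b Q) : IsBlockProj b (P × Q) where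
  projective := have := hP.projective; have := hQ.projective; inferInstance
  finite := have := hP.finite; have := hQ.finite; inferInstance
  smul_eq v := Prod.ext (hP.smul_eq v.1) (hQ.smul_eq v.2)

theorem IsBlockProj.of_retract {P Q : Type u} [AddCommGroup P] [Module A P] [AddCommGroup Q]
    [Module A Q] (hP : IsBlockProj b P) (i : Q →ₗ[A] P) (p : P →ₗ[A] Q)
    (h : p.comp i = LinearMap.id) : IsBlockProj b Q where
  projective := have := hP.projective; .of_split i p h
  finite := have := hP.finite; .of_surjective p fun x => ⟨i x, LinearMap.congr_fun h x⟩
  smul_eq v := by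
    have h1 : p (i v) = v := LinearMap.congr_fun h v
    rw [← h1, ← map_smul, hP.smul_eq]

theorem IsTestModule.of_inAdd [Module.Projective A P₁] {C Z : Type u} [AddCommGroup C]
    [Module A C] [AddCommGroup Z] [Module A Z] (hC : IsTestModule b u C) (h : InAdd A C Z) :
    IsTestModule b u Z := by
  obtain ⟨n, i, p, hp⟩ := h
  exact (hC.fin n).of_surjective p fun x => ⟨i x, LinearMap.congr_fun hp x⟩

variable (k : Type u) [Field k] [Algebra k A]

theorem dimVec_congr [Module.Finite k A] {P Q : Type u} [AddCommGroup P] [Module A P]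
    [AddCommGroup Q] [Module A Q] (e : P ≃ₗ[A] Q) : dimVec k b P = dimVec k b Q :=
  funext fun _ => congrArg _ (homDim_congr_left k A e)

theorem dimVec_prod [Module.Finite k A] {P Q : Type u} [AddCommGroup P] [Module A P]
    [AddCommGroup Q] [Module A Q] [Module.Finite A P] [Module.Finite A Q] :
    dimVec k b (P × Q) = dimVec k b P + dimVec k b Q :=
  funext fun X => by
    have := X.2.1
    simp [dimVec, homDim_prod]

variable {k}

theorem HasPresVec.congr {Z Z' : Type u} [AddCommGroup Z] [Module A Z] [AddCommGroup Z']
    [Module A Z'] {w : BlockMod b → ℚ} (h : HasPresVec k b u Z w) (e : Z ≃ₗ[A] Z') :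
    HasPresVec k b u Z' w := by
  obtain ⟨R₁, R₀, v, ρ, h1, h0, hρ, hker, hext, hw⟩ := h
  refine ⟨R₁, R₀, v, e.toLinearMap.comp ρ, h1, h0, e.surjective.comp hρ, ?_, hext, hw⟩
  rw [LinearEquiv.ker_comp, hker]

theorem HasPresVec.prod [Module.Finite k A] {Z Z' : Type u} [AddCommGroup Z] [Module A Z]
    [AddCommGroup Z'] [Module A Z'] {w w' : BlockMod b → ℚ} (h : HasPresVec k b u Z w)
    (h' : HasPresVec k b u Z' w') : HasPresVec k b u (Z × Z') (w + w') := by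
  obtain ⟨R₁, R₀, v, ρ, h1, h0, hρ, hker, hext, rfl⟩ := h
  obtain ⟨R₁', R₀', v', ρ', h1', h0', hρ', hker', hext', rfl⟩ := h'
  have := h1.finite
  have := h0.finite
  have := h1'.finite
  have := h0'.finite
  refine ⟨.of A (R₁ × R₁'), .of A (R₀ × R₀'), v.prodMap v', ρ.prodMap ρ', h1.prod h1', h0.prod h0',
    hρ.prodMap hρ', ?_, fun Y _ _ hY f => ?_, ?_⟩
  · rw [LinearMap.ker_prodMap, LinearMap.range_prodMap, hker, hker']
  · obtain ⟨e, he⟩ := hext Y hY (f.comp (LinearMap.inl A R₁ R₁'))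
    obtain ⟨e', he'⟩ := hext' Y hY (f.comp (LinearMap.inr A R₁ R₁'))
    refine ⟨e.coprod e', LinearMap.ext fun x => ?_⟩
    have h2 := LinearMap.congr_fun he x.1
    have h3 := LinearMap.congr_fun he' x.2
    simp only [LinearMap.comp_apply, LinearMap.prodMap_apply, LinearMap.coprod_apply] at h2 h3 ⊢
    rw [h2, h3, ← map_add]
    simp
  · change _ = dimVec k b (R₀ × R₀') - dimVec k b (R₁ × R₁')
    rw [dimVec_prod, dimVec_prod]
    abel

theorem HasPresVec.apply_eq [Module.Finite k A] {Z : Type u} [AddCommGroup Z] [Module A Z]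
    {w : BlockMod b → ℚ} (h : HasPresVec k b u Z w) (X : BlockMod b) (hX : ExtendsAlong u X.1) :
    w X = homDim k A Z X.1 := by
  obtain ⟨R₁, R₀, v, ρ, h1, h0, hρ, hker, hext, rfl⟩ := h
  have := h0.finite
  have := X.2.1
  rw [Pi.sub_apply, dimVec, dimVec, homDim_eq_add_of_exact_left k A v ρ hρ hker
    (hext X.1 ⟨X.2.1, X.2.2, hX⟩)]
  push_cast
  ring

theorem exists_hasPresVec [Module.Finite k A] (hb : b * b = b) (hc : ∀ r : A, b * r = r * b)
    [Module.Projective A P₁] [Module.Projective A P₀]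
    {C Z : Type u} [AddCommGroup C] [Module A C] [AddCommGroup Z] [Module A Z]
    (π₀ : P₀ →ₗ[A] C) (hπ₀ : Function.Surjective π₀) (hu : LinearMap.ker π₀ = LinearMap.range u)
    [Module.Finite A C] (hC : ∀ x : C, b • x = x) (hZ : InAdd A C Z) :
    ∃ w, HasPresVec k b u Z w := by
  classical
  have : IsNoetherianRing A := isNoetherian_of_tower k inferInstance
  have : IsArtinianRing A := isArtinian_of_tower k inferInstance
  obtain ⟨n, i, p, hp⟩ := hZ
  have hpi : ∀ x, p (i x) = x := LinearMap.congr_fun hp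
  have hZf : Module.Finite A Z := .of_surjective p fun x => ⟨i x, hpi x⟩
  have hZb : ∀ x : Z, b • x = x := fun x => by
    rw [← hpi x, ← map_smul]
    exact congrArg p (funext fun _ => hC _)
  obtain ⟨R₀, ρ₀, hρ₀, hR₀⟩ := exists_projCover (A := A) Z
  obtain ⟨R₁, ρ₁, hρ₁, hR₁⟩ := exists_projCover (A := A) (LinearMap.ker ρ₀)
  have hb₀ := hρ₀.smul_eq hb hc hZb
  have hb₁ := hρ₁.smul_eq hb hc fun v => Subtype.ext (hb₀ v)
  refine ⟨_, R₁, R₀, (LinearMap.ker ρ₀).subtype.comp ρ₁, ρ₀, ⟨hρ₁.1, hR₁, hb₁⟩,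
    ⟨hρ₀.1, hR₀, hb₀⟩, hρ₀.2.1, ?_, fun Y _ _ hY => ?_, rfl⟩
  · rw [LinearMap.range_comp, LinearMap.range_eq_top.2 hρ₁.2.1, Submodule.map_subtype_top]
  have := hρ₀.1
  refine .of_projCover hρ₁ fun W => ?_
  have hYW := (hY.of_surjective W.mkQ W.mkQ_surjective).extendsAlong
  have hext : ExtendsAlong (u.compLeft (Fin n)) (Y ⧸ W) := fun f => by
    choose e he using fun j => hYW (f.comp (LinearMap.single A (fun _ => P₁) j))
    refine ⟨∑ j, (e j).comp (LinearMap.proj j), LinearMap.ext fun x => ?_⟩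
    have he' : ∀ j y, e j (u y) = f (Pi.single j y) := fun j => LinearMap.congr_fun (he j)
    rw [LinearMap.comp_apply, LinearMap.sum_apply]
    conv_rhs => rw [← Finset.univ_sum_single x, map_sum]
    exact Finset.sum_congr rfl fun j _ => he' j (x j)
  have hsurj : Function.Surjective (π₀.compLeft (Fin n)) := hπ₀.comp_left
  have : Module.Projective A (Fin n → P₀) := projective_pi
  refine (hext.extendsFromKernel (π₀ := π₀.compLeft (Fin n)) ?_).of_retract hsurj hρ₀.2.1 i p hp
  ext x
  constructor
  · intro hx
    have h1 : ∀ j, ∃ y, u y = x j := fun j => by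
      have : x j ∈ LinearMap.ker π₀ := congrFun hx j
      rwa [hu] at this
    choose y hy using h1
    exact ⟨y, funext hy⟩
  · rintro ⟨y, rfl⟩
    exact funext fun j => by
      have : u (y j) ∈ LinearMap.ker π₀ := hu ▸ ⟨y j, rfl⟩
      exact this

theorem IsProjCover.exists_complement [Module.Finite k A] {E X R₁ R₀ R' Z : Type u}
    [AddCommGroup E] [Module A E] [AddCommGroup X] [Module A X] [AddCommGroup R₁] [Module A R₁]
    [AddCommGroup R₀] [Module A R₀] [AddCommGroup R'] [Module A R'] [AddCommGroup Z] [Module A Z]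
    {ε : E →ₗ[A] X} (hε : IsProjCover A ε) (h1 : IsBlockProj b R₁) (h' : IsBlockProj b R')
    {v : R₁ →ₗ[A] R₀} (hv : ExtendsAlong v Z) (φ : R₁ × R' →ₗ[A] X) (hφ : Function.Surjective φ)
    (hker : ∀ x, φ x = 0 → v x.1 = 0 ∧ x.2 = 0) :
    ∃ Q : ModuleCat.{u} A, IsBlockProj b Q ∧ (∀ f : (Q : Type u) →ₗ[A] Z, f = 0) ∧
      dimVec k b R₁ + dimVec k b R' = dimVec k b E + dimVec k b Q := by
  have hprod := h1.prod h'
  have := hprod.projective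
  have := h1.finite
  have := h'.finite
  have := hε.1
  obtain ⟨φ', hφ'⟩ := Module.projective_lifting_property ε φ hε.2.1
  have hφ'' : ∀ x, ε (φ' x) = φ x := LinearMap.congr_fun hφ'
  have hsurj : Function.Surjective φ' := by
    refine LinearMap.range_eq_top.1 (hε.2.2 _ (eq_top_iff.2 fun x _ => ?_))
    obtain ⟨y, hy⟩ := hφ (ε x)
    exact Submodule.mem_sup.2 ⟨φ' y, ⟨y, rfl⟩, x - φ' y, by simp [hφ'', hy], by abel⟩
  obtain ⟨s, hs⟩ := Module.projective_lifting_property φ' LinearMap.id hsurj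
  have hs' : ∀ x, φ' (s x) = x := LinearMap.congr_fun hs
  let r : R₁ × R' →ₗ[A] LinearMap.ker φ' :=
    (LinearMap.id - s.comp φ').codRestrict _ fun x => by simp [hs']
  have hr : r.comp (LinearMap.ker φ').subtype = LinearMap.id := by
    refine LinearMap.ext fun x => Subtype.ext ?_
    change (x : R₁ × R') - s (φ' x) = x
    rw [LinearMap.mem_ker.1 x.2, map_zero, sub_zero]
  refine ⟨.of A (LinearMap.ker φ'), hprod.of_retract _ r hr, fun f => ?_, ?_⟩
  · obtain ⟨e, he⟩ := hv ((f.comp r).comp (LinearMap.inl A R₁ R'))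
    refine LinearMap.ext fun q => ?_
    have hq := hker q.1 (by rw [← hφ'', LinearMap.mem_ker.1 q.2, map_zero])
    have h2 : f (r (q.1.1, 0)) = 0 := by
      have := LinearMap.congr_fun he q.1.1
      rw [LinearMap.comp_apply, hq.1, map_zero] at this
      exact this.symm
    have h3 : ((q.1.1, 0) : R₁ × R') = q.1 := Prod.ext rfl hq.2.symm
    rw [h3] at h2
    have h4 : r q.1 = q := LinearMap.congr_fun hr q
    rwa [h4] at h2
  · rw [← dimVec_prod]
    funext Y
    have := Y.2.1
    have := homDim_eq_add_of_exact_left k A (X := Y.1) (LinearMap.ker φ').subtype φ' hsurj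
      (Submodule.range_subtype _).symm
      fun h => ⟨h.comp r, by rw [LinearMap.comp_assoc, hr, LinearMap.comp_id]⟩
    simp only [dimVec, this, Nat.cast_add, Pi.add_apply]

theorem HasPresVec.exists_sub_eq [Module.Finite k A] {Z : Type u} [AddCommGroup Z] [Module A Z]
    {w w' : BlockMod b → ℚ} (h : HasPresVec k b u Z w) (h' : HasPresVec k b u Z w')
    (hZ : IsTestModule b u Z) :
    ∃ Q Q' : ModuleCat.{u} A, IsBlockProj b Q ∧ IsBlockProj b Q' ∧
      (∀ f : (Q : Type u) →ₗ[A] Z, f = 0) ∧ (∀ f : (Q' : Type u) →ₗ[A] Z, f = 0) ∧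
      w - w' = dimVec k b Q' - dimVec k b Q := by
  have : IsNoetherianRing A := isNoetherian_of_tower k inferInstance
  have : IsArtinianRing A := isArtinian_of_tower k inferInstance
  obtain ⟨R₁, R₀, v, ρ, h1, h0, hρ, hker, hext, rfl⟩ := h
  obtain ⟨R₁', R₀', v', ρ', h1', h0', hρ', hker', hext', rfl⟩ := h'
  have := h0.projective
  have := h0'.projective
  have := h0.finite
  have := h0'.finite
  let X : Submodule A (R₀ × R₀') :=
    LinearMap.ker ((ρ.comp (LinearMap.fst A R₀ R₀')) - (ρ'.comp (LinearMap.snd A R₀ R₀')))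
  have hX : ∀ x : R₀ × R₀', x ∈ X ↔ ρ x.1 = ρ' x.2 := fun x => by
    simp [X, sub_eq_zero]
  have hρv : ∀ x, ρ (v x) = 0 := fun x => by
    have : v x ∈ LinearMap.ker ρ := hker ▸ ⟨x, rfl⟩
    exact this
  have hρv' : ∀ x, ρ' (v' x) = 0 := fun x => by
    have : v' x ∈ LinearMap.ker ρ' := hker' ▸ ⟨x, rfl⟩
    exact this
  obtain ⟨E, ε, hε, -⟩ := exists_projCover (A := A) X
  obtain ⟨σ, hσ⟩ := Module.projective_lifting_property ρ ρ' hρ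
  obtain ⟨σ', hσ'⟩ := Module.projective_lifting_property ρ' ρ hρ'
  have hσ : ∀ x, ρ (σ x) = ρ' x := LinearMap.congr_fun hσ
  have hσ' : ∀ x, ρ' (σ' x) = ρ x := LinearMap.congr_fun hσ'
  let φ : R₁ × R₀' →ₗ[A] X :=
    ((v.coprod σ).prod (LinearMap.snd A R₁ R₀')).codRestrict _ fun x => by simp [hX, hρv, hσ]
  let φ' : R₁' × R₀ →ₗ[A] X :=
    ((LinearMap.snd A R₁' R₀).prod (v'.coprod σ')).codRestrict _ fun x => by simp [hX, hρv', hσ']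
  have hφ : ∀ x, (φ x : R₀ × R₀') = (v x.1 + σ x.2, x.2) := fun x => rfl
  have hφ' : ∀ x, (φ' x : R₀ × R₀') = (x.2, v' x.1 + σ' x.2) := fun x => rfl
  have hφs : Function.Surjective φ := by
    rintro ⟨⟨x, y⟩, hxy⟩
    have h2 : x - σ y ∈ LinearMap.range v := by
      rw [← hker, LinearMap.mem_ker, map_sub, hσ, (hX _).1 hxy, sub_self]
    obtain ⟨z, hz⟩ := h2
    refine ⟨(z, y), Subtype.ext ?_⟩
    simp [hφ, hz]
  have hφs' : Function.Surjective φ' := by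
    rintro ⟨⟨x, y⟩, hxy⟩
    have h2 : y - σ' x ∈ LinearMap.range v' := by
      rw [← hker', LinearMap.mem_ker, map_sub, hσ', (hX _).1 hxy, sub_self]
    obtain ⟨z, hz⟩ := h2
    refine ⟨(z, x), Subtype.ext ?_⟩
    simp [hφ', hz]
  obtain ⟨Q, hQ, hQZ, hQd⟩ := hε.exists_complement (k := k) h1 h0' (hext Z hZ) φ hφs fun x hx => by
    have h2 := congrArg Subtype.val hx
    rw [hφ] at h2
    have h3 : x.2 = 0 := congrArg Prod.snd h2
    have h4 : v x.1 + σ x.2 = 0 := congrArg Prod.fst h2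
    rw [h3, map_zero, add_zero] at h4
    exact ⟨h4, h3⟩
  obtain ⟨Q', hQ', hQZ', hQd'⟩ := hε.exists_complement (k := k) h1' h0 (hext' Z hZ) φ' hφs'
    fun x hx => by
      have h2 := congrArg Subtype.val hx
      rw [hφ'] at h2
      have h3 : x.2 = 0 := congrArg Prod.fst h2
      have h4 : v' x.1 + σ' x.2 = 0 := congrArg Prod.snd h2
      rw [h3, map_zero, add_zero] at h4
      exact ⟨h4, h3⟩
  refine ⟨Q, Q', hQ, hQ', hQZ, hQZ', ?_⟩
  have e1 : dimVec k b R₁ = dimVec k b E + dimVec k b Q - dimVec k b R₀' := eq_sub_of_add_eq hQd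
  have e2 : dimVec k b R₁' = dimVec k b E + dimVec k b Q' - dimVec k b R₀ := eq_sub_of_add_eq hQd'
  rw [e1, e2]
  abel

end PresentationVectors

section IndependentFamilies

variable {A : Type u} [Ring A]

/-- The isomorphism classes of indecomposable direct summands of `M`. -/
abbrev IndecClass (A : Type u) [Ring A] (M : Type u) [AddCommGroup M] [Module A M] : Type u :=
  Quot fun L L' : IndecSummand A M => Nonempty (L.1 ≃ₗ[A] L'.1)

theorem IndecClass.mk_eq_iff {M : Type u} [AddCommGroup M] [Module A M]
    (L L' : IndecSummand A M) :
    Quot.mk (fun L L' : IndecSummand A M => Nonempty (L.1 ≃ₗ[A] L'.1)) L = Quot.mk _ L' ↔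
      Nonempty (L.1 ≃ₗ[A] L'.1) :=
  (equivalence_nonempty_linearEquiv fun L : IndecSummand A M => .of A L.1).quot_mk_eq_iff L L'

theorem IndecClass.not_equiv_out {M : Type u} [AddCommGroup M] [Module A M]
    {c c' : IndecClass A M} (h : c ≠ c') : ¬ Nonempty (c.out.1 ≃ₗ[A] c'.out.1) := fun e => by
  have := Quot.sound (r := fun L L' : IndecSummand A M => Nonempty (L.1 ≃ₗ[A] L'.1)) e
  rw [Quot.out_eq, Quot.out_eq] at this
  exact h this

theorem IndecSummand.inAdd {M : Type u} [AddCommGroup M] [Module A M] (L : IndecSummand A M) :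
    InAdd A M L.1 := by
  obtain ⟨p, hp⟩ := L.exists_retract
  exact (InAdd.refl M).of_retract _ p hp

variable {b : A} {P₁ P₀ : Type u} [AddCommGroup P₁] [Module A P₁] [AddCommGroup P₀]
  [Module A P₀] {u : P₁ →ₗ[A] P₀} (k : Type u) [Field k] [Algebra k A] [Module.Finite k A]

theorem linearIndependent_homDim [Module.Projective A P₁] {ι : Type u} {Y : ι → Type u}
    [∀ i, AddCommGroup (Y i)] [∀ i, Module A (Y i)]
    (hind : ∀ i, IsIndecModule A (Y i))
    (hniso : ∀ i j, i ≠ j → ¬ Nonempty (Y i ≃ₗ[A] Y j))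
    (hT : ∀ i, IsTestModule b u (Y i))
    (hext : ∀ i, ∃ (R : ModuleCat.{u} A) (π : (R : Type u) →ₗ[A] Y i), Module.Projective A R ∧
      Function.Surjective π ∧ ∀ (X : Type u) [AddCommGroup X] [Module A X], IsTestModule b u X →
        ExtendsFromKernel π X) :
    LinearIndependent ℚ fun i (X : {X : BlockMod b // ExtendsAlong u X.1}) =>
      (homDim k A (Y i) X.1.1 : ℚ) := by
  refine linearIndependent_iff'.2 fun s c h0 i hi => ?_
  refine coeff_eq_zero_of_sum_homDim_eq_zero k (ι := s) (Y := fun i => Y i) (b := b) (u := u)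
    (fun i => hind i) (fun i j hij => hniso i j (Subtype.coe_injective.ne hij)) (fun i => hT i)
    (fun i => hext i) (fun i => c i) (fun X _ _ hX => ?_) ⟨i, hi⟩
  have := congrFun h0 ⟨⟨.of A X, hX.finite, hX.smul_eq⟩, hX.extendsAlong⟩
  rw [Finset.sum_coe_sort s fun i => c i * (homDim k A (Y i) X : ℚ)]
  simpa [Finset.sum_apply] using this

theorem linearIndependent_dimVec {Q : Type u} [AddCommGroup Q] [Module A Q]
    (hQ : IsBlockProj b Q) :
    LinearIndependent ℚ fun c : IndecClass A Q => dimVec k b c.out.1 := by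
  let u' : PUnit.{u + 1} →ₗ[A] PUnit.{u + 1} := 0
  have hp (c : IndecClass A Q) : IsBlockProj b c.out.1 :=
    c.out.exists_retract.elim fun p hp => hQ.of_retract _ p hp
  have h := linearIndependent_homDim k (b := b) (u := u') (Y := fun c : IndecClass A Q => c.out.1)
    (fun c => c.out.2.2) (fun c c' => IndecClass.not_equiv_out)
    (fun c => ⟨(hp c).finite, (hp c).smul_eq, fun h => ⟨h, LinearMap.ext fun x => by
      rw [Subsingleton.elim x 0, map_zero, map_zero]⟩⟩)
    fun c => ⟨.of A c.out.1, LinearMap.id, (hp c).projective, Function.surjective_id,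
      fun X _ _ _ h => ⟨0, fun z => by
        have : z = 0 := Subtype.ext z.2
        rw [this, map_zero, LinearMap.zero_apply]⟩⟩
  exact .of_comp (LinearMap.funLeft ℚ ℚ Subtype.val) h

theorem exists_linearIndependent_presVec [Module.Projective A P₁] {M Q : Type u}
    [AddCommGroup M] [Module A M] [AddCommGroup Q] [Module A Q] (hM : IsTestModule b u M)
    (hpres : ∀ L : IndecSummand A M, ∃ w, HasPresVec k b u L.1 w) (hQ : IsBlockProj b Q)
    (hQT : ∀ (Y : Type u) [AddCommGroup Y] [Module A Y], IsTestModule b u Y →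
      ∀ f : Q →ₗ[A] Y, f = 0) :
    ∃ g : IndecClass A M → BlockMod b → ℚ, (∀ c, HasPresVec k b u c.out.1 (g c)) ∧
      LinearIndependent ℚ (Sum.elim g fun c : IndecClass A Q => dimVec k b c.out.1) := by
  choose g hg using fun c : IndecClass A M => hpres c.out
  refine ⟨g, hg, ?_⟩
  have hT (c : IndecClass A M) : IsTestModule b u c.out.1 := hM.of_inAdd c.out.inAdd
  let ev : (BlockMod b → ℚ) →ₗ[ℚ] ({X : BlockMod b // ExtendsAlong u X.1} → ℚ) :=
    LinearMap.funLeft ℚ ℚ Subtype.val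
  have hLI : LinearIndependent ℚ (ev ∘ g) := by
    have h := linearIndependent_homDim k (b := b) (u := u)
      (Y := fun c : IndecClass A M => c.out.1)
      (fun c => c.out.2.2) (fun c c' => IndecClass.not_equiv_out) hT fun c => by
        obtain ⟨R₁, R₀, v, ρ, h1, h0, hρ, hker, hext, hw⟩ := hg c
        exact ⟨R₀, ρ, h0.projective, hρ, fun X _ _ hX => (hext X hX).extendsFromKernel hker⟩
    convert h using 1
    exact funext fun c => funext fun X => (hg c).apply_eq X.1 X.2
  refine .sum_type (.of_comp ev hLI) (linearIndependent_dimVec k hQ) ?_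
  rw [Submodule.disjoint_def]
  intro x hx hx'
  have h0 : ev x = 0 := by
    refine LinearMap.mem_ker.1 (Submodule.span_le.2 ?_ hx')
    rintro _ ⟨c, rfl⟩
    refine funext fun X => ?_
    have := X.1.2.1
    obtain ⟨p, hp⟩ := c.out.exists_retract
    have hc := hQ.of_retract _ p hp
    have := hc.finite
    refine Nat.cast_eq_zero.2 ((homDim_eq_zero_iff k A _ _).2 fun f => ?_)
    have h := hQT X.1.1 ⟨X.1.2.1, X.1.2.2, X.2⟩ (f.comp p)
    ext z
    have h1 := LinearMap.congr_fun h (z : Q)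
    have h2 : p (z : Q) = z := LinearMap.congr_fun hp z
    rwa [LinearMap.comp_apply, h2] at h1
  obtain ⟨l, rfl⟩ := (Finsupp.mem_span_range_iff_exists_finsupp (R := ℚ)).1 hx
  have h1 : Finsupp.linearCombination ℚ (ev ∘ g) l = 0 := by
    rw [← h0, Finsupp.linearCombination_apply, map_finsuppSum]
    simp
  rw [linearIndependent_iff.1 hLI l h1, Finsupp.sum_zero_index]

end IndependentFamilies

section BongartzCompletion

variable {A : Type u} [Ring A] {b : A} {P₁ P₀ C : Type u} [AddCommGroup P₁] [Module A P₁]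
  [AddCommGroup P₀] [Module A P₀] [AddCommGroup C] [Module A C] {u : P₁ →ₗ[A] P₀}
  {k : Type u} [Field k] [Algebra k A]

/-- Multiplication by a scalar, as an endomorphism of a module over a `k`-algebra. -/
def scalarEnd (c : k) (X : Type u) [AddCommGroup X] [Module A X] : X →ₗ[A] X where
  toFun x := algebraMap k A c • x
  map_add' := smul_add _
  map_smul' a x := by rw [RingHom.id_apply, ← mul_smul, ← mul_smul, Algebra.commutes]

theorem IsTestModule.exists_surjective_of_generates [Module.Finite k A] [Module.Projective A P₁]
    [Module.Projective A P₀] {π₀ : P₀ →ₗ[A] C} (hπ₀ : Function.Surjective π₀)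
    (hu : LinearMap.ker π₀ = LinearMap.range u) (hC : IsTestModule b u C)
    (hZ : ∀ (Y : Type u) [AddCommGroup Y] [Module A Y], IsTestModule b u Y →
      (∀ f : C →ₗ[A] Y, f = 0) → ∀ y : Y, y = 0)
    {Y : Type u} [AddCommGroup Y] [Module A Y] (hY : IsTestModule b u Y) :
    ∃ (r : ℕ) (Φ : (Fin r → C) →ₗ[A] Y), Function.Surjective Φ ∧
      IsTestModule b u (LinearMap.ker Φ) := by
  have : IsNoetherianRing A := isNoetherian_of_tower k inferInstance
  have := hC.finite
  have := hY.finite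
  obtain ⟨r, f, hf⟩ := exists_hom_generators (A := A) k C Y
  let Φ : (Fin r → C) →ₗ[A] Y := ∑ i, (f i).comp (LinearMap.proj i)
  have hΦ : ∀ x, Φ x = ∑ i, f i (x i) := fun x => by simp [Φ]
  have hfac : ∀ g : C →ₗ[A] Y, ∃ τ : C →ₗ[A] (Fin r → C), Φ.comp τ = g := fun g => by
    obtain ⟨c, hc⟩ := hf g
    refine ⟨LinearMap.pi fun i => scalarEnd (c i) C, LinearMap.ext fun x => ?_⟩
    rw [hc, LinearMap.comp_apply, hΦ]
    rfl
  refine ⟨r, Φ, fun y => ?_, inferInstance, fun x => Subtype.ext ((hC.fin r).smul_eq x),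
    fun h => ?_⟩
  · let q := (LinearMap.range Φ).mkQ
    have hq : Function.Surjective q := Submodule.mkQ_surjective _
    have hker : IsTestModule b u (LinearMap.ker q) := by
      have h1 : IsTestModule b u (LinearMap.range Φ) :=
        (hC.fin r).of_surjective Φ.rangeRestrict Φ.surjective_rangeRestrict
      exact h1.of_surjective (LinearEquiv.ofEq _ _ (Submodule.ker_mkQ _).symm).toLinearMap
        (LinearEquiv.surjective _)
    have h0 := hZ _ (hY.of_surjective q hq) (fun g => by
      obtain ⟨g', rfl⟩ := (hker.extendsAlong.extendsFromKernel hu).exists_lift hπ₀ q hq g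
      obtain ⟨τ, rfl⟩ := hfac g'
      exact LinearMap.ext fun x => (Submodule.Quotient.mk_eq_zero _).2 ⟨τ x, rfl⟩) (q y)
    exact (Submodule.Quotient.mk_eq_zero _).1 h0
  · obtain ⟨e, he⟩ := (hC.fin r).extendsAlong ((LinearMap.ker Φ).subtype.comp h)
    have he' : ∀ x, e (u x) = h x := LinearMap.congr_fun he
    obtain ⟨t, ht⟩ := LinearMap.exists_comp_eq_of_ker_le π₀ hπ₀ (Φ.comp e) fun x hx => by
      obtain ⟨y, rfl⟩ : x ∈ LinearMap.range u := hu ▸ hx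
      rw [LinearMap.comp_apply, he']
      exact (h y).2
    obtain ⟨τ, hτ⟩ := hfac t
    refine ⟨(e - τ.comp π₀).codRestrict _ fun x => ?_, LinearMap.ext fun x => Subtype.ext ?_⟩
    · have h1 : t (π₀ x) = Φ (e x) := LinearMap.congr_fun ht x
      have h2 : Φ (τ (π₀ x)) = t (π₀ x) := LinearMap.congr_fun hτ _
      rw [LinearMap.mem_ker, LinearMap.sub_apply, map_sub, LinearMap.comp_apply, h2, h1, sub_self]
    · have h1 : π₀ (u x) = 0 := by
        have : u x ∈ LinearMap.ker π₀ := hu ▸ ⟨x, rfl⟩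
        exact this
      change e (u x) - τ (π₀ (u x)) = h x
      rw [h1, map_zero, sub_zero, he']

theorem exists_bongartz [Module.Finite k A] (h1 : IsBlockProj b P₁) (h0 : IsBlockProj b P₀)
    {π₀ : P₀ →ₗ[A] C} (hπ₀ : Function.Surjective π₀)
    (hu : LinearMap.ker π₀ = LinearMap.range u) (hC : IsTestModule b u C)
    {P : Type u} [AddCommGroup P] [Module A P] (hP : IsBlockProj b P) :
    ∃ (n : ℕ) (E : ModuleCat.{u} A), IsTestModule b u E ∧
      HasPresVec k b u E (n • (dimVec k b P₀ - dimVec k b P₁) + dimVec k b P) := by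
  have := h1.finite
  have := h0.finite
  have := hP.finite
  have := h1.projective
  have := h0.projective
  have := hP.projective
  obtain ⟨n, α, hα⟩ := exists_hom_generators (A := A) k P₁ P
  let v : (Fin n → P₁) →ₗ[A] (Fin n → P₀) × P :=
    (u.compLeft (Fin n)).prod (∑ i, (α i).comp (LinearMap.proj i))
  have hv : ∀ x, v x = (fun j => u (x j), ∑ i, α i (x i)) := fun x => by
    refine Prod.ext rfl ?_
    simp [v]
  let ρ := (LinearMap.range v).mkQ
  have hρ : Function.Surjective ρ := Submodule.mkQ_surjective _
  have hker : LinearMap.ker ρ = LinearMap.range v := Submodule.ker_mkQ _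
  have hfin (m : ℕ) {R : Type u} [AddCommGroup R] [Module A R] (hR : IsBlockProj b R) :
      IsBlockProj b (Fin m → R) :=
    have := hR.projective
    have := hR.finite
    ⟨projective_pi, inferInstance, fun x => funext fun i => hR.smul_eq (x i)⟩
  have hR₀ := (hfin n h0).prod hP
  have hπu : ∀ x, π₀ (u x) = 0 := fun x => by
    have : u x ∈ LinearMap.ker π₀ := hu ▸ ⟨x, rfl⟩
    exact this
  refine ⟨n, .of A (((Fin n → P₀) × P) ⧸ LinearMap.range v), ⟨?_, fun x => ?_, fun h => ?_⟩,
    .of A (Fin n → P₁), .of A ((Fin n → P₀) × P), v, ρ, hfin n h1, hR₀, hρ, hker,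
    fun Y _ _ hY f => ?_, ?_⟩
  · exact .of_surjective ρ hρ
  · obtain ⟨y, rfl⟩ := hρ x
    rw [← map_smul, hR₀.smul_eq]
  · -- The quotient of `E` by the image of `P` is `C ^ n`.
    obtain ⟨θ, hθ⟩ := LinearMap.exists_comp_eq_of_ker_le ρ hρ
      ((π₀.compLeft (Fin n)).comp (LinearMap.fst A (Fin n → P₀) P)) fun x hx => by
        obtain ⟨y, rfl⟩ : x ∈ LinearMap.range v := hker ▸ hx
        rw [hv]
        exact funext fun j => hπu (y j)
    have hθ' : ∀ x, θ (ρ x) = fun j => π₀ (x.1 j) := LinearMap.congr_fun hθ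
    have hθs : Function.Surjective θ := fun y => by
      choose x hx using fun j => hπ₀ (y j)
      exact ⟨ρ (x, 0), (hθ' _).trans (funext hx)⟩
    obtain ⟨e, he⟩ := (hC.fin n).extendsAlong (θ.comp h)
    obtain ⟨e₀, he₀⟩ := Module.projective_lifting_property θ e hθs
    have hlift : ∀ x, θ ((h - e₀.comp u) x) = 0 := fun x => by
      have h2 : e (u x) = θ (h x) := LinearMap.congr_fun he x
      have h3 : θ (e₀ (u x)) = e (u x) := LinearMap.congr_fun he₀ _
      rw [LinearMap.sub_apply, map_sub, LinearMap.comp_apply, h3, h2, sub_self]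
    have hkerθ : ∀ x, θ x = 0 → ∃ y : P, ρ (0, y) = x := fun x hx => by
      obtain ⟨⟨a, y⟩, rfl⟩ := hρ x
      rw [hθ'] at hx
      have h4 : ∀ j, ∃ z, u z = a j := fun j => by
        have : a j ∈ LinearMap.ker π₀ := congrFun hx j
        rwa [hu] at this
      choose z hz using h4
      refine ⟨y - ∑ i, α i (z i), ?_⟩
      rw [← sub_eq_zero, ← map_sub]
      refine (Submodule.Quotient.mk_eq_zero _).2 ⟨-z, ?_⟩
      rw [hv]
      refine Prod.ext (funext fun j => ?_) ?_
      · simp [hz]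
      · simp
    let ψ : P →ₗ[A] LinearMap.ker θ :=
      (ρ.comp (LinearMap.inr A (Fin n → P₀) P)).codRestrict _ fun y => by
        rw [LinearMap.mem_ker, LinearMap.comp_apply, hθ']
        exact funext fun j => map_zero π₀
    have hψ : Function.Surjective ψ := fun x =>
      (hkerθ x x.2).imp fun y hy => Subtype.ext hy
    obtain ⟨g, hg⟩ := Module.projective_lifting_property ψ
      ((h - e₀.comp u).codRestrict (LinearMap.ker θ) hlift) hψ
    have hg' : ∀ x, ρ (0, g x) = h x - e₀ (u x) := fun x =>
      congrArg Subtype.val (LinearMap.congr_fun hg x)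
    obtain ⟨c, hc⟩ := hα g
    refine ⟨e₀ - ρ.comp ((LinearMap.inl A (Fin n → P₀) P).comp
      (LinearMap.pi fun i => scalarEnd (c i) P₀)), LinearMap.ext fun x => ?_⟩
    have h5 : ρ ((fun i => algebraMap k A (c i) • u x), 0) + ρ (0, g x) = 0 := by
      rw [← map_add]
      refine (Submodule.Quotient.mk_eq_zero _).2 ⟨fun i => algebraMap k A (c i) • x, ?_⟩
      rw [hv, hc]
      refine Prod.ext (funext fun j => ?_) ?_
      · simp
      · simp
    rw [hg'] at h5
    change e₀ (u x) - ρ ((fun i => algebraMap k A (c i) • u x), 0) = h x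
    rw [eq_neg_of_add_eq_zero_left h5]
    abel
  · choose e he using fun j => hY.extendsAlong (f.comp (LinearMap.single A (fun _ => P₁) j))
    refine ⟨(∑ j, (e j).comp (LinearMap.proj j)).comp (LinearMap.fst A (Fin n → P₀) P),
      LinearMap.ext fun x => ?_⟩
    have he' : ∀ j y, e j (u y) = f (Pi.single j y) := fun j => LinearMap.congr_fun (he j)
    rw [LinearMap.comp_apply, hv, LinearMap.comp_apply, LinearMap.sum_apply]
    conv_rhs => rw [← Finset.univ_sum_single x, map_sum]
    exact Finset.sum_congr rfl fun j _ => he' j (x j)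
  · change _ = dimVec k b ((Fin n → P₀) × P) - dimVec k b (Fin n → P₁)
    rw [dimVec_prod]
    funext X
    have := X.2.1
    simp only [dimVec, Pi.add_apply, Pi.sub_apply, Pi.smul_apply, homDim_fin]
    push_cast
    rw [nsmul_eq_mul]
    ring

end BongartzCompletion

section Counting

variable {A : Type u} [Ring A] {b : A} {P₁ P₀ C M : Type u} [AddCommGroup P₁] [Module A P₁]
  [AddCommGroup P₀] [Module A P₀] [AddCommGroup C] [Module A C] [AddCommGroup M] [Module A M]
  {u : P₁ →ₗ[A] P₀} {k : Type u} [Field k] [Algebra k A]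

/-- A class of modules closed under isomorphisms and binary direct sums, containing `0` and the
indecomposable direct summands of `X`, contains `X`. -/
theorem prop_of_indecSummand {X : Type u} [AddCommGroup X] [Module A X] [IsArtinian A X]
    {motive : ModuleCat.{u} A → Prop} (bot : motive (.of A PUnit))
    (congr : ∀ (U V : ModuleCat.{u} A), ((U : Type u) ≃ₗ[A] V) → motive U → motive V)
    (prod : ∀ U V : ModuleCat.{u} A, motive U → motive V → motive (.of A (U × V)))
    (indec : ∀ L : IndecSummand A X, motive (.of A L.1)) : motive (.of A X) := by
  refine congr (.of A (⊤ : Submodule A X)) _ Submodule.topEquiv ?_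
  refine indecSummand_induction (A := A) X (motive := fun U => motive (.of A U)) ?_ indec ?_
  · exact congr (.of A PUnit) _
      { toFun := fun _ => 0
        invFun := fun _ => 0
        map_add' := fun _ _ => (add_zero _).symm
        map_smul' := fun _ _ => (smul_zero _).symm
        left_inv := fun _ => rfl
        right_inv := fun _ => Subsingleton.elim _ _ } bot
  · intro U V hUV hU hV
    have hinj : Function.Injective (U.subtype.coprod V.subtype) := by
      rw [← LinearMap.ker_eq_bot, LinearMap.ker_coprod_of_disjoint_range _ _ (by simpa using hUV)]
      simp
    have hr : LinearMap.range (U.subtype.coprod V.subtype) = U ⊔ V := by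
      rw [LinearMap.range_coprod, Submodule.range_subtype, Submodule.range_subtype]
    exact congr (.of A (U × V)) _
      ((LinearEquiv.ofInjective _ hinj).trans (LinearEquiv.ofEq _ _ hr)) (prod _ _ hU hV)

theorem dimVec_mem_span [Module.Finite k A] {Q X : Type u} [AddCommGroup Q] [Module A Q]
    [Module.Finite A Q] [AddCommGroup X] [Module A X] (h : InAdd A Q X) :
    dimVec k b X ∈ Submodule.span ℚ (Set.range fun c : IndecClass A Q => dimVec k b c.out.1) := by
  have : IsNoetherianRing A := isNoetherian_of_tower k inferInstance
  have : IsArtinianRing A := isArtinian_of_tower k inferInstance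
  have : Module.Finite A X := h.elim fun n h => h.elim fun i h => h.elim fun p hp =>
    .of_surjective p fun x => ⟨i x, LinearMap.congr_fun hp x⟩
  have hp := prop_of_indecSummand (A := A) (X := X)
    (motive := fun U => Module.Finite A U ∧ dimVec k b U ∈
      Submodule.span ℚ (Set.range fun c : IndecClass A Q => dimVec k b c.out.1))
    ⟨inferInstance, ?_⟩ ?_ ?_ ?_
  · exact hp.2
  · convert Submodule.zero_mem _
    refine funext fun Y => ?_
    have := Y.2.1
    refine Nat.cast_eq_zero.2 ((homDim_eq_zero_iff k A PUnit Y.1).2 fun f => ?_)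
    exact LinearMap.ext fun x => by
      rw [Subsingleton.elim x 0, map_zero, map_zero]
  · rintro U V e ⟨h1, h2⟩
    exact ⟨.equiv e, dimVec_congr k e ▸ h2⟩
  · rintro U V ⟨h1, h2⟩ ⟨h3, h4⟩
    refine ⟨inferInstanceAs (Module.Finite A (U × V)), ?_⟩
    change dimVec k b (U × V) ∈ _
    rw [dimVec_prod]
    exact add_mem h2 h4
  · intro L
    obtain ⟨p, hp⟩ := L.exists_retract
    obtain ⟨Z, ⟨e⟩⟩ := L.2.2.exists_indecSummand_of_inAdd (h.of_retract _ p hp)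
    refine ⟨.of_surjective p fun x => ⟨x, LinearMap.congr_fun hp x⟩, ?_⟩
    obtain ⟨e'⟩ := (IndecClass.mk_eq_iff _ _).1
      (Quot.out_eq (Quot.mk (fun L L' : IndecSummand A Q => Nonempty (L.1 ≃ₗ[A] L'.1)) Z))
    change dimVec k b L.1 ∈ _
    rw [dimVec_congr k (e.trans e'.symm)]
    exact Submodule.subset_span ⟨_, rfl⟩

theorem exists_hasPresVec_mem_span [Module.Finite k A] [Module.Finite A M]
    {g : IndecClass A M → BlockMod b → ℚ} (hg : ∀ c, HasPresVec k b u c.out.1 (g c))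
    {X : Type u} [AddCommGroup X] [Module A X] (h : InAdd A M X) :
    ∃ w ∈ Submodule.span ℚ (Set.range g), HasPresVec k b u X w := by
  have : IsNoetherianRing A := isNoetherian_of_tower k inferInstance
  have : IsArtinianRing A := isArtinian_of_tower k inferInstance
  have : Module.Finite A X := h.elim fun n h => h.elim fun i h => h.elim fun p hp =>
    .of_surjective p fun x => ⟨i x, LinearMap.congr_fun hp x⟩
  refine prop_of_indecSummand (A := A) (X := X)
    (motive := fun U => ∃ w ∈ Submodule.span ℚ (Set.range g), HasPresVec k b u U w) ?_ ?_ ?_ ?_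
  · have hP : IsBlockProj b PUnit.{u + 1} :=
      ⟨.of_split (M := A) 0 0 (Subsingleton.elim _ _), inferInstance, fun _ => rfl⟩
    exact ⟨0, zero_mem _, .of A PUnit, .of A PUnit, LinearMap.id, LinearMap.id, hP, hP,
      Function.surjective_id, Subsingleton.elim _ _, fun Y _ _ _ h => ⟨h, rfl⟩, (sub_self _).symm⟩
  · rintro U V e ⟨w, hw, h⟩
    exact ⟨w, hw, h.congr e⟩
  · rintro U V ⟨w, hw, h⟩ ⟨w', hw', h'⟩
    exact ⟨w + w', add_mem hw hw', h.prod h'⟩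
  · intro L
    obtain ⟨p, hp⟩ := L.exists_retract
    obtain ⟨Z, ⟨e⟩⟩ := L.2.2.exists_indecSummand_of_inAdd (h.of_retract _ p hp)
    obtain ⟨e'⟩ := (IndecClass.mk_eq_iff _ _).1
      (Quot.out_eq (Quot.mk (fun L L' : IndecSummand A M => Nonempty (L.1 ≃ₗ[A] L'.1)) Z))
    exact ⟨_, Submodule.subset_span ⟨_, rfl⟩, (hg _).congr (e'.trans e.symm)⟩

/-- If no nonzero test module is orthogonal to `C`, where `C` and `M` have the same indecomposable
direct summands, then `M` is completed to a support τ-tilting pair by a projective module. -/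
theorem exists_numIndec_add_eq [Module.Finite k A] (hb : b * b = b) (hc : ∀ r : A, b * r = r * b)
    (h1 : IsBlockProj b P₁) (h0 : IsBlockProj b P₀) {π₀ : P₀ →ₗ[A] C}
    (hπ₀ : Function.Surjective π₀) (hu : LinearMap.ker π₀ = LinearMap.range u)
    (hM : IsTestModule b u M) (hMC : InAdd A M C) (hCM : InAdd A C M)
    (hZ : ∀ (Y : Type u) [AddCommGroup Y] [Module A Y], IsTestModule b u Y →
      (∀ f : C →ₗ[A] Y, f = 0) → ∀ y : Y, y = 0) :
    ∃ P : ModuleCat.{u} A, Module.Projective A P ∧ Module.Finite A P ∧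
      (∀ v : (P : Type u), b • v = v) ∧ (∀ f : (P : Type u) →ₗ[A] M, f = 0) ∧
      numIndec A M + numIndec A (P : Type u) = numSimplesIn A b := by
  classical
  have := h1.projective
  have := h0.projective
  have := h1.finite
  have := h0.finite
  have hC : IsTestModule b u C := hM.of_inAdd hMC
  have := hM.finite
  have := hC.finite
  obtain ⟨P, hP, hPli, hPspan⟩ := exists_projective_family k hb hc
  have hPb (i) : IsBlockProj b (P i) := ⟨(hP i).1, (hP i).2.1, (hP i).2.2⟩
  let I := {i // ∀ f : (P i : Type u) →ₗ[A] M, f = 0}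
  let Q : Type u := ∀ i : I, P i.1
  have hQ : IsBlockProj b Q := by
    have (i : I) := (hPb i.1).projective
    have (i : I) := (hPb i.1).finite
    exact ⟨projective_pi, inferInstance, fun x => funext fun i => (hPb i.1).smul_eq (x i)⟩
  have hQM : ∀ f : Q →ₗ[A] M, f = 0 := fun f => LinearMap.pi_ext' fun i =>
    (i.2 _).trans (LinearMap.zero_comp _).symm
  have hQT : ∀ (Y : Type u) [AddCommGroup Y] [Module A Y], IsTestModule b u Y →
      ∀ f : Q →ₗ[A] Y, f = 0 := fun Y _ _ hY f => by
    obtain ⟨r, Φ, hΦ, -⟩ := hC.exists_surjective_of_generates (k := k) hπ₀ hu hZ hY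
    have := hQ.projective
    obtain ⟨f', rfl⟩ := Module.projective_lifting_property Φ f hΦ
    obtain ⟨n, i, p, hp⟩ := hMC
    have h2 : f' = 0 := LinearMap.ext fun x => funext fun j => by
      have h3 : i (f' x j) = 0 := funext fun l => LinearMap.congr_fun
        (hQM ((LinearMap.proj l).comp (i.comp ((LinearMap.proj j).comp f')))) x
      have h4 : p (i (f' x j)) = f' x j := LinearMap.congr_fun hp _
      rw [← h4, h3, map_zero]
      rfl
    rw [h2, LinearMap.comp_zero]
  refine ⟨.of A Q, hQ.projective, hQ.finite, hQ.smul_eq, hQM, ?_⟩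
  obtain ⟨g, hg, hli⟩ := exists_linearIndependent_presVec k hM
    (fun L => exists_hasPresVec hb hc π₀ hπ₀ hu hC.smul_eq (hCM.trans L.inAdd)) hQ hQT
  let V := Submodule.span ℚ (Set.range
    (Sum.elim g fun c : IndecClass A Q => dimVec k b c.out.1))
  let D := Submodule.span ℚ (Set.range fun i => dimVec k b (P i))
  have hV : V = Submodule.span ℚ (Set.range g) ⊔
      Submodule.span ℚ (Set.range fun c : IndecClass A Q => dimVec k b c.out.1) := by
    simp only [V, Set.Sum.elim_range, Submodule.span_union]
  have hDmem {X : Type u} [AddCommGroup X] [Module A X] (hX : IsBlockProj b X) :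
      dimVec k b X ∈ D :=
    Submodule.span_mono (Set.image_subset_range _ _) (hPspan X hX.projective hX.finite)
  have hVmem {X : Type u} [AddCommGroup X] [Module A X] (hX : IsBlockProj b X)
      (hXM : ∀ f : X →ₗ[A] M, f = 0) : dimVec k b X ∈ V := by
    refine Submodule.span_le.2 ?_ (hPspan X hX.projective hX.finite)
    rintro _ ⟨i, ⟨f, hf⟩, rfl⟩
    have hi : ∀ f : (P i : Type u) →ₗ[A] M, f = 0 := fun f' => LinearMap.ext fun x => by
      obtain ⟨y, rfl⟩ := hf x
      exact LinearMap.congr_fun (hXM (f'.comp f)) y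
    have := hQ.finite
    have h2 : InAdd A Q (P i) := (InAdd.refl Q).of_retract
      (LinearMap.single A (fun i : I => (P i.1 : Type u)) ⟨i, hi⟩)
      (LinearMap.proj (φ := fun i : I => (P i.1 : Type u)) ⟨i, hi⟩)
      (LinearMap.proj_comp_single_same ..)
    exact hV ▸ Submodule.mem_sup_right (dimVec_mem_span h2)
  have hpres {X : Type u} [AddCommGroup X] [Module A X] (hX : InAdd A M X)
      {w : BlockMod b → ℚ} (hw : HasPresVec k b u X w) : w ∈ V := by
    obtain ⟨w₁, h1, hw₁⟩ := exists_hasPresVec_mem_span hg hX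
    obtain ⟨w₂, -, hw₂⟩ := exists_hasPresVec_mem_span hg (InAdd.refl M)
    have hXT := hM.of_inAdd hX
    have hprod : IsTestModule b u (X × M) := by
      have := hXT.finite
      refine ⟨inferInstance, fun x => Prod.ext (hXT.smul_eq _) (hM.smul_eq _), fun f => ?_⟩
      obtain ⟨e, he⟩ := hXT.extendsAlong ((LinearMap.fst A X M).comp f)
      obtain ⟨e', he'⟩ := hM.extendsAlong ((LinearMap.snd A X M).comp f)
      exact ⟨e.prod e', LinearMap.ext fun x =>
        Prod.ext (LinearMap.congr_fun he x) (LinearMap.congr_fun he' x)⟩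
    have hzero {R : ModuleCat.{u} A} (h : ∀ f : (R : Type u) →ₗ[A] X × M, f = 0)
        (f : (R : Type u) →ₗ[A] M) : f = 0 := LinearMap.ext fun x =>
      congrArg Prod.snd (LinearMap.congr_fun (h ((LinearMap.inr A X M).comp f)) x)
    obtain ⟨R, R', hR, hR', hRM, hRM', hsub⟩ := (hw.prod hw₂).exists_sub_eq (hw₁.prod hw₂) hprod
    have h2 : w = w₁ + (dimVec k b R' - dimVec k b R) := by
      rw [← hsub]
      abel
    rw [h2]
    exact add_mem (hV ▸ Submodule.mem_sup_left h1)
      (sub_mem (hVmem hR' (hzero hRM')) (hVmem hR (hzero hRM)))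
  have hVD : V = D := by
    refine le_antisymm (Submodule.span_le.2 ?_) (Submodule.span_le.2 ?_)
    · rintro _ ⟨c | c, rfl⟩
      · obtain ⟨R₁, R₀, v, ρ, h1, h0, -, -, -, hw⟩ := hg c
        rw [Sum.elim_inl, hw]
        exact sub_mem (hDmem h0) (hDmem h1)
      · obtain ⟨p, hp⟩ := c.out.exists_retract
        exact hDmem (hQ.of_retract _ p hp)
    · rintro _ ⟨i, rfl⟩
      obtain ⟨n, E, hE, hEw⟩ := exists_bongartz (k := k) h1 h0 hπ₀ hu hC (hPb i)
      have hCE : InAdd A C E := by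
        obtain ⟨r, Φ, hΦ, hΦK⟩ := hC.exists_surjective_of_generates (k := k) hπ₀ hu hZ hE
        obtain ⟨R₁, R₀, v, ρ, -, hR₀, hρ, hker, hext, -⟩ := hEw
        have := hR₀.projective
        obtain ⟨s, hs⟩ := ((hext _ hΦK).extendsFromKernel hker).exists_lift hρ Φ hΦ LinearMap.id
        exact ⟨r, s, Φ, hs⟩
      have h2 : HasPresVec k b u C (dimVec k b P₀ - dimVec k b P₁) :=
        ⟨.of A P₁, .of A P₀, u, π₀, h1, h0, hπ₀, hu, fun Y _ _ hY => hY.extendsAlong, rfl⟩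
      have h3 := sub_mem (hpres (hMC.trans hCE) hEw) (V.smul_mem (n : ℚ) (hpres hMC h2))
      rwa [← Nat.cast_smul_eq_nsmul ℚ, add_sub_cancel_left] at h3
  let e : IndecClass A M ⊕ IndecClass A Q ≃ Fin (numSimplesIn A b) :=
    ((Module.Basis.span hli).map (LinearEquiv.ofEq V D hVD)).indexEquiv (Module.Basis.span hPli)
  have hfin : Finite (IndecClass A M ⊕ IndecClass A Q) := .of_equiv _ e.symm
  have : Finite (IndecClass A M) := .of_injective _ (Sum.inl_injective (β := IndecClass A Q))
  have : Finite (IndecClass A Q) := .of_injective _ (Sum.inr_injective (α := IndecClass A M))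
  calc
    _ = Nat.card (IndecClass A M ⊕ IndecClass A Q) := Nat.card_sum.symm
    _ = _ := (Nat.card_congr e).trans (Nat.card_fin _)

end Counting

section SymmetricAlgebras

variable {k : Type u} [Field k] {A : Type u} [Ring A] [Algebra k A]

/-- A nondegenerate symmetric linear form on `A` that represents the linear forms on
`A`-modules. -/
structure IsSymmetrizingForm (t : A →ₗ[k] k) : Prop where
  mul_comm : ∀ a a', t (a * a') = t (a' * a)
  eq_zero : ∀ a, (∀ r, t (r * a) = 0) → a = 0
  exists_hom : ∀ (X : Type u) [AddCommGroup X] [Module A X] (ψ : X →+ k),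
    (∀ (c : k) x, ψ (algebraMap k A c • x) = c * ψ x) → ∃ f : X →ₗ[A] A, ∀ x, t (f x) = ψ x

/-- The trace of an endomorphism of a free module of rank `n`, composed with a linear form. -/
def formTrace (t : A →ₗ[k] k) {n : ℕ} (W : (Fin n → A) →ₗ[A] (Fin n → A)) : k :=
  ∑ j, t (W (Pi.single j 1) j)

variable {t : A →ₗ[k] k}

theorem formTrace_comp_eq_sum {m n : ℕ} (U : (Fin n → A) →ₗ[A] (Fin m → A))
    (W : (Fin m → A) →ₗ[A] (Fin n → A)) :
    formTrace t (U.comp W) = ∑ j, ∑ l, t (W (Pi.single j 1) l * U (Pi.single l 1) j) := by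
  refine Finset.sum_congr rfl fun j _ => ?_
  rw [LinearMap.comp_apply, ← Finset.univ_sum_single (W (Pi.single j 1)), map_sum, Finset.sum_apply,
    map_sum, Finset.univ_sum_single]
  refine Finset.sum_congr rfl fun l _ => ?_
  have : (Pi.single l (W (Pi.single j 1) l) : Fin n → A) =
      W (Pi.single j 1) l • Pi.single l (1 : A) := by
    rw [← Pi.single_smul, smul_eq_mul, mul_one]
  rw [this, map_smul, Pi.smul_apply, smul_eq_mul]

theorem formTrace_comp_comm (ht : IsSymmetrizingForm t) {m n : ℕ}
    (U : (Fin n → A) →ₗ[A] (Fin m → A)) (W : (Fin m → A) →ₗ[A] (Fin n → A)) :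
    formTrace t (U.comp W) = formTrace t (W.comp U) := by
  rw [formTrace_comp_eq_sum, formTrace_comp_eq_sum, Finset.sum_comm]
  exact Finset.sum_congr rfl fun j _ => Finset.sum_congr rfl fun l _ => ht.mul_comm _ _

variable {P₁ P₀ X : Type u} [AddCommGroup P₁] [Module A P₁] [AddCommGroup P₀] [Module A P₀]
  [AddCommGroup X] [Module A X]

/-- The homomorphism `Aⁿ → X` sending the `j`-th basis vector to `x` and the others to `0`. -/
def coordHom (n : ℕ) (j : Fin n) (x : X) : (Fin n → A) →ₗ[A] X :=
  (LinearMap.toSpanSingleton A X x).comp (LinearMap.proj j)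

theorem coordHom_apply {n : ℕ} (j : Fin n) (x : X) (a : Fin n → A) :
    coordHom n j x a = a j • x := rfl

theorem eq_zero_of_formTrace_eq_zero (ht : IsSymmetrizingForm t) {n : ℕ}
    (i : P₁ →ₗ[A] (Fin n → A)) (q : (Fin n → A) →ₗ[A] P₁) (hq : q.comp i = LinearMap.id)
    (f : X →ₗ[A] P₁) (h : ∀ γ : P₁ →ₗ[A] X, formTrace t (i.comp (f.comp (γ.comp q))) = 0) :
    f = 0 := by
  have hq' : ∀ x, q (i x) = x := LinearMap.congr_fun hq
  have h0 : ∀ x j, t (i (f x) j) = 0 := fun x j => by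
    have h1 := h ((coordHom n j x).comp i)
    have h2 : i.comp (f.comp (((coordHom n j x).comp i).comp q)) =
        (i.comp (f.comp (coordHom n j x))).comp (i.comp q) := rfl
    have h3 : (i.comp q).comp (i.comp (f.comp (coordHom n j x))) =
        i.comp (f.comp (coordHom n j x)) :=
      LinearMap.ext fun a => congrArg i (hq' _)
    rw [h2, formTrace_comp_comm ht, h3, formTrace, Finset.sum_eq_single j] at h1
    · simpa [coordHom_apply] using h1
    · intro l _ hl
      simp [coordHom_apply, Pi.single_eq_of_ne' hl]
    · simp
  refine LinearMap.ext fun x => ?_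
  rw [← hq' (f x)]
  have : i (f x) = 0 := funext fun j => ht.eq_zero _ fun r => by
    have := h0 (r • x) j
    rwa [map_smul, map_smul] at this
  rw [this, map_zero, LinearMap.zero_apply]

theorem exists_formTrace_eq (ht : IsSymmetrizingForm t) {n : ℕ}
    (i : P₁ →ₗ[A] (Fin n → A)) (q : (Fin n → A) →ₗ[A] P₁) (hq : q.comp i = LinearMap.id)
    (ξ : (P₁ →ₗ[A] X) →+ k) (hξ : ∀ (c : k) h, ξ ((scalarEnd c X).comp h) = c * ξ h) :
    ∃ f : X →ₗ[A] P₁, ∀ γ : P₁ →ₗ[A] X, formTrace t (i.comp (f.comp (γ.comp q))) = ξ γ := by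
  have hq' : ∀ x, q (i x) = x := LinearMap.congr_fun hq
  let ψ (j : Fin n) : X →+ k :=
    { toFun := fun x => ξ ((coordHom n j x).comp i)
      map_zero' := by
        rw [← map_zero ξ]
        exact congrArg ξ (LinearMap.ext fun x => smul_zero _)
      map_add' := fun x y => by
        rw [← map_add ξ]
        exact congrArg ξ (LinearMap.ext fun _ => smul_add _ _ _) }
  choose F hF using fun j => ht.exists_hom X (ψ j) fun c x => by
    refine Eq.trans (congrArg ξ (LinearMap.ext fun y => ?_)) (hξ c _)
    change i y j • algebraMap k A c • x = algebraMap k A c • i y j • x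
    rw [← mul_smul, ← mul_smul, Algebra.commutes]
  let F' : X →ₗ[A] (Fin n → A) := LinearMap.pi F
  refine ⟨q.comp F', fun γ => ?_⟩
  have h1 : i.comp ((q.comp F').comp (γ.comp q)) = (i.comp q).comp (F'.comp (γ.comp q)) := rfl
  have h2 : (F'.comp (γ.comp q)).comp (i.comp q) = F'.comp (γ.comp q) :=
    LinearMap.ext fun a => congrArg (fun z => F' (γ z)) (hq' _)
  rw [h1, formTrace_comp_comm ht, h2, formTrace]
  have h3 : ∀ j, t ((F'.comp (γ.comp q)) (Pi.single j 1) j) =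
      ξ ((coordHom n j (γ (q (Pi.single j 1)))).comp i) := fun j => hF j _
  rw [Finset.sum_congr rfl fun j _ => h3 j, ← map_sum]
  refine congrArg ξ (LinearMap.ext fun x => ?_)
  have h4 : ∀ j, i x j • γ (q (Pi.single j 1)) = γ (q (Pi.single j (i x j))) := fun j => by
    rw [← map_smul, ← map_smul, ← Pi.single_smul, smul_eq_mul, mul_one]
  rw [LinearMap.sum_apply]
  simp only [LinearMap.comp_apply, coordHom_apply, h4]
  rw [← map_sum, ← map_sum, Finset.univ_sum_single, hq']

theorem extendsAlong_iff (ht : IsSymmetrizingForm t) [Module.Projective A P₁]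
    [Module.Finite A P₁] [Module.Projective A P₀] [Module.Finite A P₀] (u : P₁ →ₗ[A] P₀) :
    ExtendsAlong u X ↔ ∀ f : X →ₗ[A] P₁, u.comp f = 0 → f = 0 := by
  obtain ⟨n, q, hqs⟩ := Module.Finite.exists_fin' A P₁
  obtain ⟨i, hq⟩ := Module.projective_lifting_property q LinearMap.id hqs
  obtain ⟨m, q₀, hqs₀⟩ := Module.Finite.exists_fin' A P₀
  obtain ⟨i₀, hq₀⟩ := Module.projective_lifting_property q₀ LinearMap.id hqs₀
  have hq' : ∀ x, q (i x) = x := LinearMap.congr_fun hq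
  have hq₀' : ∀ x, q₀ (i₀ x) = x := LinearMap.congr_fun hq₀
  have hcomm (f : X →ₗ[A] P₁) (e : P₀ →ₗ[A] X) :
      formTrace t (i.comp (f.comp ((e.comp u).comp q))) =
        formTrace t (i₀.comp ((u.comp f).comp (e.comp q₀))) := by
    have h1 : i.comp (f.comp ((e.comp u).comp q)) =
        (i.comp (f.comp (e.comp q₀))).comp (i₀.comp (u.comp q)) :=
      LinearMap.ext fun a => congrArg (fun z => i (f (e z))) (hq₀' _).symm
    have h2 : i₀.comp ((u.comp f).comp (e.comp q₀)) =
        (i₀.comp (u.comp q)).comp (i.comp (f.comp (e.comp q₀))) :=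
      LinearMap.ext fun a => congrArg (fun z => i₀ (u z)) (hq' _).symm
    rw [h1, h2, formTrace_comp_comm ht]
  have hzero (e : P₀ →ₗ[A] X) : formTrace t (i₀.comp ((0 : X →ₗ[A] P₀).comp (e.comp q₀))) = 0 := by
    simp [formTrace]
  constructor
  · intro h f hf
    refine eq_zero_of_formTrace_eq_zero ht i q hq f fun γ => ?_
    obtain ⟨e, rfl⟩ := h γ
    rw [hcomm, hf, hzero]
  · intro h
    let _ := scalarModule k A X
    have := scalarModule_isScalarTower k A X
    let φ : (P₀ →ₗ[A] X) →ₗ[k] (P₁ →ₗ[A] X) :=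
      { toFun := fun e => e.comp u
        map_add' := fun _ _ => rfl
        map_smul' := fun _ _ => rfl }
    suffices LinearMap.range φ = ⊤ from fun γ => LinearMap.range_eq_top.1 this γ
    by_contra hne
    obtain ⟨ξ, hξ, hle⟩ := Submodule.exists_le_ker_of_lt_top _ (lt_top_iff_ne_top.2 hne)
    obtain ⟨f, hf⟩ := exists_formTrace_eq ht i q hq ξ.toAddMonoidHom fun c h => ξ.map_smul c h
    have h0 : u.comp f = 0 := eq_zero_of_formTrace_eq_zero ht i₀ q₀ hq₀ _ fun e => by
      rw [← hcomm, hf]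
      exact hle ⟨e, rfl⟩
    refine hξ (LinearMap.ext fun γ => ?_)
    have := hf γ
    rw [h f h0] at this
    refine this.symm.trans ?_
    simp [formTrace]

theorem isSymmetrizingForm_coeff_one (k Γ : Type u) [Field k] [Group Γ] [Finite Γ] :
    ∃ t : MonoidAlgebra k Γ →ₗ[k] k, IsSymmetrizingForm t := by
  classical
  have := Fintype.ofFinite Γ
  let t : MonoidAlgebra k Γ →ₗ[k] k :=
    { toFun := fun a => a.coeff 1
      map_add' := fun _ _ => rfl
      map_smul' := fun _ _ => rfl }
  have ht : ∀ a, t a = a.coeff 1 := fun _ => rfl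
  refine ⟨t, fun a a' => ?_, fun a h => ?_, fun X _ _ ψ hψ => ?_⟩
  · induction a using MonoidAlgebra.induction_linear with
    | zero => simp
    | add x y hx hy => rw [add_mul, mul_add, map_add, map_add, hx, hy]
    | single g c =>
      rw [ht, ht, MonoidAlgebra.coeff_mul_single_apply, MonoidAlgebra.coeff_single_mul_apply,
        mul_one, one_mul, mul_comm]
  · refine MonoidAlgebra.ext (Finsupp.ext fun g => ?_)
    have := h (.single g⁻¹ 1)
    rw [ht, MonoidAlgebra.coeff_single_mul_apply] at this
    simpa using this
  · let f : X → MonoidAlgebra k Γ := fun x =>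
      ∑ g, .single g (ψ ((MonoidAlgebra.single g⁻¹ 1 : MonoidAlgebra k Γ) • x))
    have hcoeff : ∀ x g,
        (f x).coeff g = ψ ((MonoidAlgebra.single g⁻¹ 1 : MonoidAlgebra k Γ) • x) := fun x g => by
      simp [f, MonoidAlgebra.coeff_sum, Finsupp.finsetSum_apply, Finsupp.single_apply]
    have hadd : ∀ x y, f (x + y) = f x + f y := fun x y => by
      refine MonoidAlgebra.ext (Finsupp.ext fun g => ?_)
      rw [MonoidAlgebra.coeff_add, Finsupp.add_apply, hcoeff, hcoeff, hcoeff, smul_add, map_add]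
    refine ⟨{ toFun := f, map_add' := hadd, map_smul' := fun a x => ?_ }, fun x => ?_⟩
    · rw [RingHom.id_apply]
      induction a using MonoidAlgebra.induction_linear with
      | zero =>
        refine MonoidAlgebra.ext (Finsupp.ext fun g => ?_)
        simp [hcoeff]
      | add a a' ha ha' => rw [add_smul, hadd, ha, ha', add_smul]
      | single h c =>
        refine MonoidAlgebra.ext (Finsupp.ext fun g => ?_)
        rw [smul_eq_mul, MonoidAlgebra.coeff_single_mul_apply, hcoeff, hcoeff, ← hψ, ← mul_smul,
          ← mul_smul, MonoidAlgebra.single_mul_single, MonoidAlgebra.coe_algebraMap]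
        simp [MonoidAlgebra.single_mul_single]
    · change (f x).coeff 1 = _
      rw [hcoeff, inv_one, ← MonoidAlgebra.one_def, one_smul]

end SymmetricAlgebras

section SupportTauTilting

variable {k : Type u} [Field k] {A : Type u} [Ring A] [Algebra k A] [Module.Finite k A]
  {t : A →ₗ[k] k} {N : Type u} [AddCommGroup N] [Module A N]

theorem extendsAlong_of_isTauRigid (ht : IsSymmetrizingForm t) [Module.Finite A N]
    (hN : IsTauRigid A N) {P₀ P₁ : Type u} [AddCommGroup P₀] [Module A P₀] [AddCommGroup P₁]
    [Module A P₁] {π₀ : P₀ →ₗ[A] N} (h₀ : IsProjCover A π₀) {π₁ : P₁ →ₗ[A] LinearMap.ker π₀}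
    (h₁ : IsProjCover A π₁) : ExtendsAlong ((LinearMap.ker π₀).subtype.comp π₁) N := by
  have : IsNoetherianRing A := isNoetherian_of_tower k inferInstance
  have := h₀.1
  have := h₁.1
  have := h₀.finite
  have := h₁.finite
  refine (extendsAlong_iff ht _).2 fun f hf => ?_
  have h := hN P₀ π₀ h₀ P₁ π₁ h₁ (f.codRestrict _ fun x => Subtype.ext (LinearMap.congr_fun hf x))
  exact LinearMap.ext fun x => congrArg Subtype.val (LinearMap.congr_fun h x)

theorem isTauRigid_of_extendsAlong (ht : IsSymmetrizingForm t) [Module.Finite A N]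
    (h : ∀ (P₀ : Type u) [AddCommGroup P₀] [Module A P₀] (π₀ : P₀ →ₗ[A] N), IsProjCover A π₀ →
      ∀ W : Submodule A N, ExtendsFromKernel π₀ (N ⧸ W)) : IsTauRigid A N := by
  intro P₀ _ _ π₀ h₀ P₁ _ _ π₁ h₁ g
  have : IsNoetherianRing A := isNoetherian_of_tower k inferInstance
  have := h₀.1
  have := h₁.1
  have := h₀.finite
  have := h₁.finite
  have hg := (extendsAlong_iff ht _).1 (ExtendsAlong.of_projCover h₁ (h P₀ π₀ h₀))
    ((LinearMap.ker π₁).subtype.comp g) (LinearMap.ext fun x => by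
      change ((π₁ (g x) : LinearMap.ker π₀) : P₀) = 0
      rw [LinearMap.mem_ker.1 (g x).2]
      rfl)
  exact LinearMap.ext fun x => Subtype.ext (LinearMap.congr_fun hg x)

/-- A projective presentation of a support τ-tilting module `N`, for which `N` is a test module and
no nonzero test module is orthogonal to `N`. -/
theorem IsSupportTauTilting.exists_presentation (ht : IsSymmetrizingForm t) [Module.Finite A N]
    (hN : IsSupportTauTilting A N) :
    ∃ (P₁ P₀ : ModuleCat.{u} A) (u : (P₁ : Type u) →ₗ[A] P₀) (π₀ : (P₀ : Type u) →ₗ[A] N),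
      IsBlockProj (1 : A) P₁ ∧ IsBlockProj (1 : A) P₀ ∧ Function.Surjective π₀ ∧
      LinearMap.ker π₀ = LinearMap.range u ∧ IsTestModule (1 : A) u N ∧
      ∀ (Y : Type u) [AddCommGroup Y] [Module A Y], IsTestModule (1 : A) u Y →
        (∀ f : N →ₗ[A] Y, f = 0) → ∀ y : Y, y = 0 := by
  classical
  have : IsNoetherianRing A := isNoetherian_of_tower k inferInstance
  have : IsArtinianRing A := isArtinian_of_tower k inferInstance
  obtain ⟨hτ, Q, hQ, hQf, hQN, hcard⟩ := hN
  obtain ⟨P₀, π₀, h₀, hP₀⟩ := exists_projCover (A := A) N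
  obtain ⟨P₁, π₁, h₁, hP₁⟩ := exists_projCover (A := A) (LinearMap.ker π₀)
  have := h₀.1
  have := h₁.1
  let u : (P₁ × Q) →ₗ[A] P₀ := ((LinearMap.ker π₀).subtype.comp π₁).comp (LinearMap.fst A P₁ Q)
  have hu : LinearMap.ker π₀ = LinearMap.range u := by
    rw [LinearMap.range_comp_of_range_eq_top _ Submodule.range_fst, LinearMap.range_comp,
      LinearMap.range_eq_top.2 h₁.2.1, Submodule.map_subtype_top]
  have hNT : IsTestModule (1 : A) u N := by
    refine ⟨inferInstance, one_smul _, fun f => ?_⟩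
    obtain ⟨e, he⟩ := extendsAlong_of_isTauRigid ht hτ h₀ h₁ (f.comp (LinearMap.inl A P₁ Q))
    refine ⟨e, LinearMap.ext fun x => ?_⟩
    have h1 : e (u x) = f (x.1, 0) := LinearMap.congr_fun he x.1
    have h2 : f (0, x.2) = 0 := LinearMap.congr_fun (hQN (f.comp (LinearMap.inr A P₁ Q))) x.2
    rw [LinearMap.comp_apply, h1, ← add_zero (f (x.1, 0)), ← h2, ← map_add]
    simp
  have hQT : ∀ (Y : Type u) [AddCommGroup Y] [Module A Y], IsTestModule (1 : A) u Y →
      ∀ f : Q →ₗ[A] Y, f = 0 := fun Y _ _ hY f => by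
    obtain ⟨e, he⟩ := hY.extendsAlong (f.comp (LinearMap.snd A P₁ Q))
    refine LinearMap.ext fun q => ?_
    have h1 : e (u (0, q)) = f q := LinearMap.congr_fun he (0, q)
    have h2 : u (0, q) = 0 := map_zero ((LinearMap.ker π₀).subtype.comp π₁)
    rw [← h1, h2, map_zero, LinearMap.zero_apply]
  have hQb : IsBlockProj (1 : A) Q := ⟨hQ, hQf, one_smul _⟩
  refine ⟨.of A (P₁ × Q), P₀, u, π₀, IsBlockProj.prod ⟨h₁.1, hP₁, one_smul _⟩ hQb,
    ⟨h₀.1, hP₀, one_smul _⟩,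
    h₀.2.1, hu, hNT, fun Y _ _ hY hNY => ?_⟩
  obtain ⟨g, hg, hli⟩ := exists_linearIndependent_presVec k hNT
    (fun L => exists_hasPresVec (one_mul 1) (fun r => by rw [one_mul, mul_one]) π₀ h₀.2.1 hu
      (one_smul _) L.inAdd) hQb hQT
  obtain ⟨P, hP, hPli, hPspan⟩ := exists_projective_family k (one_mul (1 : A))
    fun r => by rw [one_mul, mul_one]
  let D := Submodule.span ℚ (Set.range fun i => dimVec k (1 : A) (P i))
  have hDmem {X : Type u} [AddCommGroup X] [Module A X] (hX : IsBlockProj (1 : A) X) :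
      dimVec k 1 X ∈ D :=
    Submodule.span_mono (Set.image_subset_range _ _) (hPspan X hX.projective hX.finite)
  have hmem : ∀ c, (Sum.elim g fun c : IndecClass A Q => dimVec k 1 c.out.1) c ∈ D := by
    rintro (c | c)
    · obtain ⟨R₁, R₀, v, ρ, h1, h0, -, -, -, hw⟩ := hg c
      rw [Sum.elim_inl, hw]
      exact sub_mem (hDmem h0) (hDmem h1)
    · obtain ⟨p, hp⟩ := c.out.exists_retract
      exact hDmem (hQb.of_retract _ p hp)
  have hspan : D ≤ Submodule.span ℚ (Set.range
      (Sum.elim g fun c : IndecClass A Q => dimVec k 1 c.out.1)) := by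
    let bas := Module.Basis.span hPli
    have : Module.Finite ℚ D := .of_basis bas
    have hli' : LinearIndependent ℚ fun c => (⟨_, hmem c⟩ : D) := .of_comp D.subtype hli
    have hfin : Finite (IndecClass A N ⊕ IndecClass A Q) := hli'.finite
    have : Finite (IndecClass A N) := .of_injective _ (Sum.inl_injective (β := IndecClass A Q))
    have : Finite (IndecClass A Q) := .of_injective _ (Sum.inr_injective (α := IndecClass A N))
    have := Fintype.ofFinite (IndecClass A N ⊕ IndecClass A Q)
    have hrank : Fintype.card (IndecClass A N ⊕ IndecClass A Q) = Module.finrank ℚ D := by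
      rw [Module.finrank_eq_nat_card_basis bas, Nat.card_fin, numSimplesIn_one, ← hcard,
        ← Nat.card_eq_fintype_card, Nat.card_sum]
      rfl
    have htop := hli'.span_eq_top_of_card_eq_finrank' hrank
    have h2 := congrArg (Submodule.map D.subtype) htop
    rw [Submodule.map_subtype_top, Submodule.map_span, ← Set.range_comp] at h2
    exact h2.ge
  have := hY.finite
  have hzero {X : Type u} [AddCommGroup X] [Module A X] {R : Type u} [AddCommGroup R] [Module A R]
      [Module.Finite A X] (i : R →ₗ[A] X) (p : X →ₗ[A] R) (hp : p.comp i = LinearMap.id)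
      (h : ∀ f : X →ₗ[A] Y, f = 0) : homDim k A R Y = 0 := by
    have : Module.Finite A R := .of_surjective p fun x => ⟨i x, LinearMap.congr_fun hp x⟩
    refine (homDim_eq_zero_iff k A R Y).2 fun f => LinearMap.ext fun x => ?_
    have h1 : f (p (i x)) = 0 := LinearMap.congr_fun (h (f.comp p)) (i x)
    have h2 : p (i x) = x := LinearMap.congr_fun hp x
    rwa [h2] at h1
  let Y' : BlockMod (1 : A) := ⟨.of A Y, hY.finite, hY.smul_eq⟩
  have hA : dimVec k (1 : A) A Y' = 0 := by
    suffices h : Submodule.span ℚ (Set.range (Sum.elim g fun c : IndecClass A Q =>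
        dimVec k 1 c.out.1)) ≤ LinearMap.ker (LinearMap.proj Y' : (BlockMod (1 : A) → ℚ) →ₗ[ℚ] ℚ)
      from h (hspan (hDmem (X := A) ⟨inferInstance, inferInstance, one_smul _⟩))
    refine Submodule.span_le.2 ?_
    rintro _ ⟨c | c, rfl⟩
    · obtain ⟨p, hp⟩ := c.out.exists_retract
      refine ((hg c).apply_eq Y' hY.extendsAlong).trans (Nat.cast_eq_zero.2 ?_)
      exact hzero _ p hp hNY
    · obtain ⟨p, hp⟩ := c.out.exists_retract
      exact Nat.cast_eq_zero.2 (hzero _ p hp (hQT Y hY))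
  intro y
  have h1 := (homDim_eq_zero_iff k A A Y).1 (Nat.cast_eq_zero.1 hA)
    (LinearMap.toSpanSingleton A Y y)
  simpa using LinearMap.congr_fun h1 1

end SupportTauTilting

section ChangeOfRings

variable {R S : Type u} [Ring R] [Ring S]

/-- Restriction of scalars along `ι`. -/
def Res (_ : R →+* S) (X : Type u) : Type u := X

instance (ι : R →+* S) (X : Type u) [AddCommGroup X] : AddCommGroup (Res ι X) :=
  inferInstanceAs (AddCommGroup X)

instance (ι : R →+* S) (X : Type u) [AddCommGroup X] [Module S X] : Module R (Res ι X) :=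
  Module.compHom X ι

/-- Restriction of scalars of a linear map. -/
def resMap (ι : R →+* S) {X Y : Type u} [AddCommGroup X] [Module S X] [AddCommGroup Y] [Module S Y]
    (f : X →ₗ[S] Y) : Res ι X →ₗ[R] Res ι Y where
  toFun := fun x => f x
  map_add' := f.map_add
  map_smul' r x := f.map_smul (ι r) x

/-- Coinduction along `ι`. -/
def Coind (ι : R →+* S) (Y : Type u) [AddCommGroup Y] [Module R Y] : Type u := Res ι S →ₗ[R] Y

variable {ι : R →+* S} {X Y : Type u} [AddCommGroup X] [Module S X] [AddCommGroup Y] [Module R Y]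

instance : AddCommGroup (Coind ι Y) := inferInstanceAs (AddCommGroup (Res ι S →ₗ[R] Y))

/-- Evaluation of an element of a coinduced module. -/
def Coind.eval (f : Coind ι Y) (s : S) : Y := (f : Res ι S →ₗ[R] Y).toFun s

theorem Coind.ext {f g : Coind ι Y} (h : ∀ s, f.eval s = g.eval s) : f = g := LinearMap.ext h

theorem Coind.eval_add (f : Coind ι Y) (s s' : S) : f.eval (s + s') = f.eval s + f.eval s' :=
  LinearMap.map_add (f : Res ι S →ₗ[R] Y) s s'

theorem Coind.eval_incl_mul (f : Coind ι Y) (r : R) (s : S) :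
    f.eval (ι r * s) = r • f.eval s :=
  LinearMap.map_smul (f : Res ι S →ₗ[R] Y) r s

theorem Coind.eval_sum (f : Coind ι Y) {Q : Type*} [Fintype Q] (s : Q → S) :
    f.eval (∑ q, s q) = ∑ q, f.eval (s q) :=
  map_sum (AddMonoidHom.mk' f.eval f.eval_add) s _

/-- Evaluation at `s` as an additive map. -/
def Coind.evalHom (s : S) : Coind ι Y →+ Y where
  toFun := fun f => f.eval s
  map_zero' := rfl
  map_add' := fun _ _ => rfl

/-- An `R`-linear function on `S` as an element of a coinduced module. -/
def Coind.mk (f : S → Y) (h : ∀ s s', f (s + s') = f s + f s')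
    (h' : ∀ (r : R) s, f (ι r * s) = r • f s) : Coind ι Y :=
  ({ toFun := f, map_add' := h, map_smul' := h' } : Res ι S →ₗ[R] Y)

instance : SMul S (Coind ι Y) where
  smul s f := .mk (fun x => f.eval (x * s))
    (fun x x' => (congrArg f.eval (add_mul x x' s)).trans (f.eval_add _ _))
    (fun r x => (congrArg f.eval (mul_assoc (ι r) x s)).trans (f.eval_incl_mul r _))

theorem Coind.eval_smul (s : S) (f : Coind ι Y) (x : S) : (s • f).eval x = f.eval (x * s) := rfl

instance : Module S (Coind ι Y) where
  one_smul f := Coind.ext fun x => by rw [Coind.eval_smul, mul_one]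
  mul_smul s s' f := Coind.ext fun x => by
    rw [Coind.eval_smul, Coind.eval_smul, Coind.eval_smul, mul_assoc]
  smul_zero _ := rfl
  smul_add _ _ _ := rfl
  add_smul s s' f := Coind.ext fun x => by
    rw [Coind.eval_smul, mul_add, Coind.eval_add]
    rfl
  zero_smul f := Coind.ext fun x => by
    rw [Coind.eval_smul, mul_zero]
    exact LinearMap.map_zero (f : Res ι S →ₗ[R] Y)

/-- The map to a coinduced module which is adjoint to `f`. -/
def coindLift (f : Res ι X →ₗ[R] Y) : X →ₗ[S] Coind ι Y where
  toFun := fun x => .mk (fun s => f.toFun (s • x : X))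
    (fun s s' => (congrArg f.toFun (add_smul s s' x)).trans (f.map_add _ _))
    (fun r s => (congrArg f.toFun (mul_smul (ι r) s x)).trans (f.map_smul r _))
  map_add' x x' := Coind.ext fun s =>
    (congrArg f.toFun (smul_add s x x')).trans (f.map_add _ _)
  map_smul' s x := Coind.ext fun s' => congrArg f.toFun (mul_smul s' s x).symm

/-- The map from a restricted module which is adjoint to `g`. -/
def resLift (g : X →ₗ[S] Coind ι Y) : Res ι X →ₗ[R] Y where
  toFun := fun x => (g x).eval 1
  map_add' x x' := congrArg (fun f => Coind.eval f 1) (g.map_add x x')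
  map_smul' r x := by
    refine (congrArg (fun f => Coind.eval f 1) (g.map_smul (ι r) x)).trans ?_
    exact (congrArg (Coind.eval (g x)) ((one_mul _).trans (mul_one _).symm)).trans
      (Coind.eval_incl_mul (g x) r 1)

theorem eval_eq_resLift (g : X →ₗ[S] Coind ι Y) (x : X) (s : S) :
    (g x).eval s = (resLift g).toFun (s • x : X) := by
  refine (congrArg (g x).eval (one_mul s).symm).trans ?_
  exact congrArg (fun f => Coind.eval f 1) (g.map_smul s x).symm

theorem extendsAlong_resMap_iff {P₁ P₀ : Type u} [AddCommGroup P₁] [Module S P₁]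
    [AddCommGroup P₀] [Module S P₀] (u : P₁ →ₗ[S] P₀) :
    ExtendsAlong (resMap ι u) Y ↔ ExtendsAlong u (Coind ι Y) := by
  constructor
  · intro h g
    obtain ⟨e, he⟩ := h (resLift g)
    refine ⟨coindLift e, LinearMap.ext fun x => Coind.ext fun s => ?_⟩
    rw [eval_eq_resLift g, ← he]
    exact congrArg (fun x => e.toFun x) (u.map_smul s x).symm
  · intro h f
    obtain ⟨e, he⟩ := h (coindLift f)
    refine ⟨resLift e, LinearMap.ext fun x => ?_⟩
    refine (congrArg (fun g => Coind.eval g 1) (LinearMap.congr_fun he x)).trans ?_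
    exact congrArg f.toFun (one_smul S (show P₁ from x))

end ChangeOfRings

section BlockComponent

variable {A : Type u} [Ring A] {b : A} {X X' : Type u} [AddCommGroup X] [Module A X]
  [AddCommGroup X'] [Module A X']

/-- The projection onto a block component. -/
def blockProj (hb : b * b = b) (hc : ∀ r : A, b * r = r * b) (X : Type u) [AddCommGroup X]
    [Module A X] : X →ₗ[A] blockComponent A b hc X where
  toFun := fun x => ⟨b • x, (mul_smul b b x).symm.trans (congrArg (· • x) hb)⟩
  map_add' x y := Subtype.ext (smul_add b x y)
  map_smul' r x := Subtype.ext <| by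
    change b • r • x = r • b • x
    rw [← mul_smul, ← mul_smul, hc]

theorem blockProj_comp_subtype (hb : b * b = b) (hc : ∀ r : A, b * r = r * b) :
    (blockProj hb hc X).comp (blockComponent A b hc X).subtype = LinearMap.id :=
  LinearMap.ext fun x => Subtype.ext x.2

/-- The restriction of a linear map to block components. -/
def blockMap (hc : ∀ r : A, b * r = r * b) (u : X →ₗ[A] X') :
    blockComponent A b hc X →ₗ[A] blockComponent A b hc X' :=
  u.restrict fun x hx => (u.map_smul b x).symm.trans (congrArg u hx)

theorem blockMap_surjective (hb : b * b = b) (hc : ∀ r : A, b * r = r * b) {u : X →ₗ[A] X'}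
    (hu : Function.Surjective u) : Function.Surjective (blockMap hc u) := by
  intro y
  obtain ⟨x, hx⟩ := hu y
  refine ⟨blockProj hb hc X x, Subtype.ext ?_⟩
  change u (b • x) = y
  rw [u.map_smul, hx]
  exact y.2

theorem ker_blockMap_eq_range (hb : b * b = b) (hc : ∀ r : A, b * r = r * b) {X'' : Type u}
    [AddCommGroup X''] [Module A X''] {u : X →ₗ[A] X'} {π : X' →ₗ[A] X''}
    (h : LinearMap.ker π = LinearMap.range u) :
    LinearMap.ker (blockMap hc π) = LinearMap.range (blockMap hc u) := by
  ext y
  constructor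
  · intro hy
    have hy' : (y : X') ∈ LinearMap.ker π := congrArg Subtype.val hy
    rw [h] at hy'
    obtain ⟨x, hx⟩ := hy'
    refine ⟨blockProj hb hc X x, Subtype.ext ?_⟩
    change u (b • x) = y
    rw [u.map_smul, hx]
    exact y.2
  · rintro ⟨x, rfl⟩
    have : u x ∈ LinearMap.ker π := h ▸ ⟨x, rfl⟩
    exact Subtype.ext this

theorem extendsAlong_blockMap_iff (hb : b * b = b) (hc : ∀ r : A, b * r = r * b) (u : X →ₗ[A] X')
    {Y : Type u} [AddCommGroup Y] [Module A Y] (hY : ∀ y : Y, b • y = y) :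
    ExtendsAlong (blockMap hc u) Y ↔ ExtendsAlong u Y := by
  constructor
  · intro h f
    obtain ⟨e, he⟩ := h (f.comp (blockComponent A b hc X).subtype)
    refine ⟨e.comp (blockProj hb hc X'), LinearMap.ext fun x => ?_⟩
    have h1 : e (blockMap hc u (blockProj hb hc X x)) = f (b • x) := LinearMap.congr_fun he _
    rw [f.map_smul, hY] at h1
    rw [← h1]
    exact congrArg e (Subtype.ext (u.map_smul b x).symm)
  · intro h f
    obtain ⟨e, he⟩ := h (f.comp (blockProj hb hc X))
    refine ⟨e.comp (blockComponent A b hc X').subtype, LinearMap.ext fun x => ?_⟩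
    have h1 : e (u x) = f (blockProj hb hc X x) := LinearMap.congr_fun he _
    exact h1.trans (congrArg f (Subtype.ext x.2))

theorem isBlockProj_blockComponent (hb : b * b = b) (hc : ∀ r : A, b * r = r * b)
    (h : Module.Projective A X) (hf : Module.Finite A X) :
    IsBlockProj b (blockComponent A b hc X) where
  projective := .of_split _ _ (blockProj_comp_subtype hb hc)
  finite := .of_surjective (blockProj hb hc X) fun x =>
    ⟨x, LinearMap.congr_fun (blockProj_comp_subtype hb hc) x⟩
  smul_eq x := Subtype.ext x.2

end BlockComponent

section FrobeniusSystem

variable {R S : Type u} [Ring R] [Ring S]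

/-- `pr` makes `ι : R →+* S` a Frobenius extension with dual bases `y`, `z`, where `pr` is a
retraction of `ι` and commuting scalars of `R` past the bases twists them by the ring
endomorphisms `σ q`. -/
structure IsFrobeniusSystem (ι : R →+* S) (pr : S →+ R) {Q : Type*} [Fintype Q] (y z : Q → S)
    (σ : Q → R →+* R) : Prop where
  map_one : pr 1 = 1
  map_incl_mul : ∀ r s, pr (ι r * s) = r * pr s
  map_mul_incl : ∀ s r, pr (s * ι r) = pr s * r
  sum_mul : ∀ s, ∑ q, ι (pr (s * y q)) * z q = s
  sum_mul' : ∀ s, ∑ q, y q * ι (pr (z q * s)) = s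
  incl_mul : ∀ q r, ι r * y q = y q * ι (σ q r)
  mul_incl : ∀ q r, z q * ι r = ι (σ q r) * z q

namespace IsFrobeniusSystem

variable {ι : R →+* S} {pr : S →+ R} {Q : Type*} [Fintype Q] {y z : Q → S} {σ : Q → R →+* R}

/-- A left inverse of a surjection from a free `R`-module onto the restriction of `S^n`. -/
theorem exists_retract_pi (h : IsFrobeniusSystem ι pr y z σ) (n : ℕ) :
    ∃ (i : Res ι (Fin n → S) →ₗ[R] Fin n → Q → R) (p : (Fin n → Q → R) →ₗ[R] Res ι (Fin n → S)),
      p.comp i = LinearMap.id := by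
  refine ⟨{ toFun := fun x a q => pr (id (α := Fin n → S) x a * y q)
            map_add' := fun x x' => funext fun a => funext fun q => ?_
            map_smul' := fun r x => funext fun a => funext fun q => ?_ },
    { toFun := fun f => (fun a => ∑ q, ι (f a q) * z q : Fin n → S)
      map_add' := fun f f' => ?_
      map_smul' := fun r f => ?_ }, ?_⟩
  · exact (congrArg pr (add_mul (id (α := Fin n → S) x a) (id (α := Fin n → S) x' a) (y q))).trans
      (map_add pr _ _)
  · exact (congrArg pr (mul_assoc (ι r) (id (α := Fin n → S) x a) (y q))).trans
      (h.map_incl_mul _ _)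
  · refine funext (α := Fin n) (β := fun _ => S) fun a => ?_
    change ∑ q, ι (f a q + f' a q) * z q = ∑ q, ι (f a q) * z q + ∑ q, ι (f' a q) * z q
    simp [add_mul, Finset.sum_add_distrib]
  · refine funext (α := Fin n) (β := fun _ => S) fun a => ?_
    change ∑ q, ι (r * f a q) * z q = ι r * ∑ q, ι (f a q) * z q
    simp [Finset.mul_sum, mul_assoc]
  · exact LinearMap.ext fun x => funext (α := Fin n) (β := fun _ => S) fun a => h.sum_mul _

theorem finite_res (h : IsFrobeniusSystem ι pr y z σ) (X : Type u) [AddCommGroup X] [Module S X]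
    [Module.Finite S X] : Module.Finite R (Res ι X) := by
  obtain ⟨n, f, hf⟩ := Module.Finite.exists_fin' S X
  obtain ⟨i, p, hp⟩ := h.exists_retract_pi n
  have : Function.Surjective p := fun x => ⟨i x, LinearMap.congr_fun hp x⟩
  exact .of_surjective ((resMap ι f).comp p) (Function.Surjective.comp (g := resMap ι f) hf this)

theorem projective_res (h : IsFrobeniusSystem ι pr y z σ) (X : Type u) [AddCommGroup X]
    [Module S X] [Module.Finite S X] [Module.Projective S X] : Module.Projective R (Res ι X) := by
  obtain ⟨n, f, hf⟩ := Module.Finite.exists_fin' S X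
  obtain ⟨g, hg⟩ := Module.projective_lifting_property f LinearMap.id hf
  obtain ⟨i, p, hp⟩ := h.exists_retract_pi n
  have : Module.Projective R (Fin n → Q → R) := projective_pi
  refine .of_split (i.comp (resMap ι g)) ((resMap ι f).comp p) (LinearMap.ext fun x => ?_)
  refine (congrArg (fun v => resMap ι f v) (LinearMap.congr_fun hp (resMap ι g x))).trans ?_
  exact LinearMap.congr_fun hg x

theorem finite_of_span_eq_top {M N : Type u} [AddCommGroup M] [Module R M] [Module.Finite R M]
    [AddCommGroup N] [Module S N] (j : M →ₛₗ[ι] N)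
    (hj : Submodule.span S (Set.range j) = ⊤) : Module.Finite S N := by
  classical
  obtain ⟨t, ht⟩ := (inferInstance : Module.Finite R M).fg_top
  refine ⟨⟨t.image j, eq_top_iff.2 (hj ▸ Submodule.span_le.2 ?_)⟩⟩
  rintro _ ⟨m, rfl⟩
  have : Submodule.span R t ≤ (Submodule.span S (t.image j : Set N)).comap j :=
    Submodule.span_le.2 fun x hx => Submodule.subset_span (by simpa using ⟨x, hx, rfl⟩)
  exact this (ht ▸ Submodule.mem_top)

variable {Y : Type u} [AddCommGroup Y] [Module R Y]

/-- The canonical map from a module to the module coinduced from it. -/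
def toCoind (h : IsFrobeniusSystem ι pr y z σ) (Y : Type u) [AddCommGroup Y] [Module R Y] :
    Y →ₛₗ[ι] Coind ι Y where
  toFun := fun v => .mk (fun s => pr s • v) (fun s s' => by rw [map_add, add_smul])
    fun r s => by rw [h.map_incl_mul, mul_smul]
  map_add' v w := Coind.ext fun s => smul_add (pr s) v w
  map_smul' r v := Coind.ext fun s => by
    change pr s • r • v = pr (s * ι r) • v
    rw [h.map_mul_incl, mul_smul]

theorem eval_toCoind (h : IsFrobeniusSystem ι pr y z σ) (v : Y) (s : S) :
    (h.toCoind Y v).eval s = pr s • v := rfl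

theorem sum_smul_toCoind (h : IsFrobeniusSystem ι pr y z σ) (f : Coind ι Y) :
    ∑ q, y q • h.toCoind Y (f.eval (z q)) = f := by
  refine Coind.ext fun s => ?_
  change Coind.evalHom s _ = _
  rw [map_sum]
  change ∑ q, pr (s * y q) • f.eval (z q) = f.eval s
  simp_rw [← Coind.eval_incl_mul]
  rw [← Coind.eval_sum, h.sum_mul]

theorem span_range_toCoind (h : IsFrobeniusSystem ι pr y z σ) :
    Submodule.span S (Set.range (h.toCoind Y)) = ⊤ :=
  eq_top_iff.2 fun f _ => h.sum_smul_toCoind f ▸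
    Submodule.sum_mem _ fun _ _ => Submodule.smul_mem _ _ (Submodule.subset_span ⟨_, rfl⟩)

end IsFrobeniusSystem

section Induced

variable {ι : R →+* S} {pr : S →+ R} {Q : Type*} [Fintype Q] {y z : Q → S} {σ : Q → R →+* R}
  {M N : Type u} [AddCommGroup M] [Module R M] [AddCommGroup N] [Module S N]

/-- The universal map of an induced module as a semilinear map. -/
def IsInducedMod.toSemilinear {j : M →+ N} (hN : IsInducedMod ι M N j) : M →ₛₗ[ι] N where
  toFun := j
  map_add' := j.map_add
  map_smul' := hN.1

theorem IsInducedMod.span_range {j : M →+ N} (hN : IsInducedMod ι M N j) :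
    Submodule.span S (Set.range j) = ⊤ := by
  let W := Submodule.span S (Set.range j)
  have hW (m) : W.mkQ (j m) = 0 :=
    (Submodule.Quotient.mk_eq_zero W).2 (Submodule.subset_span ⟨m, rfl⟩)
  have := (hN.2 (N ⧸ W) 0 fun r m => by simp).unique (y₁ := W.mkQ) (y₂ := 0) hW fun m => rfl
  exact (Submodule.ker_mkQ W).symm.trans (this ▸ LinearMap.ker_zero)

theorem IsInducedMod.exists_toCoind (h : IsFrobeniusSystem ι pr y z σ) {j : M →+ N}
    (hN : IsInducedMod ι M N j) :
    ∃ φ : N →ₗ[S] Coind ι M, (∀ m, φ (j m) = h.toCoind M m) ∧ Function.Surjective φ ∧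
      ∀ n, ∑ q, y q • j ((φ n).eval (z q)) = n := by
  obtain ⟨φ, hφ, -⟩ := hN.2 (Coind ι M) (h.toCoind M).toAddMonoidHom (h.toCoind M).map_smulₛₗ
  refine ⟨φ, hφ, LinearMap.range_eq_top.1 (eq_top_iff.2 ?_), fun n => ?_⟩
  · rw [← h.span_range_toCoind, Submodule.span_le]
    rintro _ ⟨m, rfl⟩
    exact ⟨j m, hφ m⟩
  · have hn : n ∈ Submodule.span S (Set.range j) := hN.span_range ▸ Submodule.mem_top
    induction hn using Submodule.closure_induction with
    | zero =>
      rw [map_zero]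
      refine Finset.sum_eq_zero fun q _ => ?_
      have h0 : Coind.eval (0 : Coind ι M) (z q) = 0 := rfl
      rw [h0, map_zero, smul_zero]
    | add x x' _ _ hx hx' =>
      conv_rhs => rw [← hx, ← hx', ← Finset.sum_add_distrib]
      refine Finset.sum_congr rfl fun q _ => ?_
      rw [← smul_add, ← map_add, map_add φ]
      rfl
    | smul_mem s n hn =>
      obtain ⟨m, rfl⟩ := hn
      conv_rhs => rw [← h.sum_mul' s, Finset.sum_smul]
      refine Finset.sum_congr rfl fun q _ => ?_
      rw [mul_smul, ← hN.1, map_smul, hφ]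
      rfl

end Induced

end FrobeniusSystem

section Transfer

variable {R S : Type u} [Ring R] [Ring S] {ι : R →+* S} {pr : S →+ R} {Q : Type*} [Fintype Q]
  {y z : Q → S} {σ : Q → R →+* R} {b : R} {M N : Type u} [AddCommGroup M] [Module R M]
  [AddCommGroup N] [Module S N] {j : M →+ N}

/-- The `b`-component of the restriction of an `S`-module. -/
abbrev ResBlock (ι : R →+* S) (hc : ∀ r : R, b * r = r * b) (X : Type u) [AddCommGroup X]
    [Module S X] : Type u :=
  blockComponent R b hc (Res ι X)

theorem IsInducedMod.exists_retract (h : IsFrobeniusSystem ι pr y z σ)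
    (hc : ∀ r : R, b * r = r * b) (hbM : ∀ m : M, b • m = m) (hN : IsInducedMod ι M N j) :
    ∃ (i : M →ₗ[R] ResBlock ι hc N) (p : ResBlock ι hc N →ₗ[R] M), p.comp i = LinearMap.id := by
  obtain ⟨φ, hφ, -, -⟩ := hN.exists_toCoind h
  let i : M →ₗ[R] Res ι N :=
    { toFun := fun m => j m, map_add' := j.map_add, map_smul' := hN.1 }
  refine ⟨i.codRestrict _ fun m => (i.map_smul b m).symm.trans (congrArg i (hbM m)),
    (resLift φ).comp (Submodule.subtype _), LinearMap.ext fun m => ?_⟩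
  change (φ (j m)).eval 1 = m
  rw [hφ, h.eval_toCoind, h.map_one, one_smul]

theorem IsInducedMod.inAdd_resBlock (h : IsFrobeniusSystem ι pr y z σ)
    (hc : ∀ r : R, b * r = r * b) (hbM : ∀ m : M, b • m = m) (hN : IsInducedMod ι M N j)
    (hσ : ∀ q, σ q b ≠ b → σ q b * b = 0)
    (hinv : ∀ q, σ q b = b → ∃ φ : M ≃+ M, ∀ (r : R) (m : M), φ (σ q r • m) = r • φ m) :
    InAdd R M (ResBlock ι hc N) := by
  classical
  obtain ⟨φ, hφ, -, hsum⟩ := hN.exists_toCoind h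
  let T := {q // σ q b = b}
  choose ψ hψ using fun q : T => hinv q q.2
  have hψ' (q : T) (r : R) (m : M) : (ψ q).symm (r • m) = σ q r • (ψ q).symm m :=
    (ψ q).injective (by rw [hψ, AddEquiv.apply_symm_apply, AddEquiv.apply_symm_apply])
  have hcomm (q) (r : R) (n : N) : (φ (ι r • n)).eval (z q) = σ q r • (φ n).eval (z q) := by
    rw [map_smul, Coind.eval_smul, h.mul_incl, Coind.eval_incl_mul]
  let α (q : T) : Res ι N →ₗ[R] M :=
    { toFun := fun n => ψ q ((φ n).eval (z q))
      map_add' := fun n n' => by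
        rw [← map_add]
        exact congrArg (fun f => ψ q (Coind.eval f (z q))) (φ.map_add n n')
      map_smul' := fun r n => (congrArg (ψ q) (hcomm q r n)).trans (hψ q r _) }
  let β (q : T) : M →ₗ[R] Res ι N :=
    { toFun := fun m => (y q • j ((ψ q).symm m) : N)
      map_add' := fun m m' => by
        rw [map_add, map_add]
        exact smul_add (A := N) (y q.1) _ _
      map_smul' := fun r m => by
        rw [hψ', hN.1, ← mul_smul, ← h.incl_mul, mul_smul]
        rfl }
  let γ (q : T) : M →ₗ[R] ResBlock ι hc N :=
    (β q).codRestrict _ fun m => ((β q).map_smul b m).symm.trans (congrArg (β q) (hbM m))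
  refine .of_pi (LinearMap.pi fun q : T => (α q).comp (Submodule.subtype _))
    (∑ q : T, (γ q).comp (LinearMap.proj q)) (LinearMap.ext fun c => Subtype.ext ?_)
  rw [LinearMap.comp_apply, LinearMap.sum_apply, Submodule.coe_sum]
  have hzero (q) (hq : σ q b ≠ b) : (φ (show N from c.1)).eval (z q) = 0 := by
    have h1 : ι b • (show N from c.1) = c.1 := c.2
    rw [← h1, hcomm, ← hbM ((φ _).eval _), ← mul_smul, hσ q hq, zero_smul]
  refine Eq.trans ?_ (hsum (show N from c.1))
  have h2 : ∀ q ∈ Finset.univ, y q • j ((φ (show N from c.1)).eval (z q)) ≠ 0 →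
      σ q b = b := fun q _ hne => by
    by_contra hq
    exact hne (by rw [hzero q hq, map_zero, smul_zero])
  rw [← Finset.sum_filter_of_ne h2, Finset.sum_subtype (p := fun q => σ q b = b) _ (by simp)]
  refine Finset.sum_congr rfl fun q _ => ?_
  change y q.1 • j ((ψ q).symm (ψ q _)) = _
  rw [AddEquiv.symm_apply_apply]
  rfl

theorem IsFrobeniusSystem.isBlockProj_resBlock (h : IsFrobeniusSystem ι pr y z σ)
    (hb : b * b = b) (hc : ∀ r : R, b * r = r * b) {P : Type u} [AddCommGroup P] [Module S P]
    {e : S} (hP : IsBlockProj e P) : IsBlockProj b (ResBlock ι hc P) := by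
  have := hP.projective
  have := hP.finite
  exact isBlockProj_blockComponent hb hc (h.projective_res P) (h.finite_res P)

theorem extendsAlong_resBlock_iff (hb : b * b = b) (hc : ∀ r : R, b * r = r * b) {P₁ P₀ : Type u}
    [AddCommGroup P₁] [Module S P₁] [AddCommGroup P₀] [Module S P₀] (u : P₁ →ₗ[S] P₀)
    {Y : Type u} [AddCommGroup Y] [Module R Y] (hY : ∀ y : Y, b • y = y) :
    ExtendsAlong (blockMap hc (resMap ι u)) Y ↔ ExtendsAlong u (Coind ι Y) :=
  (extendsAlong_blockMap_iff hb hc _ hY).trans (extendsAlong_resMap_iff u)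

theorem IsFrobeniusSystem.eq_zero_of_orthogonal (h : IsFrobeniusSystem ι pr y z σ)
    (hb : b * b = b) (hc : ∀ r : R, b * r = r * b) {P₁ P₀ : Type u}
    [AddCommGroup P₁] [Module S P₁] [AddCommGroup P₀] [Module S P₀] {u : P₁ →ₗ[S] P₀}
    (hZ : ∀ (X : Type u) [AddCommGroup X] [Module S X], IsTestModule (1 : S) u X →
      (∀ f : N →ₗ[S] X, f = 0) → ∀ x : X, x = 0)
    {Y : Type u} [AddCommGroup Y] [Module R Y]
    (hY : IsTestModule b (blockMap hc (resMap ι u)) Y)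
    (hNY : ∀ f : ResBlock ι hc N →ₗ[R] Y, f = 0) (v : Y) : v = 0 := by
  have := hY.finite
  have hX : h.toCoind Y v = 0 := by
    refine hZ (Coind ι Y) ⟨finite_of_span_eq_top (h.toCoind Y) h.span_range_toCoind, one_smul _,
      (extendsAlong_resBlock_iff hb hc u hY.smul_eq).1 hY.extendsAlong⟩ (fun g => ?_) _
    refine LinearMap.ext fun n => Coind.ext fun s => ?_
    rw [eval_eq_resLift]
    have h1 := LinearMap.congr_fun (hNY ((resLift g).comp (Submodule.subtype _)))
      (blockProj hb hc (Res ι N) (s • n : N))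
    refine (hY.smul_eq _).symm.trans (Eq.trans ?_ h1)
    exact ((resLift g).map_smul b _).symm
  have h2 := congrArg (fun f => Coind.eval f 1) hX
  rwa [h.eval_toCoind, h.map_one, one_smul] at h2

/-- If a module induced along a Frobenius extension of symmetric algebras is support `τ`-tilting,
then so is the original module, provided that it is stable under the twists fixing `b`. -/
theorem IsInducedMod.isSupportTauTiltingBlock (k : Type u) [Field k] [Algebra k R]
    [Module.Finite k R] [Algebra k S] [Module.Finite k S] {t : R →ₗ[k] k}
    (ht : IsSymmetrizingForm t) {t' : S →ₗ[k] k} (ht' : IsSymmetrizingForm t')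
    (h : IsFrobeniusSystem ι pr y z σ) (hb : b * b = b) (hc : ∀ r : R, b * r = r * b)
    [Module.Finite R M] (hbM : ∀ m : M, b • m = m) (hN : IsInducedMod ι M N j)
    (hσ : ∀ q, σ q b ≠ b → σ q b * b = 0)
    (hinv : ∀ q, σ q b = b → ∃ φ : M ≃+ M, ∀ (r : R) (m : M), φ (σ q r • m) = r • φ m)
    (hst : IsSupportTauTilting S N) : IsSupportTauTiltingBlock R b M := by
  have : Module.Finite S N :=
    IsFrobeniusSystem.finite_of_span_eq_top hN.toSemilinear hN.span_range
  obtain ⟨P₁, P₀, u, π₀, h1, h0, hπ₀, hu, hNT, hZ⟩ := hst.exists_presentation ht'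
  have := h1.projective
  obtain ⟨φ, -, hφ, -⟩ := hN.exists_toCoind h
  have h1' := h.isBlockProj_resBlock hb hc h1
  have h0' := h.isBlockProj_resBlock hb hc h0
  have hπ' : Function.Surjective (blockMap hc (resMap ι π₀)) := blockMap_surjective hb hc hπ₀
  have hu' : LinearMap.ker (blockMap hc (resMap ι π₀)) =
      LinearMap.range (blockMap hc (resMap ι u)) :=
    ker_blockMap_eq_range hb hc (SetLike.ext fun x => SetLike.ext_iff.1 hu x)
  have hMT : IsTestModule b (blockMap hc (resMap ι u)) M :=
    ⟨inferInstance, hbM,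
      (extendsAlong_resBlock_iff hb hc u hbM).2 (hNT.of_surjective φ hφ).extendsAlong⟩
  obtain ⟨i, p, hp⟩ := hN.exists_retract h hc hbM
  have := h1'.projective
  have := h0'.projective
  refine ⟨hbM, isTauRigid_of_extendsAlong ht fun P _ _ π hπ W => ?_,
    exists_numIndec_add_eq (k := k) hb hc h1' h0' hπ' hu' hMT
      (hN.inAdd_resBlock h hc hbM hσ hinv) ((InAdd.refl _).of_retract i p hp)
      fun Y _ _ hY hNY => h.eq_zero_of_orthogonal hb hc hZ hY hNY⟩
  have := hπ.1
  exact ((hMT.of_surjective W.mkQ W.mkQ_surjective).extendsAlong.extendsFromKernel hu').of_retract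
    hπ' hπ.2.1 i p hp

end Transfer

section GroupAlgebra

theorem IsBlockIdem.eq_or_mul_eq_zero {A : Type u} [Ring A] {b c : A} (hb : IsBlockIdem A b)
    (hc : IsBlockIdem A c) : c = b ∨ c * b = 0 := by
  have hcomm := hb.2.2.1 c
  have hcen (r : A) : c * b * r = r * (c * b) := by
    rw [mul_assoc, hb.2.2.1, ← mul_assoc, hc.2.2.1, mul_assoc]
  have hidem : c * b * (c * b) = c * b := by
    rw [mul_assoc, ← mul_assoc b c b, hcomm, mul_assoc c b b, hb.2.1, ← mul_assoc, hc.2.1]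
  have hle : b * (c * b) = c * b := by rw [← mul_assoc, hcomm, mul_assoc, hb.2.1]
  rcases hb.2.2.2 _ hidem hcen hle with h | h
  · exact .inr h
  · exact .inl ((hc.2.2.2 b hb.2.1 hb.2.2.1 h).resolve_left hb.1).symm

theorem IsBlockIdem.map {A : Type u} [Ring A] {b : A} (hb : IsBlockIdem A b) (e : A ≃+* A) :
    IsBlockIdem A (e b) := by
  refine ⟨fun h => hb.1 (e.injective (h.trans (map_zero e).symm)), by rw [← map_mul, hb.2.1],
    fun r => ?_, fun c h1 h2 h3 => ?_⟩
  · rw [← e.apply_symm_apply r, ← map_mul, hb.2.2.1, map_mul]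
  · have h := hb.2.2.2 (e.symm c) (by rw [← map_mul, h1])
      (fun r => by rw [← e.symm_apply_apply r, ← map_mul, h2, map_mul])
      (e.injective (by rw [map_mul, e.apply_symm_apply, h3]))
    exact h.imp (fun h => by rw [← e.apply_symm_apply c, h, map_zero])
      fun h => by rw [← e.apply_symm_apply c, h]

variable (k : Type u) [Field k] {Gt : Type u} [Group Gt] (G : Subgroup Gt)

/-- The projection of `kG̃` onto `kG` which kills the group elements outside `G`. -/
noncomputable def groupAlgebraProj : MonoidAlgebra k Gt →+ MonoidAlgebra k G where
  toFun := fun s => .ofCoeff (s.coeff.comapDomain Subtype.val Subtype.val_injective.injOn)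
  map_zero' := MonoidAlgebra.ext (Finsupp.ext fun _ => rfl)
  map_add' _ _ := MonoidAlgebra.ext (Finsupp.ext fun _ => rfl)

variable {k G}

theorem coeff_groupAlgebraProj (s : MonoidAlgebra k Gt) (g : G) :
    (groupAlgebraProj k G s).coeff g = s.coeff g := rfl

theorem groupAlgebraProj_single_of_mem (g : G) (c : k) :
    groupAlgebraProj k G (.single g c) = .single g c := by
  classical
  refine MonoidAlgebra.ext (Finsupp.ext fun x => ?_)
  rw [coeff_groupAlgebraProj, MonoidAlgebra.coeff_single, MonoidAlgebra.coeff_single,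
    Finsupp.single_apply, Finsupp.single_apply]
  simp only [Subtype.ext_iff]

theorem groupAlgebraProj_single_of_notMem {g : Gt} (hg : g ∉ G) (c : k) :
    groupAlgebraProj k G (.single g c) = 0 := by
  classical
  refine MonoidAlgebra.ext (Finsupp.ext fun x => ?_)
  rw [coeff_groupAlgebraProj, MonoidAlgebra.coeff_single, Finsupp.single_apply,
    if_neg (ne_of_mem_of_not_mem x.2 hg).symm]
  rfl

theorem inclRingHom_single (g : G) (c : k) :
    inclRingHom k Gt G (.single g c) = .single (g : Gt) c :=
  MonoidAlgebra.mapDomain_single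

theorem groupAlgebraProj_incl_mul (r : MonoidAlgebra k G) (s : MonoidAlgebra k Gt) :
    groupAlgebraProj k G (inclRingHom k Gt G r * s) = r * groupAlgebraProj k G s := by
  induction r using MonoidAlgebra.induction_linear with
  | zero => simp
  | add r r' h h' => rw [map_add, add_mul, map_add, h, h', add_mul]
  | single g c =>
    refine MonoidAlgebra.ext (Finsupp.ext fun x => ?_)
    rw [inclRingHom_single, coeff_groupAlgebraProj, MonoidAlgebra.coeff_single_mul_apply,
      MonoidAlgebra.coeff_single_mul_apply, coeff_groupAlgebraProj]
    rfl

theorem groupAlgebraProj_mul_incl (s : MonoidAlgebra k Gt) (r : MonoidAlgebra k G) :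
    groupAlgebraProj k G (s * inclRingHom k Gt G r) = groupAlgebraProj k G s * r := by
  induction r using MonoidAlgebra.induction_linear with
  | zero => simp
  | add r r' h h' => rw [map_add, mul_add, map_add, h, h', mul_add]
  | single g c =>
    refine MonoidAlgebra.ext (Finsupp.ext fun x => ?_)
    rw [inclRingHom_single, coeff_groupAlgebraProj, MonoidAlgebra.coeff_mul_single_apply,
      MonoidAlgebra.coeff_mul_single_apply, coeff_groupAlgebraProj]
    rfl

variable [G.Normal]

theorem conjRingHom_single (x : Gt) (g : G) (c : k) :
    conjRingHom k Gt G x (.single g c) = .single (MulAut.conjNormal x g) c :=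
  MonoidAlgebra.mapDomain_single

theorem inclRingHom_mul_single (x : Gt) (r : MonoidAlgebra k G) :
    inclRingHom k Gt G r * .single x⁻¹ 1 =
      .single x⁻¹ 1 * inclRingHom k Gt G (conjRingHom k Gt G x r) := by
  induction r using MonoidAlgebra.induction_linear with
  | zero => simp
  | add r r' h h' => rw [map_add, map_add, map_add, add_mul, mul_add, h, h']
  | single g c =>
    rw [conjRingHom_single, inclRingHom_single, inclRingHom_single,
      MonoidAlgebra.single_mul_single, MonoidAlgebra.single_mul_single, mul_one, one_mul,
      MulAut.conjNormal_apply]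
    congr 1
    group

theorem single_mul_inclRingHom (x : Gt) (r : MonoidAlgebra k G) :
    .single x 1 * inclRingHom k Gt G r =
      inclRingHom k Gt G (conjRingHom k Gt G x r) * .single x 1 := by
  induction r using MonoidAlgebra.induction_linear with
  | zero => simp
  | add r r' h h' => rw [map_add, map_add, map_add, add_mul, mul_add, h, h']
  | single g c =>
    rw [conjRingHom_single, inclRingHom_single, inclRingHom_single,
      MonoidAlgebra.single_mul_single, MonoidAlgebra.single_mul_single, mul_one, one_mul,
      MulAut.conjNormal_apply]
    congr 1
    group

theorem isFrobeniusSystem_inclRingHom [Fintype (Gt ⧸ G)] :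
    IsFrobeniusSystem (inclRingHom k Gt G) (groupAlgebraProj k G)
      (fun q : Gt ⧸ G => .single q.out⁻¹ 1) (fun q => .single q.out 1)
      (fun q => conjRingHom k Gt G q.out) where
  map_one := by
    rw [MonoidAlgebra.one_def, ← G.coe_one, groupAlgebraProj_single_of_mem]
    rfl
  map_incl_mul := groupAlgebraProj_incl_mul
  map_mul_incl := groupAlgebraProj_mul_incl
  sum_mul s := by
    classical
    induction s using MonoidAlgebra.induction_linear with
    | zero => simp
    | add s s' h h' =>
      conv_rhs => rw [← h, ← h']
      simp only [add_mul, map_add, Finset.sum_add_distrib]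
    | single g c =>
      rw [Finset.sum_eq_single (g : Gt ⧸ G)]
      · have hg : g * (g : Gt ⧸ G).out⁻¹ ∈ G :=
          Subgroup.Normal.mem_comm ‹_› (QuotientGroup.eq.1 (QuotientGroup.out_eq' (g : Gt ⧸ G)))
        rw [MonoidAlgebra.single_mul_single,
          show g * (g : Gt ⧸ G).out⁻¹ = ((⟨_, hg⟩ : G) : Gt) from rfl,
          groupAlgebraProj_single_of_mem, inclRingHom_single, MonoidAlgebra.single_mul_single]
        simp
      · intro q _ hq
        have hg : g * q.out⁻¹ ∉ G := fun h => hq <| by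
          rw [← QuotientGroup.out_eq' q]
          exact QuotientGroup.eq.2 (Subgroup.Normal.mem_comm ‹_› h)
        rw [MonoidAlgebra.single_mul_single, groupAlgebraProj_single_of_notMem hg, map_zero,
          zero_mul]
      · simp
  sum_mul' s := by
    classical
    induction s using MonoidAlgebra.induction_linear with
    | zero => simp
    | add s s' h h' =>
      conv_rhs => rw [← h, ← h']
      simp only [mul_add, map_add, Finset.sum_add_distrib]
    | single g c =>
      rw [Finset.sum_eq_single (g⁻¹ : Gt ⧸ G)]
      · have hg : (g⁻¹ : Gt ⧸ G).out * g ∈ G :=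
          Subgroup.Normal.mem_comm ‹_› <| by
            simpa using G.inv_mem (QuotientGroup.eq.1 (QuotientGroup.out_eq' (g⁻¹ : Gt ⧸ G)))
        rw [MonoidAlgebra.single_mul_single,
          show (g⁻¹ : Gt ⧸ G).out * g = ((⟨_, hg⟩ : G) : Gt) from rfl,
          groupAlgebraProj_single_of_mem, inclRingHom_single, MonoidAlgebra.single_mul_single]
        simp
      · intro q _ hq
        have hg : q.out * g ∉ G := fun h => hq <| by
          rw [← QuotientGroup.out_eq' q]
          exact QuotientGroup.eq.2 (by
            simpa using G.inv_mem (Subgroup.Normal.mem_comm ‹_› h))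
        rw [MonoidAlgebra.single_mul_single, groupAlgebraProj_single_of_notMem hg, map_zero,
          mul_zero]
      · simp
  incl_mul q := inclRingHom_mul_single q.out
  mul_incl q := single_mul_inclRingHom q.out

/-- The automorphism of `kG` induced by conjugation with `x`. -/
noncomputable def conjRingEquiv (x : Gt) : MonoidAlgebra k G ≃+* MonoidAlgebra k G :=
  MonoidAlgebra.mapDomainRingEquiv k (MulAut.conjNormal (H := G) x)

end GroupAlgebra

/-- If `M` is an `I_{G̃}(B)`-invariant `B`-module such that
`Ind_G^{G̃} M` is a support τ-tilting `kG̃`-module, then `M` is a support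
τ-tilting `B`-module. -/
theorem isSupportTauTiltingBlock_of_induced
    (k : Type u) [Field k] [IsAlgClosed k] (p : ℕ) (hp : 0 < p) [CharP k p]
    (Gt : Type u) [Group Gt] [Fintype Gt] (G : Subgroup Gt) [G.Normal]
    (b : MonoidAlgebra k ↥G) (hb : IsBlockIdem (MonoidAlgebra k ↥G) b)
    (M : Type u) [AddCommGroup M] [Module (MonoidAlgebra k ↥G) M]
    [Module.Finite (MonoidAlgebra k ↥G) M]
    (hbM : ∀ m : M, b • m = m)
    (hinv : ∀ x : Gt, conjRingHom k Gt G x b = b → IsConjStable k Gt G x M)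
    (N : Type u) [AddCommGroup N] [Module (MonoidAlgebra k Gt) N]
    (jM : M →+ N) (hN : IsInducedMod (inclRingHom k Gt G) M N jM)
    (hst : IsSupportTauTilting (MonoidAlgebra k Gt) N) :
    IsSupportTauTiltingBlock (MonoidAlgebra k ↥G) b M := by
  have := Fintype.ofFinite (Gt ⧸ G)
  obtain ⟨t, ht⟩ := isSymmetrizingForm_coeff_one k G
  obtain ⟨t', ht'⟩ := isSymmetrizingForm_coeff_one k Gt
  exact hN.isSupportTauTiltingBlock k ht ht' isFrobeniusSystem_inclRingHom hb.2.1 hb.2.2.1 hbM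
    (fun q hq => (hb.eq_or_mul_eq_zero (hb.map (conjRingEquiv q.out))).resolve_left hq)
    (fun q => hinv q.out) hst
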